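/- For every m, n ≥ 1 there is an essentially surjective, full k-linear superfunctor from Udot(p̃(m)) to p(n)-mod_{S,m} which sends an object λ = Σ_{i=1}^m λ_i ε_i with all λ_i ≥ 0 to the p(n)-supermodule S^{λ_1}(V_n) ⊗ ⋯ ⊗ S^{λ_m}(V_n), and sends every object λ ∉ X(T_m)_{≥0} to the zero module. -/

import Mathlib

/-!
Core: a concrete model of the supersymmetric algebra
`S(U) = S(Y_F ⊗ V_L)` (with `F` purely even "tensor slots" and `V_L = k^{L|L}`)
via its monomial basis.  A basis monomial is a pair `(d, ε)` where
`d : Fin F × Fin L → ℕ` records the exponents of the even variables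
`z_{i,ℓ}` (`ℓ > 0`) and `ε : Fin F × Fin L → Bool` records the occurrences of
the odd variables `z_{i,-ℓ}`, the odd variables being ordered
lexicographically by position `(i, ℓ)`.  The multiplication and derivation
operators `z_{i,±ℓ}` and `∂_{i,±ℓ}` are defined on this basis with the signs
dictated by supercommutativity.  The same space also models
`S(U') = S(W_F ⊗ Y_L)` (with `W_F = k^{F|F}`), via the variables
`z'_{±i,ℓ}`, the odd variable `z'_{-i,ℓ}` occupying the position `(i,ℓ)`.
-/

/-- The index set `I_{L|L}` (`inl` = positive/even, `inr` = negative/odd). -/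
abbrev Ix (L : ℕ) := Fin L ⊕ Fin L

/-- Negation `r ↦ -r` on `I_{L|L}`. -/
def nIx {L : ℕ} : Ix L → Ix L := Sum.elim Sum.inr Sum.inl

/-- `(-1)^{|r|}` for `r ∈ I_{L|L}`. -/
def sgn (k : Type) [Field k] {L : ℕ} : Ix L → k :=
  Sum.elim (fun _ => (1:k)) (fun _ => (-1:k))

/-- Basis monomials: even exponents and odd occurrence flags. -/
abbrev MonB (F L : ℕ) := (Fin F × Fin L → ℕ) × (Fin F × Fin L → Bool)

variable (k : Type) [Field k]

/-- The model of `S(Y_F ⊗ V_L)` (equivalently of `S(W_F ⊗ Y_L)`). -/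
abbrev SM (F L : ℕ) := MonB F L →₀ k

noncomputable def bvec (F L : ℕ) (b : MonB F L) : SM k F L := Finsupp.single b 1

/-- The vacuum monomial `1`. -/
noncomputable def vac (F L : ℕ) : SM k F L := bvec k F L (fun _ => 0, fun _ => false)

/-- Extend a map defined on basis monomials to a linear endomorphism. -/
noncomputable def opOf (F L : ℕ) (f : MonB F L → SM k F L) :
    Module.End k (SM k F L) := Finsupp.linearCombination k f

/-- Position code of `(i,ℓ)` (lexicographic). -/
def posIdx {F L : ℕ} (p : Fin F × Fin L) : ℕ := p.1.val * L + p.2.val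

/-- The number of odd variables occurring strictly before position `p`. -/
noncomputable def oddBefore {F L : ℕ} (ε : Fin F × Fin L → Bool)
    (p : Fin F × Fin L) : ℕ :=
  (Finset.univ.filter fun q : Fin F × Fin L => posIdx q < posIdx p ∧ ε q = true).card

/-- Multiplication by the even variable at position `(i,ℓ)`. -/
noncomputable def zE (F L : ℕ) (i : Fin F) (j : Fin L) : Module.End k (SM k F L) :=
  opOf k F L fun b =>
    bvec k F L (Function.update b.1 (i, j) (b.1 (i, j) + 1), b.2)

/-- Derivation with respect to the even variable at position `(i,ℓ)`. -/
noncomputable def dE (F L : ℕ) (i : Fin F) (j : Fin L) : Module.End k (SM k F L) :=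
  opOf k F L fun b =>
    (b.1 (i, j) : k) • bvec k F L (Function.update b.1 (i, j) (b.1 (i, j) - 1), b.2)

/-- (Left) multiplication by the odd variable at position `(i,ℓ)`. -/
noncomputable def zO (F L : ℕ) (i : Fin F) (j : Fin L) : Module.End k (SM k F L) :=
  opOf k F L fun b =>
    if b.2 (i, j) then 0
    else ((-1:k) ^ oddBefore b.2 (i, j)) •
      bvec k F L (b.1, Function.update b.2 (i, j) true)

/-- (Left) derivation with respect to the odd variable at position `(i,ℓ)`. -/
noncomputable def dO (F L : ℕ) (i : Fin F) (j : Fin L) : Module.End k (SM k F L) :=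
  opOf k F L fun b =>
    if b.2 (i, j) then
      ((-1:k) ^ oddBefore b.2 (i, j)) •
        bvec k F L (b.1, Function.update b.2 (i, j) false)
    else 0

/-- Multiplication by the variable `z_{i,r}`, `r ∈ I_{L|L}`. -/
noncomputable def zop (F L : ℕ) (i : Fin F) (r : Ix L) : Module.End k (SM k F L) :=
  Sum.elim (zE k F L i) (zO k F L i) r

/-- The derivation `∂_{i,r}`, `r ∈ I_{L|L}`. -/
noncomputable def dop (F L : ℕ) (i : Fin F) (r : Ix L) : Module.End k (SM k F L) :=
  Sum.elim (dE k F L i) (dO k F L i) r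

/-- `𝙴_{a,b} = Σ_{p=1}^F z_{p,a} ∂_{p,b}` for `a, b ∈ I_{L|L}`: the operator by
which the matrix unit `E_{a,b} ∈ gl(L|L)` acts naturally on `S(Y_F ⊗ V_L)`. -/
noncomputable def EEop (F L : ℕ) (a b : Ix L) : Module.End k (SM k F L) :=
  ∑ p : Fin F, zop k F L p a * dop k F L p b

/-- `𝙰_{i,j} = 𝙴_{i,j} - 𝙴_{-j,-i}`: the natural action of `a_{i,j} ∈ p(L)`. -/
noncomputable def opA (F L : ℕ) (i j : Fin L) : Module.End k (SM k F L) :=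
  EEop k F L (Sum.inl i) (Sum.inl j) - EEop k F L (Sum.inr j) (Sum.inr i)

/-- `𝙱_{i,j} = 𝙴_{i,-j} + 𝙴_{j,-i}` (`i < j`), `𝙱_{i,i} = 𝙴_{i,-i}`: the
natural action of `b_{i,j} ∈ p(L)`. -/
noncomputable def opB (F L : ℕ) (i j : Fin L) : Module.End k (SM k F L) :=
  if i = j then EEop k F L (Sum.inl i) (Sum.inr i)
  else EEop k F L (Sum.inl i) (Sum.inr j) + EEop k F L (Sum.inl j) (Sum.inr i)

/-- `𝙲_{i,j} = 𝙴_{-i,j} - 𝙴_{-j,i}` (`i < j`): the natural action of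
`c_{i,j} ∈ p(L)`. -/
noncomputable def opC (F L : ℕ) (i j : Fin L) : Module.End k (SM k F L) :=
  EEop k F L (Sum.inr i) (Sum.inl j) - EEop k F L (Sum.inr j) (Sum.inl i)

/-- `Ã_{i,j} = Σ_{r ∈ I_{L|L}} z_{i,r} ∂_{j,r} - L·δ_{i,j}` (`1 ≤ i,j ≤ F`). -/
noncomputable def tA (F L : ℕ) (i j : Fin F) : Module.End k (SM k F L) :=
  (∑ r : Ix L, zop k F L i r * dop k F L j r) - (if i = j then (L : k) • 1 else 0)

/-- `B̃_{i,j} = Σ_{r ∈ I_{L|L}} ∂_{i,r} ∂_{j,-r}` (`i ≠ j`), and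
`B̃_{i,i} = Σ_{r=1}^{L} ∂_{i,r} ∂_{i,-r}`. -/
noncomputable def tB (F L : ℕ) (i j : Fin F) : Module.End k (SM k F L) :=
  if i = j then ∑ q : Fin L, dE k F L i q * dO k F L i q
  else ∑ r : Ix L, dop k F L i r * dop k F L j (nIx r)

/-- `C̃_{i,j} = Σ_{r ∈ I_{L|L}} (-1)^{|r|} z_{i,r} z_{j,-r}` (`i < j`). -/
noncomputable def tC (F L : ℕ) (i j : Fin F) : Module.End k (SM k F L) :=
  ∑ r : Ix L, sgn k r • (zop k F L i r * zop k F L j (nIx r))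

/-- Multiplication by the variable `z'_{a,ℓ}`, `a ∈ I_{F|F}`, of
`S(W_F ⊗ Y_L)` in the same model. -/
noncomputable def zop2 (F L : ℕ) (a : Ix F) (j : Fin L) : Module.End k (SM k F L) :=
  Sum.elim (fun i => zE k F L i j) (fun i => zO k F L i j) a

/-- The derivation `∂'_{a,ℓ}`, `a ∈ I_{F|F}`. -/
noncomputable def dop2 (F L : ℕ) (a : Ix F) (j : Fin L) : Module.End k (SM k F L) :=
  Sum.elim (fun i => dE k F L i j) (fun i => dO k F L i j) a

/-- `𝙴'_{a,b} = Σ_{p=1}^L z'_{a,p} ∂'_{b,p}` for `a, b ∈ I_{F|F}`: the natural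
action of the matrix unit `E_{a,b} ∈ gl(F|F)` on `S(W_F ⊗ Y_L)`. -/
noncomputable def EE2op (F L : ℕ) (a b : Ix F) : Module.End k (SM k F L) :=
  ∑ p : Fin L, zop2 k F L a p * dop2 k F L b p

/-- `Ã'_{i,j} = 𝙴'_{i,j} - 𝙴'_{-j,-i}`: the natural action of
`ã_{i,j} ∈ p̃(F)`. -/
noncomputable def opA2 (F L : ℕ) (i j : Fin F) : Module.End k (SM k F L) :=
  EE2op k F L (Sum.inl i) (Sum.inl j) - EE2op k F L (Sum.inr j) (Sum.inr i)

/-- `B̃'_{i,j} = 𝙴'_{-i,j} + 𝙴'_{-j,i}` (`i < j`), `B̃'_{i,i} = 𝙴'_{-i,i}`: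
the natural action of `b̃_{i,j} ∈ p̃(F)`. -/
noncomputable def opB2 (F L : ℕ) (i j : Fin F) : Module.End k (SM k F L) :=
  if i = j then EE2op k F L (Sum.inr i) (Sum.inl i)
  else EE2op k F L (Sum.inr i) (Sum.inl j) + EE2op k F L (Sum.inr j) (Sum.inl i)

/-- `C̃'_{i,j} = 𝙴'_{i,-j} - 𝙴'_{j,-i}` (`i < j`): the natural action of
`c̃_{i,j} ∈ p̃(F)`. -/
noncomputable def opC2 (F L : ℕ) (i j : Fin F) : Module.End k (SM k F L) :=
  EE2op k F L (Sum.inl i) (Sum.inr j) - EE2op k F L (Sum.inl j) (Sum.inr i)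

/-- `θ'(a_{i,j}) = Σ_{r ∈ I_{F|F}} z'_{r,i} ∂'_{r,j} - F·δ_{i,j}`. -/
noncomputable def pA2 (F L : ℕ) (i j : Fin L) : Module.End k (SM k F L) :=
  (∑ r : Ix F, zop2 k F L r i * dop2 k F L r j) - (if i = j then (F : k) • 1 else 0)

/-- `θ'(b_{i,j}) = Σ_{r ∈ I_{F|F}} z'_{r,i} z'_{-r,j}` (`i ≠ j`), and
`θ'(b_{i,i}) = Σ_{r=1}^{F} z'_{r,i} z'_{-r,i}`. -/
noncomputable def pB2 (F L : ℕ) (i j : Fin L) : Module.End k (SM k F L) :=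
  if i = j then ∑ s : Fin F, zop2 k F L (Sum.inl s) i * zop2 k F L (Sum.inr s) i
  else ∑ r : Ix F, zop2 k F L r i * zop2 k F L (nIx r) j

/-- `θ'(c_{i,j}) = Σ_{r ∈ I_{F|F}} (-1)^{|r|} ∂'_{-r,i} ∂'_{r,j}` (`i < j`). -/
noncomputable def pC2 (F L : ℕ) (i j : Fin L) : Module.End k (SM k F L) :=
  ∑ r : Ix F, sgn k r • (dop2 k F L (nIx r) i * dop2 k F L r j)

/-- A monomial is even if it contains an even number of odd variables. -/
def evenMon {F L : ℕ} (b : MonB F L) : Prop :=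
  (Finset.univ.filter fun p : Fin F × Fin L => b.2 p = true).card % 2 = 0

noncomputable instance {F L : ℕ} (b : MonB F L) : Decidable (evenMon b) := by
  unfold evenMon; infer_instance

/-- The even part of the model of `S(U)`. -/
noncomputable def SMev (F L : ℕ) : Submodule k (SM k F L) where
  carrier := {s | ∀ b, ¬ evenMon b → s b = 0}
  add_mem' := by
    intro a b ha hb b' hb'
    simp [Finsupp.add_apply, ha b' hb', hb b' hb']
  zero_mem' := by intro b _; simp
  smul_mem' := by
    intro c a ha b hb
    simp [Finsupp.smul_apply, ha b hb]

/-- The odd part of the model of `S(U)`. -/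
noncomputable def SMod (F L : ℕ) : Submodule k (SM k F L) where
  carrier := {s | ∀ b, evenMon b → s b = 0}
  add_mem' := by
    intro a b ha hb b' hb'
    simp [Finsupp.add_apply, ha b' hb', hb b' hb']
  zero_mem' := by intro b _; simp
  smul_mem' := by
    intro c a ha b hb
    simp [Finsupp.smul_apply, ha b hb]

/-- Projection onto the even part. -/
noncomputable def Pe (F L : ℕ) : Module.End k (SM k F L) :=
  opOf k F L fun b => if evenMon b then bvec k F L b else 0

/-- Projection onto the odd part. -/
noncomputable def Po (F L : ℕ) : Module.End k (SM k F L) :=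
  opOf k F L fun b => if evenMon b then 0 else bvec k F L b

/-- The even component of an operator. -/
noncomputable def evPart (F L : ℕ) (f : Module.End k (SM k F L)) :
    Module.End k (SM k F L) :=
  Pe k F L * f * Pe k F L + Po k F L * f * Po k F L

/-- The odd component of an operator. -/
noncomputable def odPart (F L : ℕ) (f : Module.End k (SM k F L)) :
    Module.End k (SM k F L) :=
  Pe k F L * f * Po k F L + Po k F L * f * Pe k F L

/-- An operator is even if its odd component vanishes. -/
def IsEvenOp (F L : ℕ) (f : Module.End k (SM k F L)) : Prop := odPart k F L f = 0
/-- An operator is odd if its even component vanishes. -/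
def IsOddOp (F L : ℕ) (f : Module.End k (SM k F L)) : Prop := evPart k F L f = 0

/-- The supercommutator `[g, f]`, extended bilinearly from homogeneous
components: `[g,f] = g∘f - f∘g + 2·(odd part of f)∘(odd part of g)`. -/
noncomputable def sbrk (F L : ℕ) (g f : Module.End k (SM k F L)) :
    Module.End k (SM k F L) :=
  g * f - f * g + (2:k) • (odPart k F L f * odPart k F L g)

/-- The supercommutator `[g, f]` for an *even* `g`. -/
noncomputable def evComm (F L : ℕ) (g f : Module.End k (SM k F L)) :
    Module.End k (SM k F L) := g * f - f * g

/-- The supercommutator `[g, f]` for an *odd* (homogeneous) `g`: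
`[g,f] = g∘f - (even part of f)∘g + (odd part of f)∘g`. -/
noncomputable def odComm (F L : ℕ) (g f : Module.End k (SM k F L)) :
    Module.End k (SM k F L) :=
  g * f - evPart k F L f * g + odPart k F L f * g

/-- The Weyl–Clifford superalgebra `WC(U)`: the subalgebra of `End(S(U))`
generated by the multiplication operators and the superderivations. -/
noncomputable def WCsub (F L : ℕ) : Subalgebra k (Module.End k (SM k F L)) :=
  Algebra.adjoin k
    ({f | ∃ p r, f = zop k F L p r} ∪ {f | ∃ p r, f = dop k F L p r})

/-!
Core: the idempotented (Lusztig) forms `U̇(p(n))` and `U̇(p̃(m))`, presented as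
(unital hulls of) locally unital algebras: the generators are the morphisms
`X 1_λ` of the supercategories `Udot(p(n))` resp. `Udot(p̃(m))`, where
`λ ∈ X(T) = ⊕ ℤε_i` runs over the weight lattice, together with the weight
idempotents `1_λ`, subject to the idempotented forms (U1)–(U11) resp.
(Ũ1)–(Ũ11) of the defining relations.
-/

/-- Generators: `1_λ`, `E_i 1_λ`, `F_i 1_λ`, `B_{1,1} 1_λ`, `B_i 1_λ`,
`C_i 1_λ` (1-based `i`). -/
inductive DGen (m : ℕ) : Type
  | idem (l : Fin m → ℤ)
  | ge (i : ℕ) (l : Fin m → ℤ)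
  | gf (i : ℕ) (l : Fin m → ℤ)
  | gb11 (l : Fin m → ℤ)
  | gb (i : ℕ) (l : Fin m → ℤ)
  | gc (i : ℕ) (l : Fin m → ℤ)

/-- `ε_i ∈ X(T_m)` (1-based). -/
def epsw (m i : ℕ) : Fin m → ℤ := fun t => if t.val + 1 = i then 1 else 0
/-- `α_i = ε_i - ε_{i+1}`. -/
def alw (m i : ℕ) : Fin m → ℤ := epsw m i - epsw m (i+1)
/-- `β_i = ε_i + ε_{i+1}`. -/
def btw (m i : ℕ) : Fin m → ℤ := epsw m i + epsw m (i+1)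
/-- `2 ε_1`. -/
def b11w (m : ℕ) : Fin m → ℤ := (2:ℤ) • epsw m 1

/-- `λ_i` (the coefficient of `ε_i` in `λ`; 1-based, `0` out of range). -/
def cf (m : ℕ) (l : Fin m → ℤ) (i : ℕ) : ℤ :=
  if h : 1 ≤ i ∧ i ≤ m then l ⟨i-1, by omega⟩ else 0

/-- `(α_i, λ) = λ_i - λ_{i+1}`. -/
def alpair (m : ℕ) (l : Fin m → ℤ) (i : ℕ) : ℤ := cf m l i - cf m l (i+1)

/-- A "weighted operator": a natural transformation `λ ↦ (morphism λ → λ+wt)`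
in the free algebra on the generators; used to write the relations
uniformly. -/
structure WOp (k : Type) [Field k] (m : ℕ) where
  wt : Fin m → ℤ
  op : (Fin m → ℤ) → FreeAlgebra k (DGen m)

variable {k} in
/-- Composition of weighted operators. -/
noncomputable def WOp.comp {m : ℕ} (x y : WOp k m) : WOp k m :=
  ⟨x.wt + y.wt, fun l => x.op (l + y.wt) * y.op l⟩

variable {k} in
/-- Commutator of weighted operators. -/
noncomputable def WOp.cmm {m : ℕ} (x y : WOp k m) : WOp k m :=
  ⟨x.wt + y.wt, fun l => (x.comp y).op l - (y.comp x).op l⟩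

variable {k} in
/-- Anticommutator of weighted operators. -/
noncomputable def WOp.acm {m : ℕ} (x y : WOp k m) : WOp k m :=
  ⟨x.wt + y.wt, fun l => (x.comp y).op l + (y.comp x).op l⟩

noncomputable def wE (m i : ℕ) : WOp k m :=
  ⟨alw m i, fun l => FreeAlgebra.ι k (DGen.ge i l)⟩
noncomputable def wF (m i : ℕ) : WOp k m :=
  ⟨-(alw m i), fun l => FreeAlgebra.ι k (DGen.gf i l)⟩
/-- `B_i` for `U̇(p(n))`: weight `+β_i`. -/
noncomputable def wB (m i : ℕ) : WOp k m :=
  ⟨btw m i, fun l => FreeAlgebra.ι k (DGen.gb i l)⟩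
/-- `C_i` for `U̇(p(n))`: weight `-β_i`. -/
noncomputable def wC (m i : ℕ) : WOp k m :=
  ⟨-(btw m i), fun l => FreeAlgebra.ι k (DGen.gc i l)⟩
/-- `B_{1,1}` for `U̇(p(n))`: weight `2ε_1`. -/
noncomputable def wB11 (m : ℕ) : WOp k m :=
  ⟨b11w m, fun l => FreeAlgebra.ι k (DGen.gb11 l)⟩
/-- `B̃_i` for `U̇(p̃(m))`: weight `-β̃_i = -(ε_i + ε_{i+1})`. -/
noncomputable def wBt (m i : ℕ) : WOp k m :=
  ⟨-(btw m i), fun l => FreeAlgebra.ι k (DGen.gb i l)⟩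
/-- `C̃_i` for `U̇(p̃(m))`: weight `+(ε_i + ε_{i+1})`. -/
noncomputable def wCt (m i : ℕ) : WOp k m :=
  ⟨btw m i, fun l => FreeAlgebra.ι k (DGen.gc i l)⟩
/-- `B̃_{1,1}` for `U̇(p̃(m))`: weight `-2ε_1`. -/
noncomputable def wB11t (m : ℕ) : WOp k m :=
  ⟨-(b11w m), fun l => FreeAlgebra.ι k (DGen.gb11 l)⟩

noncomputable def iId (m : ℕ) (l : Fin m → ℤ) : FreeAlgebra k (DGen m) :=
  FreeAlgebra.ι k (DGen.idem l)

/-- Admissible index: `1 ≤ i ≤ m - 1`. -/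
def okEd (m i : ℕ) : Prop := 1 ≤ i ∧ i + 1 ≤ m

/-- The defining relations of the idempotented form `U̇(p(n))`
((U1)–(U11) of Davidson–Kujawa–Muth, Definition `Udot(p(n))`), together with
the idempotent relations and relations killing out-of-range generators. -/
inductive DRelU (n : ℕ) :
    FreeAlgebra k (DGen n) → FreeAlgebra k (DGen n) → Prop
  -- idempotents
  | idem2 (l l' : Fin n → ℤ) :
      DRelU n (iId k n l * iId k n l') (if l = l' then iId k n l else 0)
  -- sources and targets of the generators
  | srcE (i : ℕ) (l l' : Fin n → ℤ) :
      DRelU n ((wE k n i).op l * iId k n l') (if l' = l then (wE k n i).op l else 0)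
  | tgtE (i : ℕ) (l l' : Fin n → ℤ) :
      DRelU n (iId k n l' * (wE k n i).op l)
        (if l' = l + (wE k n i).wt then (wE k n i).op l else 0)
  | srcF (i : ℕ) (l l' : Fin n → ℤ) :
      DRelU n ((wF k n i).op l * iId k n l') (if l' = l then (wF k n i).op l else 0)
  | tgtF (i : ℕ) (l l' : Fin n → ℤ) :
      DRelU n (iId k n l' * (wF k n i).op l)
        (if l' = l + (wF k n i).wt then (wF k n i).op l else 0)
  | srcB (i : ℕ) (l l' : Fin n → ℤ) :
      DRelU n ((wB k n i).op l * iId k n l') (if l' = l then (wB k n i).op l else 0)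
  | tgtB (i : ℕ) (l l' : Fin n → ℤ) :
      DRelU n (iId k n l' * (wB k n i).op l)
        (if l' = l + (wB k n i).wt then (wB k n i).op l else 0)
  | srcC (i : ℕ) (l l' : Fin n → ℤ) :
      DRelU n ((wC k n i).op l * iId k n l') (if l' = l then (wC k n i).op l else 0)
  | tgtC (i : ℕ) (l l' : Fin n → ℤ) :
      DRelU n (iId k n l' * (wC k n i).op l)
        (if l' = l + (wC k n i).wt then (wC k n i).op l else 0)
  | srcB11 (l l' : Fin n → ℤ) :
      DRelU n ((wB11 k n).op l * iId k n l') (if l' = l then (wB11 k n).op l else 0)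
  | tgtB11 (l l' : Fin n → ℤ) :
      DRelU n (iId k n l' * (wB11 k n).op l)
        (if l' = l + (wB11 k n).wt then (wB11 k n).op l else 0)
  -- out-of-range generators vanish
  | killE (i : ℕ) (l : Fin n → ℤ) (h : ¬ okEd n i) : DRelU n ((wE k n i).op l) 0
  | killF (i : ℕ) (l : Fin n → ℤ) (h : ¬ okEd n i) : DRelU n ((wF k n i).op l) 0
  | killB (i : ℕ) (l : Fin n → ℤ) (h : ¬ okEd n i) : DRelU n ((wB k n i).op l) 0
  | killC (i : ℕ) (l : Fin n → ℤ) (h : ¬ okEd n i) : DRelU n ((wC k n i).op l) 0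
  -- (U1)
  | u1 (i j : ℕ) (l : Fin n → ℤ) (hi : okEd n i) (hj : okEd n j) :
      DRelU n (((wE k n i).cmm (wF k n j)).op l)
        (if i = j then ((alpair n l i : ℤ) : k) • iId k n l else 0)
  -- (U2)
  | u2a (i j : ℕ) (l : Fin n → ℤ) (hi : okEd n i) (hj : okEd n j)
      (h : j ≠ i + 1 ∧ i ≠ j + 1) : DRelU n (((wE k n i).cmm (wE k n j)).op l) 0
  | u2b (i j : ℕ) (l : Fin n → ℤ) (hi : okEd n i) (hj : okEd n j)
      (h : j = i + 1 ∨ i = j + 1) :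
      DRelU n (((wE k n i).cmm ((wE k n i).cmm (wE k n j))).op l) 0
  -- (U3)
  | u3a (i j : ℕ) (l : Fin n → ℤ) (hi : okEd n i) (hj : okEd n j)
      (h : j ≠ i + 1 ∧ i ≠ j + 1) : DRelU n (((wF k n i).cmm (wF k n j)).op l) 0
  | u3b (i j : ℕ) (l : Fin n → ℤ) (hi : okEd n i) (hj : okEd n j)
      (h : j = i + 1 ∨ i = j + 1) :
      DRelU n (((wF k n i).cmm ((wF k n i).cmm (wF k n j))).op l) 0
  -- (U4)
  | u4b (i j : ℕ) (l : Fin n → ℤ) (hi : okEd n i) (hj : okEd n j) :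
      DRelU n (((wB k n i).acm (wB k n j)).op l) 0
  | u4c (i j : ℕ) (l : Fin n → ℤ) (hi : okEd n i) (hj : okEd n j) :
      DRelU n (((wC k n i).acm (wC k n j)).op l) 0
  -- (U5)
  | u5i (i : ℕ) (l : Fin n → ℤ) (hi : okEd n i) :
      DRelU n (((wB k n i).acm (wC k n i)).op l)
        ((-((alpair n l i : ℤ) : k)) • iId k n l)
  | u5m (i : ℕ) (l : Fin n → ℤ) (hi : okEd n i) (hi1 : okEd n (i+1)) :
      DRelU n (((wB k n (i+1)).acm (wC k n i)).op l)
        (((wF k n i).cmm (wF k n (i+1))).op l)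
  | u5p (i : ℕ) (l : Fin n → ℤ) (hi : okEd n i) (hi1 : okEd n (i+1)) :
      DRelU n (((wB k n i).acm (wC k n (i+1))).op l)
        (((wE k n i).cmm (wE k n (i+1))).op l)
  | u5z (i j : ℕ) (l : Fin n → ℤ) (hi : okEd n i) (hj : okEd n j)
      (h : i ≠ j ∧ i ≠ j + 1 ∧ j ≠ i + 1) :
      DRelU n (((wB k n i).acm (wC k n j)).op l) 0
  -- (U6)
  | u6f (i j : ℕ) (l : Fin n → ℤ) (hi : okEd n i) (hj : okEd n j)
      (h : j ≠ i ∧ j ≠ i + 1) : DRelU n (((wB k n i).cmm (wF k n j)).op l) 0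
  | u6e (i j : ℕ) (l : Fin n → ℤ) (hi : okEd n i) (hj : okEd n j)
      (h : j ≠ i ∧ i ≠ j + 1) : DRelU n (((wB k n i).cmm (wE k n j)).op l) 0
  | u6c1 (i : ℕ) (l : Fin n → ℤ) (hi : okEd n i) (hi1 : okEd n (i+1)) :
      DRelU n (((wB k n i).cmm (wF k n i)).op l)
        (((wB k n (i+1)).cmm (wE k n (i+1))).op l)
  | u6c2 (i : ℕ) (l : Fin n → ℤ) (hi : okEd n i) (hi1 : okEd n (i+1)) :
      DRelU n (((wB k n i).cmm (wF k n (i+1))).op l)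
        (((wB k n (i+1)).cmm (wE k n i)).op l)
  -- (U7)
  | u7f (i j : ℕ) (l : Fin n → ℤ) (hi : okEd n i) (hj : okEd n j)
      (h : i ≠ j + 1) : DRelU n (((wF k n j).cmm (wC k n i)).op l) 0
  | u7e (i j : ℕ) (l : Fin n → ℤ) (hi : okEd n i) (hj : okEd n j)
      (h : j ≠ i + 1) : DRelU n (((wE k n j).cmm (wC k n i)).op l) 0
  | u7x (i : ℕ) (l : Fin n → ℤ) (hi : okEd n i) (hi1 : okEd n (i+1)) :
      DRelU n (((wF k n i).cmm (wC k n (i+1))).op l)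
        (((wE k n (i+1)).cmm (wC k n i)).op l)
  -- (U8)
  | u8a (i : ℕ) (l : Fin n → ℤ) (hi : okEd n i) (hi1 : okEd n (i+1)) :
      DRelU n ((((wB k n i).cmm (wF k n i)).cmm (wF k n (i+1))).op l)
        ((2:k) • FreeAlgebra.ι k (DGen.gb (i+1) l))
  | u8z (i j : ℕ) (l : Fin n → ℤ) (hi : okEd n i) (hj : okEd n j)
      (h : j ≠ i + 1) :
      DRelU n ((((wB k n i).cmm (wF k n i)).cmm (wF k n j)).op l) 0
  | u8e (l : Fin n → ℤ) (h1 : okEd n 1) :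
      DRelU n ((((wB k n 1).cmm (wF k n 1)).cmm (wE k n 1)).op l)
        ((2:k) • FreeAlgebra.ι k (DGen.gb 1 l))
  | u8be (j : ℕ) (l : Fin n → ℤ) (h1 : okEd n 1) (hj : okEd n j) :
      DRelU n ((((wB k n 1).cmm (wE k n 1)).cmm (wE k n j)).op l) 0
  -- (U9)
  | u9a (i : ℕ) (l : Fin n → ℤ) (hi : okEd n i) (hi1 : okEd n (i+1)) :
      DRelU n ((((wC k n (i+1)).cmm (wF k n i)).cmm (wF k n (i+1))).op l)
        (FreeAlgebra.ι k (DGen.gc i l))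
  | u9z (i j : ℕ) (l : Fin n → ℤ) (hi : okEd n i) (hi1 : okEd n (i+1))
      (hj : okEd n j) (h : j ≠ i + 1 ∧ i ≠ j + 1) :
      DRelU n ((((wC k n (i+1)).cmm (wF k n i)).cmm (wF k n j)).op l) 0
  -- (U10)
  | u10 (l : Fin n → ℤ) (h1 : okEd n 1) :
      DRelU n ((2:k) • FreeAlgebra.ι k (DGen.gb11 l))
        (((wE k n 1).cmm (wB k n 1)).op l)
  -- (U11)
  | u11 (l : Fin n → ℤ) :
      DRelU n (((wB11 k n).comp (wB11 k n)).op l) 0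

/-- The idempotented form `U̇(p(n))` (with a unit formally adjoined). -/
abbrev Udu (n : ℕ) := RingQuot (DRelU k n)

noncomputable def mkDu (n : ℕ) : FreeAlgebra k (DGen n) →ₐ[k] Udu k n :=
  RingQuot.mkAlgHom k (DRelU k n)

/-- The defining relations of the idempotented form `U̇(p̃(m))`
((Ũ1)–(Ũ11) of Davidson–Kujawa–Muth, Definition `Udot(p̃(m))`). -/
inductive DRelT (m : ℕ) :
    FreeAlgebra k (DGen m) → FreeAlgebra k (DGen m) → Prop
  -- idempotents
  | idem2 (l l' : Fin m → ℤ) :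
      DRelT m (iId k m l * iId k m l') (if l = l' then iId k m l else 0)
  -- sources and targets of the generators
  | srcE (i : ℕ) (l l' : Fin m → ℤ) :
      DRelT m ((wE k m i).op l * iId k m l') (if l' = l then (wE k m i).op l else 0)
  | tgtE (i : ℕ) (l l' : Fin m → ℤ) :
      DRelT m (iId k m l' * (wE k m i).op l)
        (if l' = l + (wE k m i).wt then (wE k m i).op l else 0)
  | srcF (i : ℕ) (l l' : Fin m → ℤ) :
      DRelT m ((wF k m i).op l * iId k m l') (if l' = l then (wF k m i).op l else 0)
  | tgtF (i : ℕ) (l l' : Fin m → ℤ) :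
      DRelT m (iId k m l' * (wF k m i).op l)
        (if l' = l + (wF k m i).wt then (wF k m i).op l else 0)
  | srcB (i : ℕ) (l l' : Fin m → ℤ) :
      DRelT m ((wBt k m i).op l * iId k m l') (if l' = l then (wBt k m i).op l else 0)
  | tgtB (i : ℕ) (l l' : Fin m → ℤ) :
      DRelT m (iId k m l' * (wBt k m i).op l)
        (if l' = l + (wBt k m i).wt then (wBt k m i).op l else 0)
  | srcC (i : ℕ) (l l' : Fin m → ℤ) :
      DRelT m ((wCt k m i).op l * iId k m l') (if l' = l then (wCt k m i).op l else 0)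
  | tgtC (i : ℕ) (l l' : Fin m → ℤ) :
      DRelT m (iId k m l' * (wCt k m i).op l)
        (if l' = l + (wCt k m i).wt then (wCt k m i).op l else 0)
  | srcB11 (l l' : Fin m → ℤ) :
      DRelT m ((wB11t k m).op l * iId k m l') (if l' = l then (wB11t k m).op l else 0)
  | tgtB11 (l l' : Fin m → ℤ) :
      DRelT m (iId k m l' * (wB11t k m).op l)
        (if l' = l + (wB11t k m).wt then (wB11t k m).op l else 0)
  -- out-of-range generators vanish
  | killE (i : ℕ) (l : Fin m → ℤ) (h : ¬ okEd m i) : DRelT m ((wE k m i).op l) 0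
  | killF (i : ℕ) (l : Fin m → ℤ) (h : ¬ okEd m i) : DRelT m ((wF k m i).op l) 0
  | killB (i : ℕ) (l : Fin m → ℤ) (h : ¬ okEd m i) : DRelT m ((wBt k m i).op l) 0
  | killC (i : ℕ) (l : Fin m → ℤ) (h : ¬ okEd m i) : DRelT m ((wCt k m i).op l) 0
  -- (Ũ1)
  | u1 (i j : ℕ) (l : Fin m → ℤ) (hi : okEd m i) (hj : okEd m j) :
      DRelT m (((wE k m i).cmm (wF k m j)).op l)
        (if i = j then ((alpair m l i : ℤ) : k) • iId k m l else 0)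
  -- (Ũ2)
  | u2a (i j : ℕ) (l : Fin m → ℤ) (hi : okEd m i) (hj : okEd m j)
      (h : j ≠ i + 1 ∧ i ≠ j + 1) : DRelT m (((wE k m i).cmm (wE k m j)).op l) 0
  | u2b (i j : ℕ) (l : Fin m → ℤ) (hi : okEd m i) (hj : okEd m j)
      (h : j = i + 1 ∨ i = j + 1) :
      DRelT m (((wE k m i).cmm ((wE k m i).cmm (wE k m j))).op l) 0
  -- (Ũ3)
  | u3a (i j : ℕ) (l : Fin m → ℤ) (hi : okEd m i) (hj : okEd m j)
      (h : j ≠ i + 1 ∧ i ≠ j + 1) : DRelT m (((wF k m i).cmm (wF k m j)).op l) 0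
  | u3b (i j : ℕ) (l : Fin m → ℤ) (hi : okEd m i) (hj : okEd m j)
      (h : j = i + 1 ∨ i = j + 1) :
      DRelT m (((wF k m i).cmm ((wF k m i).cmm (wF k m j))).op l) 0
  -- (Ũ4)
  | u4b (i j : ℕ) (l : Fin m → ℤ) (hi : okEd m i) (hj : okEd m j) :
      DRelT m (((wBt k m i).acm (wBt k m j)).op l) 0
  | u4c (i j : ℕ) (l : Fin m → ℤ) (hi : okEd m i) (hj : okEd m j) :
      DRelT m (((wCt k m i).acm (wCt k m j)).op l) 0
  -- (Ũ5)
  | u5i (i : ℕ) (l : Fin m → ℤ) (hi : okEd m i) :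
      DRelT m (((wBt k m i).acm (wCt k m i)).op l)
        (((alpair m l i : ℤ) : k) • iId k m l)
  | u5m (i : ℕ) (l : Fin m → ℤ) (hi : okEd m i) (hi1 : okEd m (i+1)) :
      DRelT m (((wBt k m (i+1)).acm (wCt k m i)).op l)
        (((wE k m i).cmm (wE k m (i+1))).op l)
  | u5p (i : ℕ) (l : Fin m → ℤ) (hi : okEd m i) (hi1 : okEd m (i+1)) :
      DRelT m (((wBt k m i).acm (wCt k m (i+1))).op l)
        (((wF k m i).cmm (wF k m (i+1))).op l)
  | u5z (i j : ℕ) (l : Fin m → ℤ) (hi : okEd m i) (hj : okEd m j)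
      (h : i ≠ j ∧ i ≠ j + 1 ∧ j ≠ i + 1) :
      DRelT m (((wBt k m i).acm (wCt k m j)).op l) 0
  -- (Ũ6)
  | u6e (i j : ℕ) (l : Fin m → ℤ) (hi : okEd m i) (hj : okEd m j)
      (h : j ≠ i ∧ j ≠ i + 1) : DRelT m (((wBt k m i).cmm (wE k m j)).op l) 0
  | u6f (i j : ℕ) (l : Fin m → ℤ) (hi : okEd m i) (hj : okEd m j)
      (h : j ≠ i ∧ i ≠ j + 1) : DRelT m (((wBt k m i).cmm (wF k m j)).op l) 0
  | u6c1 (i : ℕ) (l : Fin m → ℤ) (hi : okEd m i) (hi1 : okEd m (i+1)) :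
      DRelT m (((wBt k m i).cmm (wE k m i)).op l)
        (((wBt k m (i+1)).cmm (wF k m (i+1))).op l)
  | u6c2 (i : ℕ) (l : Fin m → ℤ) (hi : okEd m i) (hi1 : okEd m (i+1)) :
      DRelT m (((wBt k m i).cmm (wE k m (i+1))).op l)
        (((wBt k m (i+1)).cmm (wF k m i)).op l)
  -- (Ũ7)
  | u7e (i j : ℕ) (l : Fin m → ℤ) (hi : okEd m i) (hj : okEd m j)
      (h : i ≠ j + 1) : DRelT m (((wE k m j).cmm (wCt k m i)).op l) 0
  | u7f (i j : ℕ) (l : Fin m → ℤ) (hi : okEd m i) (hj : okEd m j)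
      (h : j ≠ i + 1) : DRelT m (((wF k m j).cmm (wCt k m i)).op l) 0
  | u7x (i : ℕ) (l : Fin m → ℤ) (hi : okEd m i) (hi1 : okEd m (i+1)) :
      DRelT m (((wE k m i).cmm (wCt k m (i+1))).op l)
        (((wF k m (i+1)).cmm (wCt k m i)).op l)
  -- (Ũ8)
  | u8a (i : ℕ) (l : Fin m → ℤ) (hi : okEd m i) (hi1 : okEd m (i+1)) :
      DRelT m ((((wBt k m i).cmm (wE k m i)).cmm (wE k m (i+1))).op l)
        ((2:k) • FreeAlgebra.ι k (DGen.gb (i+1) l))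
  | u8z (i j : ℕ) (l : Fin m → ℤ) (hi : okEd m i) (hj : okEd m j)
      (h : j ≠ i + 1) :
      DRelT m ((((wBt k m i).cmm (wE k m i)).cmm (wE k m j)).op l) 0
  | u8e (l : Fin m → ℤ) (h1 : okEd m 1) :
      DRelT m ((((wBt k m 1).cmm (wE k m 1)).cmm (wF k m 1)).op l)
        ((2:k) • FreeAlgebra.ι k (DGen.gb 1 l))
  | u8bf (j : ℕ) (l : Fin m → ℤ) (h1 : okEd m 1) (hj : okEd m j) :
      DRelT m ((((wBt k m 1).cmm (wF k m 1)).cmm (wF k m j)).op l) 0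
  -- (Ũ9)
  | u9a (i : ℕ) (l : Fin m → ℤ) (hi : okEd m i) (hi1 : okEd m (i+1)) :
      DRelT m ((((wCt k m (i+1)).cmm (wE k m i)).cmm (wE k m (i+1))).op l)
        (FreeAlgebra.ι k (DGen.gc i l))
  | u9z (i j : ℕ) (l : Fin m → ℤ) (hi : okEd m i) (hi1 : okEd m (i+1))
      (hj : okEd m j) (h : j ≠ i + 1 ∧ i ≠ j + 1) :
      DRelT m ((((wCt k m (i+1)).cmm (wE k m i)).cmm (wE k m j)).op l) 0
  -- (Ũ10)
  | u10 (l : Fin m → ℤ) (h1 : okEd m 1) :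
      DRelT m ((2:k) • FreeAlgebra.ι k (DGen.gb11 l))
        (((wBt k m 1).cmm (wF k m 1)).op l)
  -- (Ũ11)
  | u11 (l : Fin m → ℤ) :
      DRelT m (((wB11t k m).comp (wB11t k m)).op l) 0

/-- The idempotented form `U̇(p̃(m))` (with a unit formally adjoined). -/
abbrev Udt (m : ℕ) := RingQuot (DRelT k m)

noncomputable def mkDt (m : ℕ) : FreeAlgebra k (DGen m) →ₐ[k] Udt k m :=
  RingQuot.mkAlgHom k (DRelT k m)

/-!
Model-side definitions on `A = S(V_n)^{⊗ m}` (the model `SM k m n`): weight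
and tensor-degree projections and the operators of the natural `p(n)`-action,
in 1-based indexing.
-/

/-- The tensor-degree profile of a monomial: its multidegree in the `m`
tensor slots, i.e. the weight for `U̇(p̃(m))`. -/
noncomputable def prof {m n : ℕ} (b : MonB m n) : Fin m → ℤ :=
  fun i => (∑ l : Fin n, (b.1 (i, l) : ℤ))
    + ((Finset.univ.filter fun l : Fin n => b.2 (i, l) = true).card : ℤ)

/-- Projection of `A` onto the summand `S^λ(V_n) = S^{λ_1}(V_n) ⊗ ⋯ ⊗
S^{λ_m}(V_n)` (zero if `λ ∉ X(T_m)_{≥0}`). -/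
noncomputable def projP (m n : ℕ) (lam : Fin m → ℤ) : Module.End k (SM k m n) :=
  opOf k m n fun b => if prof b = lam then bvec k m n b else 0

/-- The `p(n)`-weight of a monomial. -/
noncomputable def pwt {m n : ℕ} (b : MonB m n) : Fin n → ℤ :=
  fun l => (∑ i : Fin m, (b.1 (i, l) : ℤ))
    - ((Finset.univ.filter fun i : Fin m => b.2 (i, l) = true).card : ℤ)

/-- Projection of `A` onto its `p(n)`-weight space of weight `ν`. -/
noncomputable def projW (m n : ℕ) (nu : Fin n → ℤ) : Module.End k (SM k m n) :=
  opOf k m n fun b => if pwt b = nu then bvec k m n b else 0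

/-- The operator of the natural action of `a_{i,i+1} ∈ p(n)` (1-based `i`). -/
noncomputable def pnE (m n i : ℕ) : Module.End k (SM k m n) :=
  if h : 1 ≤ i ∧ i + 1 ≤ n then opA k m n ⟨i-1, by omega⟩ ⟨i, by omega⟩ else 0
/-- The operator of the natural action of `a_{i+1,i} ∈ p(n)`. -/
noncomputable def pnF (m n i : ℕ) : Module.End k (SM k m n) :=
  if h : 1 ≤ i ∧ i + 1 ≤ n then opA k m n ⟨i, by omega⟩ ⟨i-1, by omega⟩ else 0
/-- The operator of the natural action of `b_{1,1} ∈ p(n)`. -/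
noncomputable def pnB11 (m n : ℕ) : Module.End k (SM k m n) :=
  if h : 0 < n then opB k m n ⟨0, h⟩ ⟨0, h⟩ else 0
/-- The operator of the natural action of `b_{i,i+1} ∈ p(n)`. -/
noncomputable def pnB (m n i : ℕ) : Module.End k (SM k m n) :=
  if h : 1 ≤ i ∧ i + 1 ≤ n then opB k m n ⟨i-1, by omega⟩ ⟨i, by omega⟩ else 0
/-- The operator of the natural action of `c_{i,i+1} ∈ p(n)`. -/
noncomputable def pnC (m n i : ℕ) : Module.End k (SM k m n) :=
  if h : 1 ≤ i ∧ i + 1 ≤ n then opC k m n ⟨i-1, by omega⟩ ⟨i, by omega⟩ else 0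

/-- `f` is a homomorphism of `p(n)`-supermodules `A → A` (in the graded sense:
its even and odd components intertwine the natural action operators with the
appropriate signs). -/
def IsPnHom (m n : ℕ) (f : Module.End k (SM k m n)) : Prop :=
  (∀ i j : Fin n, evComm k m n (opA k m n i j) f = 0) ∧
  (∀ i j : Fin n, i ≤ j → odComm k m n (opB k m n i j) f = 0) ∧
  (∀ i j : Fin n, i < j → odComm k m n (opC k m n i j) f = 0)

section Basics
variable {K : Type} [Field K] {F L : ℕ}

/-- The sign attached to a parity. -/
def sg (K : Type) [Field K] (b : Bool) : K := if b then -1 else 1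

@[simp] theorem sg_false : sg K false = 1 := rfl
@[simp] theorem sg_true : sg K true = -1 := rfl

theorem sg_mul_self (b : Bool) : sg K b * sg K b = 1 := by cases b <;> simp

theorem opOf_bvec (f : MonB F L → SM K F L) (b : MonB F L) :
    opOf K F L f (bvec K F L b) = f b := by
  simp [opOf, bvec]

theorem end_ext {N : Type*} [AddCommGroup N] [Module K N] {T T' : SM K F L →ₗ[K] N}
    (h : ∀ b, T (bvec K F L b) = T' (bvec K F L b)) : T = T' := by
  refine Finsupp.lhom_ext' fun b => ?_
  ext
  simpa [bvec] using h b

theorem zE_bvec (i : Fin F) (j : Fin L) (b : MonB F L) :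
    zE K F L i j (bvec K F L b)
      = bvec K F L (Function.update b.1 (i, j) (b.1 (i, j) + 1), b.2) := opOf_bvec _ _

theorem dE_bvec (i : Fin F) (j : Fin L) (b : MonB F L) :
    dE K F L i j (bvec K F L b) = (b.1 (i, j) : K) •
      bvec K F L (Function.update b.1 (i, j) (b.1 (i, j) - 1), b.2) := opOf_bvec _ _

theorem zO_bvec (i : Fin F) (j : Fin L) (b : MonB F L) :
    zO K F L i j (bvec K F L b) = if b.2 (i, j) then 0
      else ((-1:K) ^ oddBefore b.2 (i, j)) •
        bvec K F L (b.1, Function.update b.2 (i, j) true) := opOf_bvec _ _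

theorem dO_bvec (i : Fin F) (j : Fin L) (b : MonB F L) :
    dO K F L i j (bvec K F L b) = if b.2 (i, j) then
      ((-1:K) ^ oddBefore b.2 (i, j)) •
        bvec K F L (b.1, Function.update b.2 (i, j) false) else 0 := opOf_bvec _ _

theorem posIdx_injective : Function.Injective (posIdx : Fin F × Fin L → ℕ) := by
  rintro ⟨a, b⟩ ⟨c, d⟩ h
  simp only [posIdx] at h
  have hb := b.2
  have hd := d.2
  have h1 : a.val = c.val := by
    have h2 := congrArg (· / L) h
    simp only [Nat.add_div_of_dvd_right (Dvd.intro_left _ rfl), Nat.div_eq_of_lt hb,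
      Nat.div_eq_of_lt hd] at h2
    rw [Nat.mul_div_cancel _ (by omega), Nat.mul_div_cancel _ (by omega)] at h2
    simpa using h2
  rw [h1] at h
  exact Prod.ext (Fin.ext h1) (Fin.ext (by simpa using h))

theorem oddBefore_update_self (ε : Fin F × Fin L → Bool) (p : Fin F × Fin L) (v : Bool) :
    oddBefore (Function.update ε p v) p = oddBefore ε p := by
  unfold oddBefore
  congr 1
  refine Finset.filter_congr fun q _ => and_congr_right fun h => ?_
  have : q ≠ p := by rintro rfl; exact lt_irrefl _ h
  rw [Function.update_of_ne this]

theorem oddBefore_update_true (ε : Fin F × Fin L → Bool) (p q : Fin F × Fin L)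
    (hq : ε q = false) :
    oddBefore (Function.update ε q true) p
      = oddBefore ε p + if posIdx q < posIdx p then 1 else 0 := by
  unfold oddBefore
  split_ifs with h
  · rw [← Finset.card_insert_of_notMem
      (a := q) (s := Finset.univ.filter fun r => posIdx r < posIdx p ∧ ε r = true)]
    · congr 1
      ext r
      by_cases hr : r = q
      · subst hr; simp [h]
      · simp [hr]
    · simp [hq]
  · congr 1
    refine Finset.filter_congr fun r _ => and_congr_right fun h' => ?_
    have : r ≠ q := by rintro rfl; exact h h'
    rw [Function.update_of_ne this]

theorem oddBefore_update_false (ε : Fin F × Fin L → Bool) (p q : Fin F × Fin L)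
    (hq : ε q = true) :
    oddBefore ε p = oddBefore (Function.update ε q false) p
      + if posIdx q < posIdx p then 1 else 0 := by
  rw [← oddBefore_update_true _ p q (by simp)]
  congr 1
  simp [← hq]

theorem zO_zO (p q : Fin F × Fin L) :
    zO K F L p.1 p.2 * zO K F L q.1 q.2 = -(zO K F L q.1 q.2 * zO K F L p.1 p.2) := by
  refine end_ext fun b => ?_
  simp only [Module.End.mul_apply, LinearMap.neg_apply, zO_bvec]
  by_cases hpq : p = q
  · subst hpq
    by_cases hb : b.2 p <;> simp [hb, zO_bvec]
  · by_cases hp : b.2 p <;> by_cases hq : b.2 q <;>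
      simp [hp, hq, zO_bvec, hpq, Ne.symm hpq, Function.update_of_ne, smul_smul]
    rw [oddBefore_update_true _ p q (by simpa using hq),
      oddBefore_update_true _ q p (by simpa using hp), Function.update_comm hpq]
    rcases lt_or_gt_of_ne (fun h => hpq (posIdx_injective h)) with h | h
    · simp [h, h.not_gt, pow_succ, mul_comm]
    · simp [h, h.not_gt, pow_succ, mul_comm]

theorem dO_dO (p q : Fin F × Fin L) :
    dO K F L p.1 p.2 * dO K F L q.1 q.2 = -(dO K F L q.1 q.2 * dO K F L p.1 p.2) := by
  refine end_ext fun b => ?_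
  simp only [Module.End.mul_apply, LinearMap.neg_apply, dO_bvec]
  by_cases hpq : p = q
  · subst hpq
    by_cases hb : b.2 p <;> simp [hb, dO_bvec]
  · by_cases hp : b.2 p <;> by_cases hq : b.2 q <;>
      simp [hp, hq, dO_bvec, hpq, Ne.symm hpq, Function.update_of_ne, smul_smul]
    rw [oddBefore_update_false _ q p hp,
      oddBefore_update_false _ p q hq, Function.update_comm hpq]
    rcases lt_or_gt_of_ne (fun h => hpq (posIdx_injective h)) with h | h
    · simp [h, h.not_gt, pow_succ, mul_comm]
    · simp [h, h.not_gt, pow_succ, mul_comm]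

theorem dO_zO (p q : Fin F × Fin L) :
    dO K F L p.1 p.2 * zO K F L q.1 q.2
      = -(zO K F L q.1 q.2 * dO K F L p.1 p.2) + if p = q then 1 else 0 := by
  refine end_ext fun b => ?_
  simp only [Module.End.mul_apply, LinearMap.neg_apply, LinearMap.add_apply, dO_bvec, zO_bvec]
  by_cases hpq : p = q
  · subst hpq
    by_cases hb : b.2 p <;>
      simp [hb, dO_bvec, zO_bvec, oddBefore_update_self, smul_smul, ← pow_add, ← two_mul]
    · rw [← hb]; simp
    · rw [← (Bool.eq_false_iff.2 hb : b.2 p = false)]; simp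
  · by_cases hp : b.2 p <;> by_cases hq : b.2 q <;>
      simp [hp, hq, dO_bvec, zO_bvec, hpq, Ne.symm hpq, Function.update_of_ne, smul_smul]
    rw [oddBefore_update_false _ q p hp,
      oddBefore_update_true _ p q (by simpa using hq), Function.update_comm hpq]
    rcases lt_or_gt_of_ne (fun h => hpq (posIdx_injective h)) with h | h
    · simp [h, h.not_gt, pow_succ, mul_comm]
    · simp [h, h.not_gt, pow_succ, mul_comm]

theorem zE_zE (p q : Fin F × Fin L) :
    zE K F L p.1 p.2 * zE K F L q.1 q.2 = zE K F L q.1 q.2 * zE K F L p.1 p.2 := by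
  refine end_ext fun b => ?_
  simp only [Module.End.mul_apply, zE_bvec]
  by_cases hpq : p = q
  · subst hpq; rfl
  · simp [hpq, Ne.symm hpq, Function.update_of_ne, Function.update_comm hpq]

theorem dE_dE (p q : Fin F × Fin L) :
    dE K F L p.1 p.2 * dE K F L q.1 q.2 = dE K F L q.1 q.2 * dE K F L p.1 p.2 := by
  refine end_ext fun b => ?_
  simp only [Module.End.mul_apply, dE_bvec]
  by_cases hpq : p = q
  · subst hpq; rfl
  · simp [hpq, Ne.symm hpq, Function.update_of_ne, Function.update_comm hpq, dE_bvec, smul_smul,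
      mul_comm]

theorem dE_zE (p q : Fin F × Fin L) :
    dE K F L p.1 p.2 * zE K F L q.1 q.2
      = zE K F L q.1 q.2 * dE K F L p.1 p.2 + if p = q then 1 else 0 := by
  refine end_ext fun b => ?_
  simp only [Module.End.mul_apply, LinearMap.add_apply, dE_bvec, zE_bvec]
  by_cases hpq : p = q
  · subst hpq
    rcases Nat.eq_zero_or_pos (b.1 p) with h | h
    · simp only [map_smul, zE_bvec]
      simp [h]
      rw [← h]; simp
    · simp only [map_smul, zE_bvec]
      simp [Nat.sub_add_cancel h, add_smul]
  · simp [hpq, Ne.symm hpq, Function.update_of_ne, Function.update_comm hpq, zE_bvec]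

theorem zE_zO (p q : Fin F × Fin L) :
    zE K F L p.1 p.2 * zO K F L q.1 q.2 = zO K F L q.1 q.2 * zE K F L p.1 p.2 := by
  refine end_ext fun b => ?_
  simp only [Module.End.mul_apply, zE_bvec, zO_bvec]
  split_ifs <;> simp [zE_bvec]

theorem dE_zO (p q : Fin F × Fin L) :
    dE K F L p.1 p.2 * zO K F L q.1 q.2 = zO K F L q.1 q.2 * dE K F L p.1 p.2 := by
  refine end_ext fun b => ?_
  simp only [Module.End.mul_apply, dE_bvec, zO_bvec, map_smul]
  split_ifs <;> simp [dE_bvec, smul_smul, mul_comm]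

theorem dO_zE (p q : Fin F × Fin L) :
    dO K F L p.1 p.2 * zE K F L q.1 q.2 = zE K F L q.1 q.2 * dO K F L p.1 p.2 := by
  refine end_ext fun b => ?_
  simp only [Module.End.mul_apply, zE_bvec, dO_bvec]
  split_ifs <;> simp [zE_bvec]

theorem dE_dO (p q : Fin F × Fin L) :
    dE K F L p.1 p.2 * dO K F L q.1 q.2 = dO K F L q.1 q.2 * dE K F L p.1 p.2 := by
  refine end_ext fun b => ?_
  simp only [Module.End.mul_apply, dE_bvec, dO_bvec, map_smul]
  split_ifs <;> simp [dE_bvec, smul_smul, mul_comm]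

theorem neg_one_smul_end (T : Module.End K (SM K F L)) : (-1 : K) • T = -T := by
  ext1; ext1; simp

theorem zop_zop (p q : Fin F) (r s : Ix L) :
    zop K F L p r * zop K F L q s
      = sg K (r.isRight && s.isRight) • (zop K F L q s * zop K F L p r) := by
  rcases r with r | r <;> rcases s with s | s <;> simp [zop]
  · exact zE_zE (K := K) (p, r) (q, s)
  · exact zE_zO (K := K) (p, r) (q, s)
  · exact (zE_zO (K := K) (q, s) (p, r)).symm
  · rw [neg_one_smul_end]; exact zO_zO (K := K) (p, r) (q, s)

theorem dop_dop (p q : Fin F) (r s : Ix L) :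
    dop K F L p r * dop K F L q s
      = sg K (r.isRight && s.isRight) • (dop K F L q s * dop K F L p r) := by
  rcases r with r | r <;> rcases s with s | s <;> simp [dop]
  · exact dE_dE (K := K) (p, r) (q, s)
  · exact dE_dO (K := K) (p, r) (q, s)
  · exact (dE_dO (K := K) (q, s) (p, r)).symm
  · rw [neg_one_smul_end]; exact dO_dO (K := K) (p, r) (q, s)

theorem dop_zop (p q : Fin F) (r s : Ix L) :
    dop K F L p r * zop K F L q s
      = sg K (r.isRight && s.isRight) • (zop K F L q s * dop K F L p r)
        + if p = q ∧ r = s then 1 else 0 := by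
  rcases r with r | r <;> rcases s with s | s <;> simp [zop, dop]
  · simpa using dE_zE (K := K) (p, r) (q, s)
  · exact dE_zO (K := K) (p, r) (q, s)
  · exact dO_zE (K := K) (p, r) (q, s)
  · rw [neg_one_smul_end]
    simpa using dO_zO (K := K) (p, r) (q, s)

theorem dop_vac (p : Fin F) (r : Ix L) : dop K F L p r (vac K F L) = 0 := by
  rcases r with r | r <;> simp [dop, vac, dE_bvec, dO_bvec]

variable (K F L) in
/-- The Fock space `SM`, sealed so that its additive structure comes from one instance. -/
def FM : Type := SM K F L

noncomputable instance : AddCommGroup (FM K F L) := inferInstanceAs (AddCommGroup (SM K F L))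

noncomputable instance : Module K (FM K F L) := inferInstanceAs (Module K (SM K F L))

variable (K) in
/-- A basis monomial in the Fock space. -/
noncomputable def bF (b : MonB F L) : FM K F L := bvec K F L b

/-- The coefficient of a monomial. -/
noncomputable def co (b : MonB F L) : FM K F L →ₗ[K] K := Finsupp.lapply (R := K) b

variable (K F L) in
/-- The vacuum vector. -/
noncomputable def vF : FM K F L := vac K F L

/-- Multiplication by a variable. -/
noncomputable def zF (p : Fin F) (r : Ix L) : Module.End K (FM K F L) := zop K F L p r

/-- Derivation by a variable. -/
noncomputable def dF (p : Fin F) (r : Ix L) : Module.End K (FM K F L) := dop K F L p r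

theorem FM_hom_ext {N : Type*} [AddCommGroup N] [Module K N] {T T' : FM K F L →ₗ[K] N}
    (h : ∀ b, T (bF K b) = T' (bF K b)) : T = T' := end_ext (N := N) h

theorem FM_ext {x y : FM K F L} (h : ∀ b, co b x = co b y) : x = y :=
  Finsupp.ext (α := MonB F L) (M := K) h

theorem co_bF (b c : MonB F L) : co b (bF K c) = if c = b then 1 else 0 :=
  Finsupp.single_apply

variable (K F L) in
theorem vF_eq : vF K F L = bF K (fun _ => 0, fun _ => false) := rfl

theorem zF_zF (p q : Fin F) (r s : Ix L) :
    (zF p r * zF q s : Module.End K (FM K F L))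
      = sg K (r.isRight && s.isRight) • (zF q s * zF p r) := zop_zop p q r s

theorem dF_dF (p q : Fin F) (r s : Ix L) :
    (dF p r * dF q s : Module.End K (FM K F L))
      = sg K (r.isRight && s.isRight) • (dF q s * dF p r) := dop_dop p q r s

theorem dF_zF (p q : Fin F) (r s : Ix L) :
    (dF p r * zF q s : Module.End K (FM K F L))
      = sg K (r.isRight && s.isRight) • (zF q s * dF p r) + if p = q ∧ r = s then 1 else 0 :=
  dop_zop p q r s

theorem dF_vF (p : Fin F) (r : Ix L) : dF p r (vF K F L) = 0 := dop_vac p r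

end Basics

section Dual
variable {K : Type} [Field K] {F L : ℕ}

@[simp] theorem nIx_nIx (r : Ix L) : nIx (nIx r) = r := by cases r <;> rfl

theorem nIx_eq_iff (r s : Ix L) : nIx r = s ↔ r = nIx s :=
  ⟨fun h => by rw [← h, nIx_nIx], fun h => by rw [h, nIx_nIx]⟩

@[simp] theorem nIx_isRight (r : Ix L) : (nIx r).isRight = !r.isRight := by cases r <;> rfl

/-- The index `r`, flipped in odd tensor slots. -/
def fl (τ : Fin F → Bool) (P : Fin F) (r : Ix L) : Ix L := if τ P then nIx r else r

theorem fl_isRight (τ : Fin F → Bool) (P : Fin F) (r : Ix L) :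
    (fl τ P r).isRight = xor (τ P) r.isRight := by
  unfold fl; cases τ P <;> simp

theorem fl_inj (τ : Fin F → Bool) (P : Fin F) {r s : Ix L} : fl τ P r = fl τ P s ↔ r = s := by
  unfold fl; cases τ P
  · simp
  · simp [nIx_eq_iff]

variable (K) in
/-- Multiplication by the variable in slot `P`, of parity `τ P`, with index `r`. -/
noncomputable def Zt (τ : Fin F → Bool) (P : Fin F) (r : Ix L) : Module.End K (FM K F L) :=
  zF P (fl τ P r)

variable (K) in
/-- The derivation dual to `Zt`. -/
noncomputable def Dt (τ : Fin F → Bool) (P : Fin F) (r : Ix L) : Module.End K (FM K F L) :=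
  dF P (fl τ P r)

/-- The parity of the variable in slot `P` with index `r`. -/
def pz (τ : Fin F → Bool) (P : Fin F) (r : Ix L) : Bool := xor (τ P) r.isRight

variable (τ : Fin F → Bool)

theorem Zt_Zt (P Q : Fin F) (r s : Ix L) :
    Zt K τ P r * Zt K τ Q s = sg K (pz τ P r && pz τ Q s) • (Zt K τ Q s * Zt K τ P r) := by
  unfold Zt
  rw [zF_zF, fl_isRight, fl_isRight]; rfl

theorem Dt_Dt (P Q : Fin F) (r s : Ix L) :
    Dt K τ P r * Dt K τ Q s = sg K (pz τ P r && pz τ Q s) • (Dt K τ Q s * Dt K τ P r) := by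
  unfold Dt
  rw [dF_dF, fl_isRight, fl_isRight]; rfl

theorem Dt_Zt (P Q : Fin F) (r s : Ix L) :
    Dt K τ P r * Zt K τ Q s = sg K (pz τ P r && pz τ Q s) • (Zt K τ Q s * Dt K τ P r)
      + if P = Q ∧ r = s then 1 else 0 := by
  unfold Dt Zt
  rw [dF_zF, fl_isRight, fl_isRight]
  congr 1
  by_cases h : P = Q
  · subst h; simp [fl_inj]
  · simp [h]

theorem Zt_Dt (P Q : Fin F) (r s : Ix L) :
    Zt K τ P r * Dt K τ Q s = sg K (pz τ P r && pz τ Q s) • (Dt K τ Q s * Zt K τ P r)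
      - if P = Q ∧ r = s then sg K (pz τ P r) • 1 else 0 := by
  rw [Dt_Zt, smul_add, smul_smul, Bool.and_comm, sg_mul_self, one_smul]
  by_cases h : P = Q ∧ r = s
  · obtain ⟨rfl, rfl⟩ := h; simp
  · have h' : ¬ (Q = P ∧ s = r) := fun h' => h ⟨h'.1.symm, h'.2.symm⟩
    simp [h, h']

theorem push_mul {T A B U V : Module.End K (FM K F L)} {x y : K}
    (hA : T * A = x • (A * T) + U) (hB : T * B = y • (B * T) + V) :
    T * (A * B) = (x * y) • ((A * B) * T) + (x • (A * V) + U * B) := by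
  rw [← mul_assoc, hA, add_mul, smul_mul_assoc, mul_assoc, hB, mul_add, mul_smul_comm, smul_add,
    smul_smul, mul_assoc, add_assoc]

theorem push_sum {ι : Type*} (s : Finset ι) {T : Module.End K (FM K F L)}
    {A U : ι → Module.End K (FM K F L)} {x : K}
    (h : ∀ i ∈ s, T * A i = x • (A i * T) + U i) :
    T * (∑ i ∈ s, A i) = x • ((∑ i ∈ s, A i) * T) + ∑ i ∈ s, U i := by
  rw [Finset.mul_sum, Finset.sum_congr rfl h, Finset.sum_add_distrib, Finset.sum_mul,
    Finset.smul_sum]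

theorem sum_push {ι : Type*} (s : Finset ι) {A : Module.End K (FM K F L)}
    {T U : ι → Module.End K (FM K F L)} {x : K}
    (h : ∀ i ∈ s, T i * A = x • (A * T i) + U i) :
    (∑ i ∈ s, T i) * A = x • (A * (∑ i ∈ s, T i)) + ∑ i ∈ s, U i := by
  rw [Finset.sum_mul, Finset.sum_congr rfl h, Finset.sum_add_distrib, Finset.mul_sum,
    Finset.smul_sum]

theorem push_smul {T A U : Module.End K (FM K F L)} {x : K} (c : K)
    (h : T * A = x • (A * T) + U) : T * (c • A) = x • ((c • A) * T) + c • U := by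
  rw [mul_smul_comm, h, smul_add, smul_mul_assoc, smul_comm]

theorem smul_push {T A U : Module.End K (FM K F L)} {x : K} (c : K)
    (h : T * A = x • (A * T) + U) : (c • T) * A = x • (A * (c • T)) + c • U := by
  rw [smul_mul_assoc, h, smul_add, mul_smul_comm, smul_comm]

theorem mul_push {S T A U V : Module.End K (FM K F L)} {x y : K}
    (hS : S * A = x • (A * S) + U) (hT : T * A = y • (A * T) + V) :
    (S * T) * A = (x * y) • (A * (S * T)) + (y • (U * T) + S * V) := by
  rw [mul_assoc, hT, mul_add, mul_smul_comm, ← mul_assoc, hS, add_mul, smul_mul_assoc, smul_add,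
    smul_smul, mul_assoc, mul_comm y x, add_assoc]

theorem sg_xor (a b : Bool) : sg K (xor a b) = sg K a * sg K b := by
  cases a <;> cases b <;> simp

/-- `Z_a D_b` acts as a superderivation on variables. -/
theorem ZD_Zt (P P' Q : Fin F) (r s t : Ix L) :
    (Zt K τ P r * Dt K τ P' s) * Zt K τ Q t
      = sg K (xor (pz τ P r) (pz τ P' s) && pz τ Q t) • (Zt K τ Q t * (Zt K τ P r * Dt K τ P' s))
        + if P' = Q ∧ s = t then Zt K τ P r else 0 := by
  rw [mul_push ((Zt_Zt τ P Q r t).trans (add_zero _).symm) (Dt_Zt τ P' Q s t)]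
  simp only [zero_mul, smul_zero, zero_add, mul_ite, mul_one, mul_zero]
  congr 2
  cases pz τ P r <;> cases pz τ P' s <;> cases pz τ Q t <;> simp

theorem ZD_Dt (P P' Q : Fin F) (r s t : Ix L) :
    (Zt K τ P r * Dt K τ P' s) * Dt K τ Q t
      = sg K (xor (pz τ P r) (pz τ P' s) && pz τ Q t) • (Dt K τ Q t * (Zt K τ P r * Dt K τ P' s))
        + if P = Q ∧ r = t then
          -(sg K (xor (pz τ P r) (pz τ P' s) && pz τ P r) • Dt K τ P' s) else 0 := by
  rw [mul_push ((Zt_Dt τ P Q r t).trans (sub_eq_add_neg _ _))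
    ((Dt_Dt τ P' Q s t).trans (add_zero _).symm)]
  congr 1
  · congr 1
    cases pz τ P r <;> cases pz τ P' s <;> cases pz τ Q t <;> simp
  · by_cases h : P = Q ∧ r = t
    · obtain ⟨rfl, rfl⟩ := h
      simp only [and_self, if_true, mul_zero, add_zero, neg_mul, smul_mul_assoc, one_mul, smul_neg,
        smul_smul]
      congr 2
      cases pz τ P r <;> cases pz τ P' s <;> simp
    · simp [h]

variable (K) in
/-- The action of the matrix unit `E_{rs}` of `gl(L|L)`. -/
noncomputable def gV (r s : Ix L) : Module.End K (FM K F L) :=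
  ∑ P : Fin F, sg K (τ P && xor r.isRight s.isRight) • (Zt K τ P r * Dt K τ P s)

variable (K) in
/-- The action of the matrix unit `E_{PQ}` of the general linear superalgebra of the slots. -/
noncomputable def gU (P Q : Fin F) : Module.End K (FM K F L) :=
  ∑ r : Ix L, Zt K τ P r * Dt K τ Q r

variable (K L) in
/-- The quadratic invariant pairing two slots. -/
noncomputable def om (P Q : Fin F) : Module.End K (FM K F L) :=
  ∑ r : Ix L, sg K (r.isRight && !τ Q) • (Zt K τ P r * Zt K τ Q (nIx r))

theorem gV_Zt (P : Fin F) (r s t : Ix L) :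
    gV K τ r s * Zt K τ P t
      = sg K (xor r.isRight s.isRight && pz τ P t) • (Zt K τ P t * gV K τ r s)
        + if s = t then sg K (τ P && xor r.isRight s.isRight) • Zt K τ P r else 0 := by
  unfold gV
  rw [sum_push _ (x := sg K (xor r.isRight s.isRight && pz τ P t))
    (U := fun Q => if Q = P then (if s = t then
      sg K (τ P && xor r.isRight s.isRight) • Zt K τ P r else 0) else 0)]
  · simp
  · intro Q _
    rw [smul_push _ (ZD_Zt τ Q Q P r s t)]
    congr 1
    · congr 2
      simp only [pz]
      cases τ Q <;> cases r.isRight <;> cases s.isRight <;> simp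
    · by_cases h : Q = P
      · subst h; by_cases h2 : s = t <;> simp [h2]
      · simp [h]

theorem gV_Dt (P : Fin F) (r s t : Ix L) :
    gV K τ r s * Dt K τ P t
      = sg K (xor r.isRight s.isRight && pz τ P t) • (Dt K τ P t * gV K τ r s)
        + if r = t then -((sg K (τ P && xor r.isRight s.isRight) *
            sg K (xor r.isRight s.isRight && pz τ P r)) • Dt K τ P s) else 0 := by
  unfold gV
  rw [sum_push _ (x := sg K (xor r.isRight s.isRight && pz τ P t))
    (U := fun Q => if Q = P then (if r = t then
      -((sg K (τ P && xor r.isRight s.isRight) *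
            sg K (xor r.isRight s.isRight && pz τ P r)) • Dt K τ P s) else 0) else 0)]
  · simp
  · intro Q _
    rw [smul_push _ (ZD_Dt τ Q Q P r s t)]
    congr 1
    · congr 2
      simp only [pz]
      cases τ Q <;> cases r.isRight <;> cases s.isRight <;> simp
    · by_cases h : Q = P
      · subst h
        by_cases h2 : r = t
        · subst h2
          simp only [and_self, if_true, smul_neg, smul_smul, pz]
          cases τ Q <;> cases r.isRight <;> cases s.isRight <;> simp
        · simp [h2]
      · simp [h]

theorem gU_Zt (P Q R : Fin F) (t : Ix L) :
    gU K τ P Q * Zt K τ R t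
      = sg K (xor (τ P) (τ Q) && pz τ R t) • (Zt K τ R t * gU K τ P Q)
        + if Q = R then Zt K τ P t else 0 := by
  unfold gU
  rw [sum_push _ (x := sg K (xor (τ P) (τ Q) && pz τ R t))
    (U := fun r => if r = t then (if Q = R then Zt K τ P t else 0) else 0)]
  · simp
  · intro r _
    rw [ZD_Zt]
    congr 1
    · congr 2
      simp only [pz]
      cases τ P <;> cases τ Q <;> cases r.isRight <;> simp
    · by_cases h : r = t
      · subst h; simp
      · simp [h]

theorem gU_Dt (P Q R : Fin F) (t : Ix L) :
    gU K τ P Q * Dt K τ R t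
      = sg K (xor (τ P) (τ Q) && pz τ R t) • (Dt K τ R t * gU K τ P Q)
        + if P = R then -(sg K (xor (τ P) (τ Q) && pz τ P t) • Dt K τ Q t) else 0 := by
  unfold gU
  rw [sum_push _ (x := sg K (xor (τ P) (τ Q) && pz τ R t))
    (U := fun r => if r = t then
      (if P = R then -(sg K (xor (τ P) (τ Q) && pz τ P t) • Dt K τ Q t) else 0) else 0)]
  · simp
  · intro r _
    rw [ZD_Dt]
    congr 1
    · congr 2
      simp only [pz]
      cases τ P <;> cases τ Q <;> cases r.isRight <;> simp
    · by_cases h : r = t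
      · subst h
        by_cases h2 : P = R
        · simp only [h2, and_self, if_true, pz]
          cases τ R <;> cases τ Q <;> cases r.isRight <;> simp
        · simp [h2]
      · simp [h]

/-- The two actions supercommute. -/
theorem gV_gU (r s : Ix L) (P Q : Fin F) :
    gV K τ r s * gU K τ P Q
      = sg K (xor r.isRight s.isRight && xor (τ P) (τ Q)) • (gU K τ P Q * gV K τ r s) := by
  have h : ∀ t ∈ (Finset.univ : Finset (Ix L)), gV K τ r s * (Zt K τ P t * Dt K τ Q t)
      = sg K (xor r.isRight s.isRight && xor (τ P) (τ Q)) • ((Zt K τ P t * Dt K τ Q t) * gV K τ r s)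
        + ((if r = t then -(sg K (τ P && xor r.isRight s.isRight) • (Zt K τ P r * Dt K τ Q s))
            else 0)
          + if s = t then sg K (τ P && xor r.isRight s.isRight) • (Zt K τ P r * Dt K τ Q s)
            else 0) := by
    intro t _
    rw [push_mul (gV_Zt τ P r s t) (gV_Dt τ Q r s t)]
    congr 1
    · congr 1
      simp only [pz]
      cases τ P <;> cases τ Q <;> cases r.isRight <;> cases s.isRight <;> cases t.isRight <;> simp
    · congr 1
      · by_cases h : r = t
        · subst h
          simp only [if_true, mul_neg, smul_neg, mul_smul_comm, smul_smul, pz]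
          congr 2
          cases τ P <;> cases τ Q <;> cases r.isRight <;> cases s.isRight <;> simp
        · simp [h]
      · by_cases h : s = t
        · subst h; simp
        · simp [h]
  unfold gU
  rw [push_sum _ h]
  simp [Finset.sum_add_distrib]

/-- The sign relating the two matrix units in a root vector of `p(L)`. -/
def etaP (K : Type) [Field K] (r s : Ix L) : K := sg K (!(!r.isRight && s.isRight))

variable (K) in
/-- The action of `p(L)`. -/
noncomputable def pX (r s : Ix L) : Module.End K (FM K F L) :=
  gV K τ r s + etaP K r s • gV K τ (nIx s) (nIx r)

theorem gV_om (r s : Ix L) (P Q : Fin F) :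
    gV K τ r s * om K L τ P Q
      = sg K (xor r.isRight s.isRight && xor (τ P) (!τ Q)) • (om K L τ P Q * gV K τ r s)
        + ((sg K (s.isRight && !τ Q) * sg K (τ P && xor r.isRight s.isRight))
              • (Zt K τ P r * Zt K τ Q (nIx s))
          + (sg K ((!s.isRight) && !τ Q) * sg K (xor r.isRight s.isRight && pz τ P (nIx s)) *
              sg K (τ Q && xor r.isRight s.isRight)) • (Zt K τ P (nIx s) * Zt K τ Q r)) := by
  have h : ∀ t ∈ (Finset.univ : Finset (Ix L)),
      gV K τ r s * (sg K (t.isRight && !τ Q) • (Zt K τ P t * Zt K τ Q (nIx t)))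
      = sg K (xor r.isRight s.isRight && xor (τ P) (!τ Q)) •
          ((sg K (t.isRight && !τ Q) • (Zt K τ P t * Zt K τ Q (nIx t))) * gV K τ r s)
        + ((if s = t then (sg K (s.isRight && !τ Q) * sg K (τ P && xor r.isRight s.isRight))
              • (Zt K τ P r * Zt K τ Q (nIx s)) else 0) +
          (if nIx s = t then (sg K ((!s.isRight) && !τ Q) *
              sg K (xor r.isRight s.isRight && pz τ P (nIx s)) *
              sg K (τ Q && xor r.isRight s.isRight)) • (Zt K τ P (nIx s) * Zt K τ Q r) else 0)) :=
                  by
    intro t _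
    rw [push_smul _ (push_mul (gV_Zt τ P r s t) (gV_Zt τ Q r s (nIx t)))]
    congr 1
    · congr 1
      simp only [pz, nIx_isRight]
      cases τ P <;> cases τ Q <;> cases r.isRight <;> cases s.isRight <;> cases t.isRight <;> simp
    · rw [add_comm, smul_add]
      congr 1
      · by_cases h : s = t
        · subst h
          simp [smul_smul]
        · simp [h]
      · by_cases h : nIx s = t
        · subst h
          simp [smul_smul, mul_assoc]
        · have h' : ¬ s = nIx t := fun e => h (by rw [e, nIx_nIx])
          simp [h, h']
  unfold om
  rw [push_sum _ h]
  simp [Finset.sum_add_distrib]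

theorem pX_om (r s : Ix L) (P Q : Fin F) :
    pX K τ r s * om K L τ P Q
      = sg K (xor r.isRight s.isRight && xor (τ P) (!τ Q)) • (om K L τ P Q * pX K τ r s) := by
  unfold pX
  rw [add_mul, smul_mul_assoc, gV_om, gV_om]
  simp only [nIx_isRight, nIx_nIx, Bool.not_not, mul_add, smul_add, mul_smul_comm, smul_smul]
  rw [show ∀ a b c d e f : Module.End K (FM K F L), a + (b + c) + (d + (e + f))
    = (a + d) + ((b + f) + (c + e)) from fun a b c d e f => by abel]
  rw [← add_smul, ← add_smul]
  simp only [pz, etaP, nIx_isRight]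
  cases τ P <;> cases τ Q <;> cases r.isRight <;> cases s.isRight <;> simp

theorem gU_om (P Q R S : Fin F) :
    gU K τ P Q * om K L τ R S
      = sg K (xor (τ P) (τ Q) && xor (τ R) (!τ S)) • (om K L τ R S * gU K τ P Q)
        + ((if Q = R then om K L τ P S else 0)
          + if Q = S then sg K (xor (τ P) (τ Q) && τ R) • om K L τ R P else 0) := by
  have h : ∀ t ∈ (Finset.univ : Finset (Ix L)),
      gU K τ P Q * (sg K (t.isRight && !τ S) • (Zt K τ R t * Zt K τ S (nIx t)))
      = sg K (xor (τ P) (τ Q) && xor (τ R) (!τ S)) •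
          ((sg K (t.isRight && !τ S) • (Zt K τ R t * Zt K τ S (nIx t))) * gU K τ P Q)
        + ((if Q = R then sg K (t.isRight && !τ S) • (Zt K τ P t * Zt K τ S (nIx t)) else 0)
          + if Q = S then sg K (xor (τ P) (τ Q) && τ R) •
            (sg K (t.isRight && !τ P) • (Zt K τ R t * Zt K τ P (nIx t))) else 0) := by
    intro t _
    rw [push_smul _ (push_mul (gU_Zt τ P Q R t) (gU_Zt τ P Q S (nIx t)))]
    congr 1
    · congr 1
      simp only [pz, nIx_isRight]
      cases τ P <;> cases τ Q <;> cases τ R <;> cases τ S <;> cases t.isRight <;> simp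
    · rw [add_comm, smul_add]
      congr 1
      · by_cases h : Q = R <;> simp [h]
      · by_cases h : Q = S
        · subst h
          simp only [if_true, smul_smul, pz]
          congr 1
          cases τ P <;> cases τ Q <;> cases τ R <;> cases t.isRight <;> simp
        · simp [h]
  rw [om, push_sum _ h]
  simp only [Finset.sum_add_distrib, om, Finset.smul_sum]
  congr 2 <;> split_ifs <;> simp

theorem sum_nIx {N : Type*} [AddCommMonoid N] (f : Ix L → N) :
    ∑ r : Ix L, f (nIx r) = ∑ r : Ix L, f r :=
  Fintype.sum_equiv (Equiv.sumComm _ _) _ _ (fun r => by cases r <;> rfl)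

theorem om_symm (P Q : Fin F) :
    om K L τ Q P = -(sg K (τ P && τ Q) • om K L τ P Q) := by
  unfold om
  rw [← sum_nIx, Finset.smul_sum, ← Finset.sum_neg_distrib]
  refine Finset.sum_congr rfl fun r _ => ?_
  rw [Zt_Zt, nIx_nIx, smul_smul, smul_smul, ← neg_smul]
  congr 1
  simp only [pz, nIx_isRight]
  cases τ P <;> cases τ Q <;> cases r.isRight <;> simp

end Dual

section Dual0
variable {K : Type} [Field K] {F L : ℕ}

/-- The slot parity for which all slots are even. -/
def tz : Fin F → Bool := fun _ => false

@[simp] theorem pz_tz (P : Fin F) (r : Ix L) : pz tz P r = r.isRight := by simp [pz, tz]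

variable (K L) in
/-- The quadratic differential operator pairing two slots. -/
noncomputable def bg (P Q : Fin F) : Module.End K (FM K F L) :=
  ∑ r : Ix L, Dt K tz P r * Dt K tz Q (nIx r)

theorem bg_symm (P Q : Fin F) : bg K L P Q = bg K L Q P := by
  unfold bg
  rw [← sum_nIx]
  refine Finset.sum_congr rfl fun r _ => ?_
  rw [Dt_Dt, nIx_nIx]
  cases h : r.isRight <;> simp [h]

theorem gU_bg (P Q R S : Fin F) :
    gU K tz P Q * bg K L R S = bg K L R S * gU K tz P Q
      - ((if P = R then bg K L Q S else 0) + if P = S then bg K L R Q else 0) := by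
  have h : ∀ t ∈ (Finset.univ : Finset (Ix L)),
      gU K tz P Q * (Dt K tz R t * Dt K tz S (nIx t))
      = (1:K) • ((Dt K tz R t * Dt K tz S (nIx t)) * gU K tz P Q)
        + (-(if P = R then Dt K tz Q t * Dt K tz S (nIx t) else 0)
          - if P = S then Dt K tz R t * Dt K tz Q (nIx t) else 0) := by
    intro t _
    rw [push_mul (gU_Dt tz P Q R t) (gU_Dt tz P Q S (nIx t))]
    simp only [tz, Bool.xor_false, Bool.false_and, sg_false, one_mul, one_smul]
    congr 1
    rw [add_comm, sub_eq_add_neg]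
    congr 1 <;> split_ifs <;> simp
  rw [bg, push_sum _ h, one_smul]
  rw [Finset.sum_sub_distrib, Finset.sum_neg_distrib, sub_eq_add_neg _ (_ + _), neg_add,
    ← sub_eq_add_neg, bg, bg]
  congr 3 <;> split_ifs <;> simp

theorem gV_bg (r s : Ix L) (P Q : Fin F) :
    gV K tz r s * bg K L P Q
      = sg K (xor r.isRight s.isRight) • (bg K L P Q * gV K tz r s)
        + (-(sg K (xor r.isRight s.isRight && r.isRight) • (Dt K tz P s * Dt K tz Q (nIx r)))
          + -(sg K (xor r.isRight s.isRight) • (Dt K tz P (nIx r) * Dt K tz Q s))) := by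
  have h : ∀ t ∈ (Finset.univ : Finset (Ix L)),
      gV K tz r s * (Dt K tz P t * Dt K tz Q (nIx t))
      = sg K (xor r.isRight s.isRight) • ((Dt K tz P t * Dt K tz Q (nIx t)) * gV K tz r s)
        + ((if r = t then
            -(sg K (xor r.isRight s.isRight && r.isRight) • (Dt K tz P s * Dt K tz Q (nIx r))) else
                0)
          + if nIx r = t then -(sg K (xor r.isRight s.isRight) • (Dt K tz P (nIx r) * Dt K tz Q s))
              else 0) := by
    intro t _
    rw [push_mul (gV_Dt tz P r s t) (gV_Dt tz Q r s (nIx t))]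
    congr 1
    · congr 1
      simp only [pz_tz, nIx_isRight]
      cases r.isRight <;> cases s.isRight <;> cases t.isRight <;> simp
    · rw [add_comm]
      congr 1
      · by_cases h : r = t
        · subst h
          simp [tz]
        · simp [h]
      · by_cases h : nIx r = t
        · subst h
          simp only [nIx_nIx, if_true, mul_neg, mul_smul_comm, smul_neg, smul_smul, pz_tz, tz,
            nIx_isRight, Bool.false_and, sg_false, one_mul, ← sg_xor]
          congr 2
          cases r.isRight <;> cases s.isRight <;> simp
        · have h' : ¬ r = nIx t := fun e => h (by rw [e, nIx_nIx])
          simp [h, h']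
  rw [bg, push_sum _ h]
  simp [Finset.sum_add_distrib]

theorem pX_bg (r s : Ix L) (P Q : Fin F) :
    pX K tz r s * bg K L P Q
      = sg K (xor r.isRight s.isRight) • (bg K L P Q * pX K tz r s) := by
  unfold pX
  rw [add_mul, smul_mul_assoc, gV_bg, gV_bg]
  simp only [nIx_isRight, nIx_nIx, mul_add, smul_add, mul_smul_comm, smul_neg, smul_smul]
  rw [show ∀ a b c d e f : Module.End K (FM K F L), a + (-b + -c) + (d + (-e + -f))
    = (a + d) - ((b + f) + (e + c)) from fun a b c d e f => by abel]
  rw [← add_smul, ← add_smul]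
  simp only [etaP]
  cases r.isRight <;> cases s.isRight <;> simp

theorem pX_gU (τ : Fin F → Bool) (r s : Ix L) (P Q : Fin F) :
    pX K τ r s * gU K τ P Q
      = sg K (xor r.isRight s.isRight && xor (τ P) (τ Q)) • (gU K τ P Q * pX K τ r s) := by
  unfold pX
  rw [add_mul, smul_mul_assoc, gV_gU, gV_gU, mul_add, smul_add, mul_smul_comm, smul_comm]
  simp only [nIx_isRight]
  congr 3
  cases r.isRight <;> cases s.isRight <;> simp

theorem gU_gU (P Q R S : Fin F) :
    gU K (L := L) tz P Q * gU K tz R S = gU K tz R S * gU K tz P Q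
      + ((if Q = R then gU K tz P S else 0) - if P = S then gU K tz R Q else 0) := by
  have h : ∀ t ∈ (Finset.univ : Finset (Ix L)),
      gU K tz P Q * (Zt K tz R t * Dt K tz S t)
      = (1:K) • ((Zt K tz R t * Dt K tz S t) * gU K tz P Q)
        + ((if Q = R then Zt K tz P t * Dt K tz S t else 0)
          - if P = S then Zt K tz R t * Dt K tz Q t else 0) := by
    intro t _
    rw [push_mul (gU_Zt tz P Q R t) (gU_Dt tz P Q S t)]
    simp only [tz, Bool.xor_false, Bool.false_and, sg_false, one_mul, one_smul]
    congr 1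
    rw [add_comm, sub_eq_add_neg]
    congr 1 <;> split_ifs <;> simp
  have h' := push_sum _ h
  rw [one_smul, Finset.sum_sub_distrib] at h'
  refine h'.trans ?_
  simp only [gU]
  congr 2 <;> split_ifs <;> simp

theorem bg_Dt (P Q R : Fin F) (t : Ix L) :
    bg K L P Q * Dt K tz R t = sg K t.isRight • (Dt K tz R t * bg K L P Q) := by
  have := sum_push Finset.univ (A := Dt K tz R t) (x := sg K t.isRight)
    (T := fun r : Ix L => Dt K tz P r * Dt K tz Q (nIx r)) (U := fun _ => 0) (fun r _ => by
      rw [mul_push ((Dt_Dt tz P R r t).trans (add_zero _).symm)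
        ((Dt_Dt tz Q R (nIx r) t).trans (add_zero _).symm)]
      simp only [pz_tz, nIx_isRight]
      cases r.isRight <;> cases t.isRight <;> simp)
  rw [Finset.sum_const_zero, add_zero] at this
  exact this

theorem om_Zt (P Q R : Fin F) (t : Ix L) :
    om K L tz P Q * Zt K tz R t = sg K t.isRight • (Zt K tz R t * om K L tz P Q) := by
  have := sum_push Finset.univ (A := Zt K tz R t) (x := sg K t.isRight)
    (T := fun r : Ix L => sg K (r.isRight && !(tz Q)) • (Zt K tz P r * Zt K tz Q (nIx r)))
    (U := fun _ => 0) (fun r _ => by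
      rw [smul_push _ (mul_push ((Zt_Zt tz P R r t).trans (add_zero _).symm)
        ((Zt_Zt tz Q R (nIx r) t).trans (add_zero _).symm))]
      simp only [pz_tz, nIx_isRight]
      cases r.isRight <;> cases t.isRight <;> simp)
  rw [Finset.sum_const_zero, add_zero] at this
  exact this

theorem bg_bg (P Q R S : Fin F) : bg K L P Q * bg K L R S = -(bg K L R S * bg K L P Q) := by
  have := push_sum Finset.univ (T := bg K L P Q) (x := -1)
    (A := fun r : Ix L => Dt K tz R r * Dt K tz S (nIx r)) (U := fun _ => 0) (fun r _ => by
      rw [push_mul ((bg_Dt P Q R r).trans (add_zero _).symm)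
        ((bg_Dt P Q S (nIx r)).trans (add_zero _).symm)]
      simp only [nIx_isRight]
      cases r.isRight <;> simp)
  rw [Finset.sum_const_zero, add_zero, neg_smul, one_smul] at this
  exact this

theorem om_om (P Q R S : Fin F) :
    om K L tz P Q * om K L tz R S = -(om K L tz R S * om K L tz P Q) := by
  have := push_sum Finset.univ (T := om K L tz P Q) (x := -1)
    (A := fun r : Ix L => sg K (r.isRight && !(tz S)) • (Zt K tz R r * Zt K tz S (nIx r)))
    (U := fun _ => 0) (fun r _ => by
      rw [push_smul _ (push_mul ((om_Zt P Q R r).trans (add_zero _).symm)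
        ((om_Zt P Q S (nIx r)).trans (add_zero _).symm))]
      simp only [nIx_isRight]
      cases r.isRight <;> simp)
  rw [Finset.sum_const_zero, add_zero, neg_smul, one_smul] at this
  exact this

theorem bg_Zt (P Q R : Fin F) (t : Ix L) :
    bg K L P Q * Zt K tz R t = sg K t.isRight • (Zt K tz R t * bg K L P Q)
      + ((if P = R then Dt K tz Q (nIx t) else 0) + if Q = R then Dt K tz P (nIx t) else 0) := by
  have := sum_push Finset.univ (A := Zt K tz R t) (x := sg K t.isRight)
    (T := fun r : Ix L => Dt K tz P r * Dt K tz Q (nIx r))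
    (U := fun r => (if r = t then if P = R then Dt K tz Q (nIx t) else 0 else 0)
      + if r = nIx t then if Q = R then Dt K tz P (nIx t) else 0 else 0) (fun r _ => by
      rw [mul_push (Dt_Zt tz P R r t) (Dt_Zt tz Q R (nIx r) t)]
      simp only [pz_tz, nIx_isRight]
      congr 1
      · cases r.isRight <;> cases t.isRight <;> simp
      · congr 1
        · by_cases h : r = t
          · subst h; by_cases h2 : P = R <;> cases r.isRight <;> simp [h2]
          · simp [h]
        · by_cases h : r = nIx t
          · subst h; by_cases h2 : Q = R <;> simp [h2]
          · have h' : ¬ nIx r = t := fun e => h (by rw [← e, nIx_nIx])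
            simp [h, h'])
  refine this.trans ?_
  rw [← bg]
  simp [Finset.sum_add_distrib]

theorem sum_sg : ∑ t : Ix L, sg K t.isRight = 0 := by
  simp [Fintype.sum_sum_type]

theorem bg_om (P Q R S : Fin F) :
    bg K L P Q * om K L tz R S = -(om K L tz R S * bg K L P Q)
      + ((if Q = S then gU K tz R P else 0) + (if P = S then gU K tz R Q else 0)
        - (if Q = R then gU K tz S P else 0) - (if P = R then gU K tz S Q else 0)) := by
  have key : ∀ X Y : Fin F, ∑ t : Ix L, sg K t.isRight • (Dt K tz X (nIx t) * Zt K tz Y (nIx t))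
      = - gU K tz Y X := by
    intro X Y
    have : ∀ t : Ix L, sg K t.isRight • (Dt K tz X (nIx t) * Zt K tz Y (nIx t))
      = -(Zt K tz Y (nIx t) * Dt K tz X (nIx t)) + sg K t.isRight • (if X = Y then 1 else 0) := by
      intro t
      rw [Dt_Zt, smul_add, smul_smul]
      simp only [pz_tz, nIx_isRight]
      cases t.isRight <;> simp
    rw [Finset.sum_congr rfl fun t _ => this t, Finset.sum_add_distrib, ← Finset.sum_smul, sum_sg,
      zero_smul, add_zero, Finset.sum_neg_distrib, gU,
      sum_nIx (fun t => Zt K tz Y t * Dt K tz X t)]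
  have := push_sum Finset.univ (T := bg K L P Q) (x := -1)
    (A := fun r : Ix L => sg K (r.isRight && !(tz S)) • (Zt K tz R r * Zt K tz S (nIx r)))
    (U := fun r => ((if Q = S then Zt K tz R r * Dt K tz P r else 0)
      + (if P = S then Zt K tz R r * Dt K tz Q r else 0))
      + ((if Q = R then sg K r.isRight • (Dt K tz P (nIx r) * Zt K tz S (nIx r)) else 0)
      + (if P = R then sg K r.isRight • (Dt K tz Q (nIx r) * Zt K tz S (nIx r)) else 0)))
    (fun r _ => by
      rw [push_smul _ (push_mul (bg_Zt P Q R r) (bg_Zt P Q S (nIx r)))]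
      simp only [nIx_isRight, nIx_nIx]
      congr 1
      · cases r.isRight <;> simp
      · rw [smul_add, smul_smul]
        congr 1
        · rw [add_comm]
          by_cases h1 : Q = S <;> by_cases h2 : P = S <;> cases r.isRight <;>
            simp [h1, h2, mul_add, tz]
        · rw [add_comm]
          by_cases h1 : Q = R <;> by_cases h2 : P = R <;> cases r.isRight <;>
            simp [h1, h2, add_mul, tz])
  refine this.trans ?_
  rw [← om]
  have ite_sum : ∀ (p : Prop) [Decidable p] (f : Ix L → Module.End K (FM K F L)),
      ∑ r, (if p then f r else 0) = if p then ∑ r, f r else 0 := by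
    intro p _ f; split_ifs <;> simp
  simp only [Finset.sum_add_distrib, ite_sum, key, gU, neg_smul, one_smul]
  congr 1
  split_ifs <;> simp <;> abel

end Dual0

section Grading
variable {K : Type} [Field K] {F L : ℕ}

/-- The exponent of a variable in a monomial. -/
def ex (b : MonB F L) (p : Fin F) : Ix L → ℕ :=
  Sum.elim (fun l => b.1 (p, l)) (fun l => if b.2 (p, l) then 1 else 0)

theorem ex_injective {b c : MonB F L} (h : ∀ p r, ex b p r = ex c p r) : b = c := by
  refine Prod.ext (funext fun x => h x.1 (Sum.inl x.2)) (funext fun x => ?_)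
  have := h x.1 (Sum.inr x.2)
  simp only [ex, Sum.elim_inr] at this
  cases hb : b.2 x <;> cases hc : c.2 x <;> simp_all

theorem zF_bF (p : Fin F) (r : Ix L) (b : MonB F L) :
    zF p r (bF K b) = 0 ∨ ∃ (c : K) (b' : MonB F L), c ≠ 0 ∧ zF p r (bF K b) = c • bF K b' ∧
      ∀ q s, ex b' q s = ex b q s + if q = p ∧ s = r then 1 else 0 := by
  rcases r with l | l
  · refine Or.inr ⟨1, _, one_ne_zero, (zE_bvec p l b).trans (one_smul _ _).symm, ?_⟩
    rintro q (s | s)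
    · by_cases h : (q, s) = (p, l)
      · obtain ⟨rfl, rfl⟩ := Prod.mk.inj h; simp [ex]
      · have h' : ¬ (q = p ∧ s = l) := fun h' => h (by rw [h'.1, h'.2])
        simp [ex, h']
    · simp [ex]
  · by_cases hb : b.2 (p, l)
    · exact Or.inl ((zO_bvec p l b).trans (if_pos hb))
    · refine Or.inr ⟨(-1) ^ oddBefore b.2 (p, l), _, pow_ne_zero _ (by simp),
        (zO_bvec p l b).trans (if_neg hb), ?_⟩
      rintro q (s | s)
      · simp [ex]
      · by_cases h : (q, s) = (p, l)
        · obtain ⟨rfl, rfl⟩ := Prod.mk.inj h; simp [ex, hb]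
        · have h' : ¬ (q = p ∧ s = l) := fun h' => h (by rw [h'.1, h'.2])
          simp [ex, h']

theorem dF_bF (p : Fin F) (r : Ix L) (b : MonB F L) :
    (ex b p r = 0 ∧ dF p r (bF K b) = 0) ∨ ∃ (c : K) (b' : MonB F L),
      dF p r (bF K b) = c • bF K b' ∧
      ∀ q s, ex b q s = ex b' q s + if q = p ∧ s = r then 1 else 0 := by
  rcases r with l | l
  · rcases Nat.eq_zero_or_pos (b.1 (p, l)) with hb | hb
    · exact Or.inl ⟨hb, (dE_bvec p l b).trans (by rw [hb, Nat.cast_zero]; exact zero_smul K _)⟩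
    refine Or.inr ⟨_, _, dE_bvec p l b, ?_⟩
    rintro q (s | s)
    · by_cases h : (q, s) = (p, l)
      · obtain ⟨rfl, rfl⟩ := Prod.mk.inj h
        simp only [ex, Sum.elim_inl, Function.update_self, and_self, if_true]
        omega
      · have h' : ¬ (q = p ∧ s = l) := fun h' => h (by rw [h'.1, h'.2])
        simp [ex, h']
    · simp [ex]
  · by_cases hb : b.2 (p, l)
    · refine Or.inr ⟨(-1) ^ oddBefore b.2 (p, l), _, (dO_bvec p l b).trans (if_pos hb), ?_⟩
      rintro q (s | s)
      · simp [ex]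
      · by_cases h : (q, s) = (p, l)
        · obtain ⟨rfl, rfl⟩ := Prod.mk.inj h; simp [ex, hb]
        · have h' : ¬ (q = p ∧ s = l) := fun h' => h (by rw [h'.1, h'.2])
          simp [ex, h']
    · exact Or.inl ⟨by simp [ex, hb], (dO_bvec p l b).trans (if_neg hb)⟩

theorem zF_dF_bF (p : Fin F) (r : Ix L) (b : MonB F L) :
    zF p r (dF p r (bF K b)) = (ex b p r : K) • bF K b := by
  rcases r with l | l
  · change zE K F L p l (dE K F L p l (bvec K F L b)) = (ex b p (Sum.inl l) : K) • bvec K F L b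
    rw [dE_bvec, map_smul, zE_bvec]
    rcases Nat.eq_zero_or_pos (b.1 (p, l)) with hb | hb
    · simp [ex, hb]
    · simp [ex, Nat.sub_add_cancel hb]
  · change zO K F L p l (dO K F L p l (bvec K F L b)) = (ex b p (Sum.inr l) : K) • bvec K F L b
    rw [dO_bvec]
    by_cases hb : b.2 (p, l)
    · simp only [hb, if_true, map_smul, zO_bvec, Function.update_self, oddBefore_update_self,
        ex, Sum.elim_inr]
      rw [if_neg (by simp)]
      simp only [Function.update_idem]
      rw [← hb]
      simp [smul_smul, ← pow_add, ← two_mul]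
    · simp [hb, ex]

variable {G : Type} [AddCommGroup G]

/-- The weight of a monomial, for given weights of the variables. -/
def wtG (w : Fin F → Ix L → G) (b : MonB F L) : G := ∑ p, ∑ r, ex b p r • w p r

theorem wtG_add {b b' : MonB F L} {p : Fin F} {r : Ix L}
    (h : ∀ q s, ex b' q s = ex b q s + if q = p ∧ s = r then 1 else 0) (w : Fin F → Ix L → G) :
    wtG w b' = wtG w b + w p r := by
  unfold wtG
  simp only [h, add_smul, Finset.sum_add_distrib]
  congr 1
  rw [Finset.sum_eq_single p, Finset.sum_eq_single r]
  · simp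
  · intro s _ hs; simp [hs]
  · simp
  · intro q _ hq; simp [hq]
  · simp

variable (K) in
/-- A diagonal operator depending on the weight. -/
noncomputable def dgW (w : Fin F → Ix L → G) (φ : G → K) : Module.End K (FM K F L) :=
  (opOf K F L fun b => φ (wtG w b) • bvec K F L b : Module.End K (SM K F L))

theorem dgW_bF (w : Fin F → Ix L → G) (φ : G → K) (b : MonB F L) :
    dgW K w φ (bF K b) = φ (wtG w b) • bF K b := opOf_bvec _ _

theorem co_dgW (w : Fin F → Ix L → G) (φ : G → K) (b : MonB F L) (x : FM K F L) :
    co b (dgW K w φ x) = φ (wtG w b) * co b x := by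
  have : co b ∘ₗ dgW K w φ = φ (wtG w b) • co b := by
    refine FM_hom_ext fun c => ?_
    simp only [LinearMap.comp_apply, dgW_bF, map_smul, LinearMap.smul_apply, co_bF]
    split_ifs with h
    · rw [h]
    · simp
  exact LinearMap.congr_fun this x

theorem zF_dgW (w : Fin F → Ix L → G) (φ : G → K) (p : Fin F) (r : Ix L) :
    zF p r * dgW K w φ = dgW K w (fun g => φ (g - w p r)) * zF p r := by
  refine FM_hom_ext fun b => ?_
  simp only [Module.End.mul_apply, dgW_bF, map_smul]
  rcases zF_bF (K := K) p r b with h | ⟨c, b', -, h, h'⟩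
  · simp [h]
  · simp only [h, map_smul, dgW_bF, wtG_add h', add_sub_cancel_right]
    rw [smul_comm]

theorem dF_dgW (w : Fin F → Ix L → G) (φ : G → K) (p : Fin F) (r : Ix L) :
    dF p r * dgW K w φ = dgW K w (fun g => φ (g + w p r)) * dF p r := by
  refine FM_hom_ext fun b => ?_
  simp only [Module.End.mul_apply, dgW_bF, map_smul]
  rcases dF_bF (K := K) p r b with ⟨-, h⟩ | ⟨c, b', h, h'⟩
  · simp [h]
  · simp only [h, map_smul, dgW_bF, wtG_add h']
    rw [smul_comm]

theorem dgW_mul (w : Fin F → Ix L → G) (φ ψ : G → K) :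
    dgW K w φ * dgW K w ψ = dgW K w (fun g => φ g * ψ g) := by
  refine FM_hom_ext fun b => ?_
  simp [dgW_bF, smul_smul, mul_comm]

theorem dgW_comm {G' : Type} [AddCommGroup G'] (w : Fin F → Ix L → G) (w' : Fin F → Ix L → G')
    (φ : G → K) (ψ : G' → K) : dgW K w φ * dgW K w' ψ = dgW K w' ψ * dgW K w φ := by
  refine FM_hom_ext fun b => ?_
  simp [dgW_bF, smul_smul, mul_comm]

open Classical in
variable (K) in
/-- The projection to a weight component. -/
noncomputable def prW (w : Fin F → Ix L → G) (g : G) : Module.End K (FM K F L) :=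
  dgW K w fun h => if h = g then 1 else 0

open Classical in
theorem co_prW (w : Fin F → Ix L → G) (g : G) (b : MonB F L) (x : FM K F L) :
    co b (prW K w g x) = if wtG w b = g then co b x else 0 := by
  rw [prW, co_dgW]; split_ifs <;> simp

open Classical in
theorem prW_bF (w : Fin F → Ix L → G) (g : G) (b : MonB F L) :
    prW K w g (bF K b) = if wtG w b = g then bF K b else 0 := by
  rw [prW, dgW_bF]; split_ifs <;> simp

theorem zF_prW (w : Fin F → Ix L → G) (g : G) (p : Fin F) (r : Ix L) :
    zF p r * prW K w g = prW K w (g + w p r) * zF p r := by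
  classical
  unfold prW
  rw [zF_dgW]
  simp only [sub_eq_iff_eq_add]

theorem dF_prW (w : Fin F → Ix L → G) (g : G) (p : Fin F) (r : Ix L) :
    dF p r * prW K w g = prW K w (g - w p r) * dF p r := by
  classical
  unfold prW
  rw [dF_dgW]
  simp only [eq_sub_iff_add_eq]

theorem prW_mul_self (w : Fin F → Ix L → G) (g : G) : prW K w g * prW K w g = prW K w g := by
  unfold prW
  rw [dgW_mul]
  congr 1; ext h; split_ifs <;> simp

theorem prW_mul_of_ne (w : Fin F → Ix L → G) {g h : G} (hgh : g ≠ h) :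
    prW K w g * prW K w h = 0 := by
  refine FM_hom_ext fun b => ?_
  rw [Module.End.mul_apply, prW_bF]
  split_ifs with hb
  · rw [prW_bF, if_neg (by rw [hb]; exact hgh.symm)]; rfl
  · simp

/-- The weight giving the parity of monomials. -/
def wpar : Fin F → Ix L → ZMod 2 := fun _ r => if r.isRight then 1 else 0

variable (K F L) in
/-- The parity operator. -/
noncomputable def PiO : Module.End K (FM K F L) := dgW K wpar fun h => if h = 0 then 1 else -1

theorem PiO_PiO : PiO K F L * PiO K F L = 1 := by
  unfold PiO
  rw [dgW_mul]
  refine FM_hom_ext fun b => ?_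
  rw [dgW_bF]
  split_ifs <;> simp

theorem zmod2_sign (h : ZMod 2) : (if h + 1 = 0 then (1:K) else -1) = -if h = 0 then 1 else -1 := by
  have h2 : ∀ g : ZMod 2, g + 1 = 0 ↔ ¬ g = 0 := by decide
  by_cases hh : h = 0 <;> simp [h2, hh]

theorem zF_PiO (p : Fin F) (r : Ix L) :
    zF p r * PiO K F L = sg K r.isRight • (PiO K F L * zF p r) := by
  unfold PiO
  rw [zF_dgW]
  rcases r with l | l
  · simp [wpar]
  · have : ∀ g : ZMod 2, g - wpar (F := F) p (Sum.inr l) = g + 1 := by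
      intro g
      simp only [wpar, Sum.isRight_inr, if_true]
      revert g; decide
    simp only [this, zmod2_sign]
    refine FM_hom_ext fun b => ?_
    simp only [Module.End.mul_apply, LinearMap.smul_apply]
    rcases zF_bF (K := K) p (Sum.inr l) b with h | ⟨c, b', -, h, h'⟩
    · simp [h]
    · simp only [h, dgW_bF, map_smul, Sum.isRight_inr, sg_true]
      split_ifs <;> simp

theorem dF_PiO (p : Fin F) (r : Ix L) :
    dF p r * PiO K F L = sg K r.isRight • (PiO K F L * dF p r) := by
  unfold PiO
  rw [dF_dgW]
  rcases r with l | l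
  · simp [wpar]
  · have : ∀ g : ZMod 2, g + wpar (F := F) p (Sum.inr l) = g + 1 := by
      intro g
      simp only [wpar, Sum.isRight_inr, if_true]
    simp only [this, zmod2_sign]
    refine FM_hom_ext fun b => ?_
    simp only [Module.End.mul_apply, LinearMap.smul_apply]
    rcases dF_bF (K := K) p (Sum.inr l) b with ⟨-, h⟩ | ⟨c, b', h, h'⟩
    · simp [h]
    · simp only [h, dgW_bF, map_smul, Sum.isRight_inr, sg_true]
      split_ifs <;> simp

end Grading

section Slots
variable {K : Type} [Field K] {F L : ℕ}

/-- The weight of a variable recording its slot. -/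
def wsl : Fin F → Ix L → (Fin F → ℤ) := fun p _ => Pi.single p 1

variable (K L) in
/-- The projection to a slot multidegree. -/
noncomputable def prS (l : Fin F → ℤ) : Module.End K (FM K F L) := prW K wsl l

/-- `T` shifts the slot multidegree by `w`. -/
def Shifts (T : Module.End K (FM K F L)) (w : Fin F → ℤ) : Prop :=
  ∀ l, T * prS K L l = prS K L (l + w) * T

theorem Shifts.mul {T S : Module.End K (FM K F L)} {v w : Fin F → ℤ}
    (hT : Shifts T v) (hS : Shifts S w) : Shifts (T * S) (v + w) := fun l => by
  rw [mul_assoc, hS l, ← mul_assoc, hT, mul_assoc, add_assoc, add_comm w v]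

theorem Shifts.add {T S : Module.End K (FM K F L)} {w : Fin F → ℤ}
    (hT : Shifts T w) (hS : Shifts S w) : Shifts (T + S) w := fun l => by
  rw [add_mul, hS l, hT l, mul_add]

theorem Shifts.sub {T S : Module.End K (FM K F L)} {w : Fin F → ℤ}
    (hT : Shifts T w) (hS : Shifts S w) : Shifts (T - S) w := fun l => by
  rw [sub_mul, hS l, hT l, mul_sub]

theorem Shifts.smul {T : Module.End K (FM K F L)} {w : Fin F → ℤ} (c : K)
    (hT : Shifts T w) : Shifts (c • T) w := fun l => by
  rw [smul_mul_assoc, hT l, mul_smul_comm]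

theorem Shifts.zero (w : Fin F → ℤ) : Shifts (0 : Module.End K (FM K F L)) w := fun l => by
  rw [zero_mul, mul_zero]

theorem Shifts.sum {ι : Type*} (s : Finset ι) {T : ι → Module.End K (FM K F L)} {w : Fin F → ℤ}
    (hT : ∀ i ∈ s, Shifts (T i) w) : Shifts (∑ i ∈ s, T i) w := fun l => by
  rw [Finset.sum_mul, Finset.mul_sum]
  exact Finset.sum_congr rfl fun i hi => hT i hi l

theorem shifts_zF (p : Fin F) (r : Ix L) : Shifts (zF (K := K) p r) (Pi.single p 1) := fun l =>
  zF_prW wsl l p r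

theorem shifts_dF (p : Fin F) (r : Ix L) : Shifts (dF (K := K) p r) (-Pi.single p 1) := fun l => by
  rw [← sub_eq_add_neg]; exact dF_prW wsl l p r

theorem shifts_gU (P Q : Fin F) :
    Shifts (gU K (L := L) tz P Q) (Pi.single P 1 - Pi.single Q 1) :=
  Shifts.sum _ fun r _ => by
    rw [sub_eq_add_neg]; exact (shifts_zF P r).mul (shifts_dF Q r)

theorem shifts_bg (P Q : Fin F) :
    Shifts (bg K L P Q) (-(Pi.single P 1 + Pi.single Q 1)) :=
  Shifts.sum _ fun r _ => by
    rw [neg_add]; exact (shifts_dF P r).mul (shifts_dF Q (nIx r))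

theorem shifts_om (P Q : Fin F) :
    Shifts (om K L tz P Q) (Pi.single P 1 + Pi.single Q 1) :=
  Shifts.sum _ fun r _ => ((shifts_zF P r).mul (shifts_zF Q (nIx r))).smul _

/-- The number operator of a slot acts by the slot degree. -/
theorem gU_self_prS (P : Fin F) (l : Fin F → ℤ) :
    gU K tz P P * prS K L l = ((l P : ℤ) : K) • prS K L l := by
  classical
  refine FM_hom_ext fun b => ?_
  rw [Module.End.mul_apply, LinearMap.smul_apply, prS, prW_bF]
  split_ifs with h
  · have h1 : gU K tz P P (bF K b) = ((∑ r : Ix L, ex b P r : ℕ) : K) • bF K b := by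
      unfold gU
      rw [LinearMap.sum_apply, Nat.cast_sum, Finset.sum_smul]
      exact Finset.sum_congr rfl fun r _ => zF_dF_bF P r b
    rw [h1, ← h]
    congr 1
    have : wtG wsl b P = ∑ r : Ix L, (ex b P r : ℤ) := by
      simp [wtG, wsl, Finset.sum_apply, Pi.single_apply, ← Finset.sum_add_distrib, ← ite_add_zero]
    rw [this]; push_cast; rfl
  · simp
end Slots

section Functor
variable {K : Type} [Field K] {m n : ℕ}

variable (K n) in
/-- The images of the generators. -/
noncomputable def genOp : DGen m → Module.End K (FM K m n)
  | .idem l => prS K n l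
  | .ge i l => (if h : 1 ≤ i ∧ i + 1 ≤ m then gU K tz ⟨i - 1, by omega⟩
      ⟨i, by omega⟩ else 0) * prS K n l
  | .gf i l => (if h : 1 ≤ i ∧ i + 1 ≤ m then gU K tz ⟨i, by omega⟩
      ⟨i - 1, by omega⟩ else 0) * prS K n l
  | .gb11 l => (if h : 0 < m then (2⁻¹ : K) • bg K n ⟨0, h⟩ ⟨0, h⟩ else 0) * prS K n l
  | .gb i l => (if h : 1 ≤ i ∧ i + 1 ≤ m then bg K n ⟨i - 1, by omega⟩
      ⟨i, by omega⟩ else 0) * prS K n l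
  | .gc i l => (if h : 1 ≤ i ∧ i + 1 ≤ m then om K n tz ⟨i - 1, by omega⟩
      ⟨i, by omega⟩ else 0) * prS K n l

variable (K m n) in
/-- The homomorphism from the free algebra on the generators. -/
noncomputable def phiF : FreeAlgebra K (DGen m) →ₐ[K] Module.End K (FM K m n) :=
  FreeAlgebra.lift K (genOp K n)

theorem phiF_ι (g : DGen m) : phiF K m n (FreeAlgebra.ι K g) = genOp K n g :=
  FreeAlgebra.lift_ι_apply _ _

/-- The weighted operator `x` acts through `X`. -/
def ActsBy (x : WOp K m) (X : Module.End K (FM K m n)) : Prop :=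
  (∀ l, phiF K m n (x.op l) = X * prS K n l) ∧ Shifts X x.wt

theorem prS_prS (l : Fin m → ℤ) : prS K n l * prS K n l = prS K n l := prW_mul_self _ _

theorem prS_prS_of_ne {l l' : Fin m → ℤ} (h : l ≠ l') : prS K n l * prS K n l' = 0 :=
  prW_mul_of_ne _ h

theorem ActsBy.comp {x y : WOp K m} {X Y : Module.End K (FM K m n)} (hx : ActsBy x X)
    (hy : ActsBy y Y) :
    ActsBy (x.comp y) (X * Y) := by
  refine ⟨fun l => ?_, hx.2.mul hy.2⟩
  change phiF K m n (x.op (l + y.wt) * y.op l) = _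
  rw [map_mul, hx.1, hy.1, mul_assoc, ← mul_assoc (prS K n _) Y, ← hy.2 l, mul_assoc Y, prS_prS,
    mul_assoc]

theorem ActsBy.cmm {x y : WOp K m} {X Y : Module.End K (FM K m n)} (hx : ActsBy x X)
    (hy : ActsBy y Y) :
    ActsBy (x.cmm y) (X * Y - Y * X) := by
  refine ⟨fun l => ?_, (hx.2.mul hy.2).sub ?_⟩
  · change phiF K m n ((x.comp y).op l - (y.comp x).op l) = _
    rw [map_sub, (hx.comp hy).1, (hy.comp hx).1, sub_mul]
  · exact add_comm y.wt x.wt ▸ hy.2.mul hx.2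

theorem ActsBy.acm {x y : WOp K m} {X Y : Module.End K (FM K m n)} (hx : ActsBy x X)
    (hy : ActsBy y Y) :
    ActsBy (x.acm y) (X * Y + Y * X) := by
  refine ⟨fun l => ?_, (hx.2.mul hy.2).add ?_⟩
  · change phiF K m n ((x.comp y).op l + (y.comp x).op l) = _
    rw [map_add, (hx.comp hy).1, (hy.comp hx).1, add_mul]
  · exact add_comm y.wt x.wt ▸ hy.2.mul hx.2

theorem epsw_eq {i : ℕ} (h : i < m) : epsw m (i + 1) = Pi.single ⟨i, h⟩ 1 := by
  ext t
  simp [epsw, Pi.single_apply, Fin.ext_iff]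

theorem epsw_eq' {i : ℕ} (h1 : 1 ≤ i) (h : i - 1 < m) : epsw m i = Pi.single ⟨i - 1, h⟩ 1 := by
  obtain ⟨j, rfl⟩ := Nat.exists_eq_add_of_le' h1
  exact epsw_eq h

theorem rep_E {i : ℕ} (h : 1 ≤ i ∧ i + 1 ≤ m) :
    ActsBy (wE K m i) (gU K (L := n) tz ⟨i - 1, by omega⟩ ⟨i, by omega⟩) := by
  refine ⟨fun l => (phiF_ι _).trans (by rw [genOp, dif_pos h]), ?_⟩
  change Shifts _ (epsw m i - epsw m (i + 1))
  rw [epsw_eq' h.1 (by omega), epsw_eq (by omega)]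
  exact shifts_gU _ _

theorem rep_F {i : ℕ} (h : 1 ≤ i ∧ i + 1 ≤ m) :
    ActsBy (wF K m i) (gU K (L := n) tz ⟨i, by omega⟩ ⟨i - 1, by omega⟩) := by
  refine ⟨fun l => (phiF_ι _).trans (by rw [genOp, dif_pos h]), ?_⟩
  change Shifts _ (-(epsw m i - epsw m (i + 1)))
  rw [epsw_eq' h.1 (by omega), epsw_eq (by omega), neg_sub]
  exact shifts_gU _ _

theorem rep_B {i : ℕ} (h : 1 ≤ i ∧ i + 1 ≤ m) :
    ActsBy (wBt K m i) (bg K n ⟨i - 1, by omega⟩ ⟨i, by omega⟩) := by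
  refine ⟨fun l => (phiF_ι _).trans (by rw [genOp, dif_pos h]), ?_⟩
  change Shifts _ (-(epsw m i + epsw m (i + 1)))
  rw [epsw_eq' h.1 (by omega), epsw_eq (by omega)]
  exact shifts_bg _ _

theorem rep_C {i : ℕ} (h : 1 ≤ i ∧ i + 1 ≤ m) :
    ActsBy (wCt K m i) (om K n tz ⟨i - 1, by omega⟩ ⟨i, by omega⟩) := by
  refine ⟨fun l => (phiF_ι _).trans (by rw [genOp, dif_pos h]), ?_⟩
  change Shifts _ (epsw m i + epsw m (i + 1))
  rw [epsw_eq' h.1 (by omega), epsw_eq (by omega)]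
  exact shifts_om _ _

theorem rep_B11 : ActsBy (wB11t K m)
    (if h : 0 < m then (2⁻¹ : K) • bg K n ⟨0, h⟩ ⟨0, h⟩ else 0) := by
  refine ⟨fun l => (phiF_ι _).trans (by rw [genOp]), ?_⟩
  split_ifs with h
  · change Shifts _ (-((2 : ℤ) • epsw m 1))
    rw [epsw_eq h, two_smul]
    exact (shifts_bg _ _).smul _
  · exact Shifts.zero _

end Functor

section Relations
variable {K : Type} [Field K] {m n : ℕ}

theorem gU_cmm (P Q R S : Fin m) :
    gU K (L := n) tz P Q * gU K tz R S - gU K tz R S * gU K tz P Q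
      = (if Q = R then gU K tz P S else 0) - if P = S then gU K tz R Q else 0 := by
  rw [gU_gU]; abel

theorem bg_gU_cmm (R S P Q : Fin m) :
    bg K n R S * gU K tz P Q - gU K tz P Q * bg K n R S
      = (if P = R then bg K n Q S else 0) + if P = S then bg K n R Q else 0 := by
  rw [gU_bg]; abel

theorem gU_om_cmm (P Q R S : Fin m) :
    gU K tz P Q * om K n tz R S - om K n tz R S * gU K tz P Q
      = (if Q = R then om K n tz P S else 0) + if Q = S then om K n tz R P else 0 := by
  rw [gU_om]; simp [tz]

theorem om_gU_cmm (P Q R S : Fin m) :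
    om K n tz R S * gU K tz P Q - gU K tz P Q * om K n tz R S
      = -((if Q = R then om K n tz P S else 0) + if Q = S then om K n tz R P else 0) := by
  rw [← gU_om_cmm]; abel

theorem bg_acm (P Q R S : Fin m) :
    bg K n P Q * bg K n R S + bg K n R S * bg K n P Q = 0 := by rw [bg_bg]; abel

theorem om_acm (P Q R S : Fin m) :
    om K n tz P Q * om K n tz R S + om K n tz R S * om K n tz P Q = 0 := by rw [om_om]; abel

theorem bg_om_acm (P Q R S : Fin m) :
    bg K n P Q * om K n tz R S + om K n tz R S * bg K n P Q
      = (if Q = S then gU K tz R P else 0) + (if P = S then gU K tz R Q else 0)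
        - (if Q = R then gU K tz S P else 0) - (if P = R then gU K tz S Q else 0) := by
  rw [bg_om]; abel

theorem neg_cmm (X Y : Module.End K (FM K m n)) : -X * Y - Y * -X = Y * X - X * Y := by
  rw [neg_mul, mul_neg]; abel

theorem om_swap (P Q : Fin m) : om K n tz Q P = -om K n tz P Q := by
  rw [om_symm]; simp [tz]

theorem om_self [CharZero K] (P : Fin m) : om K n tz P P = 0 := by
  have h := om_swap (K := K) (n := n) P P
  have h2 : (2 : K) • om K n tz P P = 0 := by
    rw [two_smul]; nth_rewrite 1 [h]; abel
  exact (smul_eq_zero.1 h2).resolve_left two_ne_zero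

/-- A cubic relation follows from the corresponding operator identity. -/
theorem ActsBy.eq_zero {x : WOp K m} {X : Module.End K (FM K m n)} (hx : ActsBy x X) (h : X = 0)
    (l : Fin m → ℤ) : phiF K m n (x.op l) = 0 := by rw [hx.1, h, zero_mul]

theorem ActsBy.congr {x y : WOp K m} {X Y : Module.End K (FM K m n)} (hx : ActsBy x X)
    (hy : ActsBy y Y) (h : X = Y) (l : Fin m → ℤ) :
    phiF K m n (x.op l) = phiF K m n (y.op l) := by rw [hx.1, hy.1, h]

theorem ActsBy.mul_idem {x : WOp K m} {X : Module.End K (FM K m n)} (hx : ActsBy x X)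
    (l l' : Fin m → ℤ) :
    phiF K m n (x.op l * iId K m l') = phiF K m n (if l' = l then x.op l else 0) := by
  rw [map_mul, hx.1, iId, phiF_ι, genOp]
  split_ifs with h
  · rw [h, mul_assoc, prS_prS, hx.1]
  · rw [mul_assoc, prS_prS_of_ne (Ne.symm h), mul_zero, map_zero]

theorem ActsBy.idem_mul {x : WOp K m} {X : Module.End K (FM K m n)} (hx : ActsBy x X)
    (l l' : Fin m → ℤ) :
    phiF K m n (iId K m l' * x.op l) = phiF K m n (if l' = l + x.wt then x.op l else 0) := by
  rw [map_mul, hx.1, iId, phiF_ι, genOp, hx.2]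
  split_ifs with h
  · rw [h, ← mul_assoc, prS_prS, hx.1, hx.2]
  · rw [← mul_assoc, prS_prS_of_ne h, zero_mul, map_zero]

theorem actsBy_E_kill {i : ℕ} (h : ¬ okEd m i) : ActsBy (n := n) (wE K m i) 0 :=
  ⟨fun l => (phiF_ι _).trans (by rw [genOp, dif_neg (by unfold okEd at h; exact h)]), Shifts.zero _⟩

theorem actsBy_F_kill {i : ℕ} (h : ¬ okEd m i) : ActsBy (n := n) (wF K m i) 0 :=
  ⟨fun l => (phiF_ι _).trans (by rw [genOp, dif_neg (by unfold okEd at h; exact h)]), Shifts.zero _⟩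

theorem actsBy_B_kill {i : ℕ} (h : ¬ okEd m i) : ActsBy (n := n) (wBt K m i) 0 :=
  ⟨fun l => (phiF_ι _).trans (by rw [genOp, dif_neg (by unfold okEd at h; exact h)]), Shifts.zero _⟩

theorem actsBy_C_kill {i : ℕ} (h : ¬ okEd m i) : ActsBy (n := n) (wCt K m i) 0 :=
  ⟨fun l => (phiF_ι _).trans (by rw [genOp, dif_neg (by unfold okEd at h; exact h)]), Shifts.zero _⟩

theorem exists_actsBy_E (i : ℕ) : ∃ X, ActsBy (n := n) (wE K m i) X :=
  (em (okEd m i)).elim (fun h => ⟨_, rep_E h⟩) fun h => ⟨_, actsBy_E_kill h⟩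

theorem exists_actsBy_F (i : ℕ) : ∃ X, ActsBy (n := n) (wF K m i) X :=
  (em (okEd m i)).elim (fun h => ⟨_, rep_F h⟩) fun h => ⟨_, actsBy_F_kill h⟩

theorem exists_actsBy_B (i : ℕ) : ∃ X, ActsBy (n := n) (wBt K m i) X :=
  (em (okEd m i)).elim (fun h => ⟨_, rep_B h⟩) fun h => ⟨_, actsBy_B_kill h⟩

theorem exists_actsBy_C (i : ℕ) : ∃ X, ActsBy (n := n) (wCt K m i) X :=
  (em (okEd m i)).elim (fun h => ⟨_, rep_C h⟩) fun h => ⟨_, actsBy_C_kill h⟩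

theorem gU_diff_prS (l : Fin m → ℤ) {i : ℕ} (h : 1 ≤ i ∧ i + 1 ≤ m) :
    (gU K tz ⟨i - 1, by omega⟩ ⟨i - 1, by omega⟩ - gU K tz ⟨i, by omega⟩ ⟨i, by omega⟩) * prS K n l
      = ((alpair m l i : ℤ) : K) • prS K n l := by
  rw [sub_mul, gU_self_prS, gU_self_prS, ← sub_smul]
  congr 1
  simp only [alpair, cf]
  rw [dif_pos ⟨h.1, by omega⟩, dif_pos ⟨by omega, h.2⟩]
  push_cast
  rfl

variable [CharZero K]

theorem phiF_rel (x y : FreeAlgebra K (DGen m)) (h : DRelT K m x y) :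
    phiF K m n x = phiF K m n y := by
  cases h with
  | idem2 l l' =>
    rw [map_mul, iId, iId, phiF_ι, phiF_ι, genOp, genOp]
    split_ifs with h
    · rw [h, prS_prS, phiF_ι, genOp]
    · rw [prS_prS_of_ne h, map_zero]
  | srcE i l l' =>
    obtain ⟨X, hX⟩ := exists_actsBy_E (K := K) (m := m) (n := n) i
    exact hX.mul_idem l l'
  | tgtE i l l' =>
    obtain ⟨X, hX⟩ := exists_actsBy_E (K := K) (m := m) (n := n) i
    exact hX.idem_mul l l'
  | srcF i l l' =>
    obtain ⟨X, hX⟩ := exists_actsBy_F (K := K) (m := m) (n := n) i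
    exact hX.mul_idem l l'
  | tgtF i l l' =>
    obtain ⟨X, hX⟩ := exists_actsBy_F (K := K) (m := m) (n := n) i
    exact hX.idem_mul l l'
  | srcB i l l' =>
    obtain ⟨X, hX⟩ := exists_actsBy_B (K := K) (m := m) (n := n) i
    exact hX.mul_idem l l'
  | tgtB i l l' =>
    obtain ⟨X, hX⟩ := exists_actsBy_B (K := K) (m := m) (n := n) i
    exact hX.idem_mul l l'
  | srcC i l l' =>
    obtain ⟨X, hX⟩ := exists_actsBy_C (K := K) (m := m) (n := n) i
    exact hX.mul_idem l l'
  | tgtC i l l' =>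
    obtain ⟨X, hX⟩ := exists_actsBy_C (K := K) (m := m) (n := n) i
    exact hX.idem_mul l l'
  | srcB11 l l' => exact rep_B11.mul_idem l l'
  | tgtB11 l l' => exact rep_B11.idem_mul l l'
  | killE i l h => rw [(actsBy_E_kill h).1, zero_mul, map_zero]
  | killF i l h => rw [(actsBy_F_kill h).1, zero_mul, map_zero]
  | killB i l h => rw [(actsBy_B_kill h).1, zero_mul, map_zero]
  | killC i l h => rw [(actsBy_C_kill h).1, zero_mul, map_zero]
  | u1 i j l hi hj =>
    unfold okEd at hi hj
    rw [((rep_E hi).cmm (rep_F hj)).1]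
    simp only [gU_cmm, Fin.mk.injEq]
    by_cases h : i = j
    · subst h
      simp only [if_true, map_smul, iId, phiF_ι, genOp]
      exact gU_diff_prS l hi
    · rw [if_neg h, if_neg h, if_neg (by omega), sub_zero, zero_mul, map_zero]
  | u2a i j l hi hj h =>
    unfold okEd at hi hj
    rw [map_zero]
    refine ((rep_E hi).cmm (rep_E hj)).eq_zero ?_ l
    simp only [gU_cmm, Fin.mk.injEq]
    rw [if_neg (by omega), if_neg (by omega), sub_zero]
  | u2b i j l hi hj h =>
    unfold okEd at hi hj
    rw [map_zero]
    refine ((rep_E hi).cmm ((rep_E hi).cmm (rep_E hj))).eq_zero ?_ l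
    simp only [gU_cmm, Fin.mk.injEq]
    split_ifs <;> first | omega | simp only [sub_zero, zero_sub, mul_neg, neg_mul, sub_neg_eq_add,
        neg_add_eq_sub, gU_cmm, Fin.mk.injEq]
    all_goals split_ifs <;> first | omega | simp
  | u3a i j l hi hj h =>
    unfold okEd at hi hj
    rw [map_zero]
    refine ((rep_F hi).cmm (rep_F hj)).eq_zero ?_ l
    simp only [gU_cmm, Fin.mk.injEq]
    rw [if_neg (by omega), if_neg (by omega), sub_zero]
  | u3b i j l hi hj h =>
    unfold okEd at hi hj
    rw [map_zero]
    refine ((rep_F hi).cmm ((rep_F hi).cmm (rep_F hj))).eq_zero ?_ l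
    simp only [gU_cmm, Fin.mk.injEq]
    split_ifs <;> first | omega | simp only [sub_zero, zero_sub, mul_neg, neg_mul, sub_neg_eq_add,
        neg_add_eq_sub, gU_cmm, Fin.mk.injEq]
    all_goals split_ifs <;> first | omega | simp
  | u4b i j l hi hj =>
    rw [map_zero]
    exact ((rep_B hi).acm (rep_B hj)).eq_zero (bg_acm _ _ _ _) l
  | u4c i j l hi hj =>
    rw [map_zero]
    exact ((rep_C hi).acm (rep_C hj)).eq_zero (om_acm _ _ _ _) l
  | u5i i l hi =>
    unfold okEd at hi
    rw [((rep_B hi).acm (rep_C hi)).1]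
    simp only [bg_om_acm, Fin.mk.injEq]
    rw [if_pos trivial, if_neg (by omega), if_neg (by omega), if_pos trivial]
    simp only [map_smul, iId, phiF_ι, genOp, add_zero, sub_zero]
    exact gU_diff_prS l hi
  | u5m i l hi hi1 =>
    unfold okEd at hi hi1
    refine ((rep_B hi1).acm (rep_C hi)).congr ((rep_E hi).cmm (rep_E hi1)) ?_ l
    simp only [bg_om_acm, gU_cmm, Fin.mk.injEq, Nat.add_sub_cancel]
    split_ifs <;> first | omega | simp
  | u5p i l hi hi1 =>
    unfold okEd at hi hi1
    refine ((rep_B hi).acm (rep_C hi1)).congr ((rep_F hi).cmm (rep_F hi1)) ?_ l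
    simp only [bg_om_acm, gU_cmm, Fin.mk.injEq, Nat.add_sub_cancel]
    split_ifs <;> first | omega | simp
  | u5z i j l hi hj h =>
    unfold okEd at hi hj
    rw [map_zero]
    refine ((rep_B hi).acm (rep_C hj)).eq_zero ?_ l
    simp only [bg_om_acm, Fin.mk.injEq]
    split_ifs <;> first | omega | simp
  | u6e i j l hi hj h =>
    unfold okEd at hi hj
    rw [map_zero]
    refine ((rep_B hi).cmm (rep_E hj)).eq_zero ?_ l
    simp only [bg_gU_cmm, Fin.mk.injEq]
    split_ifs <;> first | omega | simp
  | u6f i j l hi hj h =>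
    unfold okEd at hi hj
    rw [map_zero]
    refine ((rep_B hi).cmm (rep_F hj)).eq_zero ?_ l
    simp only [bg_gU_cmm, Fin.mk.injEq]
    split_ifs <;> first | omega | simp
  | u6c1 i l hi hi1 =>
    unfold okEd at hi hi1
    refine ((rep_B hi).cmm (rep_E hi)).congr ((rep_B hi1).cmm (rep_F hi1)) ?_ l
    simp only [bg_gU_cmm, Fin.mk.injEq, Nat.add_sub_cancel]
    split_ifs <;> first | omega | simp
  | u6c2 i l hi hi1 =>
    unfold okEd at hi hi1
    refine ((rep_B hi).cmm (rep_E hi1)).congr ((rep_B hi1).cmm (rep_F hi)) ?_ l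
    simp only [bg_gU_cmm, Fin.mk.injEq, Nat.add_sub_cancel]
    split_ifs <;> first | omega | simp
  | u7e i j l hi hj h =>
    unfold okEd at hi hj
    rw [map_zero]
    refine ((rep_E hj).cmm (rep_C hi)).eq_zero ?_ l
    simp only [gU_om_cmm, Fin.mk.injEq]
    split_ifs with h1 h2 h2 <;> first | omega | skip
    · obtain rfl : j = i := by omega
      rw [om_self, zero_add]
    · rw [zero_add]
  | u7f i j l hi hj h =>
    unfold okEd at hi hj
    rw [map_zero]
    refine ((rep_F hj).cmm (rep_C hi)).eq_zero ?_ l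
    simp only [gU_om_cmm, Fin.mk.injEq]
    split_ifs with h1 h2 h2 <;> first | omega | skip
    · obtain rfl : j = i := by omega
      rw [om_self, add_zero]
    · rw [zero_add]
  | u7x i l hi hi1 =>
    unfold okEd at hi hi1
    refine ((rep_E hi).cmm (rep_C hi1)).congr ((rep_F hi1).cmm (rep_C hi)) ?_ l
    simp only [gU_om_cmm, Fin.mk.injEq, Nat.add_sub_cancel]
    split_ifs <;> first | omega | simp
  | u8a i l hi hi1 =>
    unfold okEd at hi hi1
    rw [(((rep_B hi).cmm (rep_E hi)).cmm (rep_E hi1)).1, map_smul]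
    refine Eq.trans ?_ (congrArg _ ((rep_B hi1).1 l)).symm
    rw [← smul_mul_assoc]
    simp only [bg_gU_cmm, Fin.mk.injEq, Nat.add_sub_cancel]
    congr 1
    rw [if_pos trivial, if_neg (by omega), add_zero]
    simp only [bg_gU_cmm, if_true]
    rw [bg_symm, two_smul]
  | u8z i j l hi hj h =>
    unfold okEd at hi hj
    rw [map_zero]
    refine (((rep_B hi).cmm (rep_E hi)).cmm (rep_E hj)).eq_zero ?_ l
    simp only [bg_gU_cmm, Fin.mk.injEq]
    rw [if_pos trivial, if_neg (by omega), add_zero]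
    simp only [bg_gU_cmm, Fin.mk.injEq]
    rw [if_neg (by omega), if_neg (by omega), add_zero]
  | u8e l h1 =>
    unfold okEd at h1
    rw [(((rep_B h1).cmm (rep_E h1)).cmm (rep_F h1)).1, map_smul]
    refine Eq.trans ?_ (congrArg _ ((rep_B h1).1 l)).symm
    rw [← smul_mul_assoc]
    simp only [bg_gU_cmm, Fin.mk.injEq, Nat.sub_self]
    congr 1
    simp only [if_true, zero_ne_one, if_false, add_zero, bg_gU_cmm]
    rw [bg_symm, two_smul]
  | u8bf j l h1 hj =>
    unfold okEd at h1 hj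
    rw [map_zero]
    refine (((rep_B h1).cmm (rep_F h1)).cmm (rep_F hj)).eq_zero ?_ l
    simp only [bg_gU_cmm, Fin.mk.injEq, Nat.sub_self]
    simp only [if_true, one_ne_zero, if_false, zero_add, bg_gU_cmm, Fin.mk.injEq]
    split_ifs <;> first | omega | simp
  | u9a i l hi hi1 =>
    unfold okEd at hi hi1
    rw [(((rep_C hi1).cmm (rep_E hi)).cmm (rep_E hi1)).1]
    refine Eq.trans ?_ ((rep_C hi).1 l).symm
    congr 1
    simp only [om_gU_cmm, Fin.mk.injEq, Nat.add_sub_cancel]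
    rw [if_pos trivial, if_neg (by omega), add_zero, neg_cmm, gU_om_cmm, if_neg (by simp; omega),
        if_pos rfl,
      zero_add]
  | u9z i j l hi hi1 hj h =>
    unfold okEd at hi hi1 hj
    rw [map_zero]
    refine (((rep_C hi1).cmm (rep_E hi)).cmm (rep_E hj)).eq_zero ?_ l
    simp only [om_gU_cmm, Fin.mk.injEq, Nat.add_sub_cancel]
    rw [if_pos trivial, if_neg (by omega), add_zero, neg_cmm, gU_om_cmm]
    simp only [Fin.mk.injEq]
    rw [if_neg (by omega), if_neg (by omega), add_zero]
  | u10 l h1 =>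
    unfold okEd at h1
    rw [((rep_B h1).cmm (rep_F h1)).1, map_smul]
    refine Eq.trans (congrArg _ (rep_B11.1 l)) ?_
    rw [← smul_mul_assoc]
    congr 1
    rw [dif_pos (by omega), smul_smul, mul_inv_cancel₀ two_ne_zero, one_smul]
    simp only [bg_gU_cmm, Fin.mk.injEq, Nat.sub_self]
    simp
  | u11 l =>
    rw [map_zero]
    refine (rep_B11.comp rep_B11).eq_zero ?_ l
    split_ifs with h
    · have h2 := bg_acm (K := K) (n := n) (⟨0, h⟩ : Fin m) ⟨0, h⟩ ⟨0, h⟩ ⟨0, h⟩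
      rw [← two_smul K] at h2
      rw [smul_mul_smul_comm, (smul_eq_zero.1 h2).resolve_left two_ne_zero, smul_zero]
    · rw [zero_mul]
end Relations

section Parity
variable {K : Type} [Field K] {F L : ℕ}

/-- `f` is homogeneous of parity `b`. -/
def HasPar (b : Bool) (f : Module.End K (FM K F L)) : Prop :=
  f * PiO K F L = sg K b • (PiO K F L * f)

theorem HasPar.mul {b c : Bool} {f g : Module.End K (FM K F L)} (hf : HasPar b f) (hg : HasPar c g)
    :
    HasPar (xor b c) (f * g) := by
  unfold HasPar at *
  rw [mul_assoc, hg, mul_smul_comm, ← mul_assoc, hf, smul_mul_assoc, smul_smul, mul_assoc, sg_xor,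
    mul_comm]

theorem HasPar.smul {b : Bool} {f : Module.End K (FM K F L)} (c : K) (hf : HasPar b f) :
    HasPar b (c • f) := by
  unfold HasPar at *
  rw [smul_mul_assoc, hf, mul_smul_comm, smul_comm]

theorem HasPar.zero (b : Bool) : HasPar b (0 : Module.End K (FM K F L)) := by
  unfold HasPar
  rw [zero_mul, mul_zero, smul_zero]

theorem HasPar.sum {ι : Type*} (s : Finset ι) {b : Bool} {f : ι → Module.End K (FM K F L)}
    (hf : ∀ i ∈ s, HasPar b (f i)) : HasPar b (∑ i ∈ s, f i) := by
  unfold HasPar at *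
  rw [Finset.sum_mul, Finset.mul_sum, Finset.smul_sum]
  exact Finset.sum_congr rfl hf

theorem hasPar_zF (p : Fin F) (r : Ix L) : HasPar r.isRight (zF (K := K) p r) := zF_PiO p r

theorem hasPar_dF (p : Fin F) (r : Ix L) : HasPar r.isRight (dF (K := K) p r) := dF_PiO p r

theorem hasPar_gU (P Q : Fin F) : HasPar false (gU K (L := L) tz P Q) :=
  HasPar.sum _ fun r _ => by
    have := (hasPar_zF (K := K) P r).mul (hasPar_dF Q r)
    rwa [Bool.xor_self] at this

theorem hasPar_om (P Q : Fin F) : HasPar true (om K L tz P Q) :=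
  HasPar.sum _ fun r _ => by
    have := (hasPar_zF (K := K) P r).mul (hasPar_zF Q (nIx r))
    rw [nIx_isRight, Bool.xor_not_self] at this
    exact this.smul _

theorem hasPar_bg (P Q : Fin F) : HasPar true (bg K L P Q) :=
  HasPar.sum _ fun r _ => by
    have := (hasPar_dF (K := K) P r).mul (hasPar_dF Q (nIx r))
    rwa [nIx_isRight, Bool.xor_not_self] at this

theorem hasPar_prS (l : Fin F → ℤ) : HasPar false (prS K L l) := by
  unfold HasPar
  rw [sg_false, one_smul]
  rw [prS, prW, PiO, dgW_comm]

/-- Conjugation by the parity operator for `b = true`. -/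
noncomputable def twP (b : Bool) (f : Module.End K (FM K F L)) : Module.End K (FM K F L) :=
  if b then PiO K F L * f * PiO K F L else f

theorem HasPar.twP {b : Bool} {f : Module.End K (FM K F L)} (hf : HasPar b f) (c : Bool) :
    twP c f = sg K (b && c) • f := by
  unfold HasPar at hf
  cases c
  · simp [_root_.twP]
  · rw [_root_.twP, if_pos rfl, mul_assoc, hf, mul_smul_comm, ← mul_assoc, PiO_PiO, one_mul,
      Bool.and_true]

/-- `f` is a homomorphism for the action of the operators `pX`. -/
def PHom (f : Module.End K (FM K F L)) : Prop :=
  ∀ r s : Ix L, pX K tz r s * f = twP (xor r.isRight s.isRight) f * pX K tz r s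

theorem PHom.of_hasPar {b : Bool} {f : Module.End K (FM K F L)} (hf : HasPar b f)
    (h : ∀ r s, pX K tz r s * f = sg K (b && xor r.isRight s.isRight) • (f * pX K tz r s)) :
    PHom f := fun r s => by rw [h, hf.twP, smul_mul_assoc]

theorem shifts_pX (r s : Ix L) : Shifts (pX K (F := F) tz r s) 0 := by
  refine (Shifts.sum _ fun P _ => ?_).add ((Shifts.sum _ fun P _ => ?_).smul _)
  all_goals
    rw [← add_neg_cancel (Pi.single P (1 : ℤ))]
    exact ((shifts_zF P _).mul (shifts_dF P _)).smul _

theorem pX_prS (r s : Ix L) (l : Fin F → ℤ) :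
    pX K (F := F) tz r s * prS K L l = prS K L l * pX K tz r s := by
  rw [shifts_pX, add_zero]

theorem PHom.mul_prS {b : Bool} {f : Module.End K (FM K F L)} (hf : HasPar b f)
    (h : ∀ r s, pX K tz r s * f = sg K (b && xor r.isRight s.isRight) • (f * pX K tz r s))
    (l : Fin F → ℤ) : PHom (f * prS K L l) :=
  PHom.of_hasPar (b := b) (by simpa using hf.mul (hasPar_prS l)) fun r s => by
    rw [← mul_assoc, h, smul_mul_assoc, mul_assoc, pX_prS, mul_assoc]

theorem prS_eq_projP (l : Fin F → ℤ) : (prS K L l : Module.End K (SM K F L)) = projP K F L l := by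
  refine end_ext fun b => ?_
  refine (prW_bF (K := K) wsl l b).trans ?_
  refine Eq.trans ?_ (opOf_bvec _ _).symm
  have hp : wtG wsl b = prof b := by
    ext P
    simp only [wtG, wsl, Finset.sum_apply, Pi.smul_apply, Pi.single_apply, prof]
    rw [Finset.sum_eq_single P (by intro q _ hq; simp [hq.symm]) (by simp)]
    rw [Fintype.sum_sum_type]
    simp [ex, Finset.sum_boole]
  rw [hp]
  by_cases h : prof b = l
  · rw [if_pos h, if_pos h]; rfl
  · rw [if_neg h, if_neg h]; rfl

theorem opA_eq (i j : Fin L) :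
    (opA K F L i j : Module.End K (SM K F L)) = pX K (F := F) tz (Sum.inl i) (Sum.inl j) := by
  change ((∑ P, zF P (Sum.inl i) * dF P (Sum.inl j))
    - ∑ P, zF P (Sum.inr j) * dF P (Sum.inr i) : Module.End K (FM K F L)) = _
  simp [pX, gV, etaP, nIx, tz, Zt, Dt, fl, sub_eq_add_neg]

theorem opC_eq (i j : Fin L) :
    (opC K F L i j : Module.End K (SM K F L)) = pX K (F := F) tz (Sum.inr i) (Sum.inl j) := by
  change ((∑ P, zF P (Sum.inr i) * dF P (Sum.inl j))
    - ∑ P, zF P (Sum.inr j) * dF P (Sum.inl i) : Module.End K (FM K F L)) = _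
  simp [pX, gV, etaP, nIx, tz, Zt, Dt, fl, sub_eq_add_neg]

theorem opB_eq {i j : Fin L} (h : i ≠ j) :
    (opB K F L i j : Module.End K (SM K F L)) = pX K (F := F) tz (Sum.inl i) (Sum.inr j) := by
  rw [opB, if_neg h]
  change ((∑ P, zF P (Sum.inl i) * dF P (Sum.inr j))
    + ∑ P, zF P (Sum.inl j) * dF P (Sum.inr i) : Module.End K (FM K F L)) = _
  simp [pX, gV, etaP, nIx, tz, Zt, Dt, fl]

/-- The operator `opB` on the sealed Fock space. -/
noncomputable def opBF (i j : Fin L) : Module.End K (FM K F L) := opB K F L i j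

theorem opBF_self (i : Fin L) :
    (2 : K) • opBF (K := K) (F := F) i i = pX K tz (Sum.inl i) (Sum.inr i) := by
  have h : opBF (K := K) (F := F) i i = ∑ P, zF P (Sum.inl i) * dF P (Sum.inr i) := if_pos rfl
  rw [h, two_smul]
  simp [pX, gV, etaP, nIx, tz, Zt, Dt, fl]

theorem pX_nIx (r s : Ix L) :
    pX K (F := F) tz (nIx s) (nIx r) = etaP K r s • pX K tz r s := by
  have h : etaP K (nIx s) (nIx r) = etaP K r s := by
    simp [etaP, Bool.or_comm]
  rw [pX, pX, h, nIx_nIx, nIx_nIx, smul_add, smul_smul, etaP, sg_mul_self, one_smul, add_comm]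

theorem end_sub_eq_zero {f g : Module.End K (FM K F L)} : f - g = 0 ↔ f = g := sub_eq_zero

variable (K F L) in
/-- The projection `Pe` on the sealed Fock space. -/
noncomputable def PeF : Module.End K (FM K F L) := Pe K F L

variable (K F L) in
/-- The projection `Po` on the sealed Fock space. -/
noncomputable def PoF : Module.End K (FM K F L) := Po K F L

/-- The even part on the sealed Fock space. -/
noncomputable def evF (f : Module.End K (FM K F L)) : Module.End K (FM K F L) :=
  PeF K F L * f * PeF K F L + PoF K F L * f * PoF K F L

/-- The odd part on the sealed Fock space. -/
noncomputable def odF (f : Module.End K (FM K F L)) : Module.End K (FM K F L) :=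
  PeF K F L * f * PoF K F L + PoF K F L * f * PeF K F L

/-- The odd supercommutator on the sealed Fock space. -/
noncomputable def odCommF (g f : Module.End K (FM K F L)) : Module.End K (FM K F L) :=
  g * f - evF f * g + odF f * g

open Classical in
theorem PeF_bF (b : MonB F L) : PeF K F L (bF K b) = if evenMon b then bF K b else 0 := by
  refine (opOf_bvec _ _).trans ?_
  by_cases h : evenMon b
  · rw [if_pos h, if_pos h]; rfl
  · rw [if_neg h, if_neg h]; rfl

open Classical in
theorem PoF_bF (b : MonB F L) : PoF K F L (bF K b) = if evenMon b then 0 else bF K b := by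
  refine (opOf_bvec _ _).trans ?_
  by_cases h : evenMon b
  · rw [if_pos h, if_pos h]; rfl
  · rw [if_neg h, if_neg h]; rfl

theorem PeF_sub_PoF : PeF K F L - PoF K F L = PiO K F L := by
  refine FM_hom_ext fun b => ?_
  rw [LinearMap.sub_apply, PeF_bF, PoF_bF, PiO, dgW_bF]
  have hp : wtG wpar b = 0 ↔ evenMon b := by
    unfold wtG wpar evenMon
    have : ∑ p : Fin F, ∑ r : Ix L, ex b p r • (if r.isRight then (1 : ZMod 2) else 0)
        = ((Finset.univ.filter fun p : Fin F × Fin L => b.2 p = true).card : ZMod 2) := by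
      rw [Finset.card_filter, Fintype.sum_prod_type]
      simp [Fintype.sum_sum_type, ex]
    rw [this, ZMod.natCast_eq_zero_iff, Nat.dvd_iff_mod_eq_zero]
  by_cases h : evenMon b
  · rw [if_pos h, if_pos h, if_pos (hp.2 h), one_smul, sub_zero]
  · rw [if_neg h, if_neg h, if_neg (fun h' => h (hp.1 h')), neg_one_smul, zero_sub]

theorem PeF_add_PoF : PeF K F L + PoF K F L = 1 := by
  refine FM_hom_ext fun b => ?_
  rw [LinearMap.add_apply, PeF_bF, PoF_bF]
  split_ifs <;> simp

theorem evF_sub_odF (f : Module.End K (FM K F L)) :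
    evF f - odF f = PiO K F L * f * PiO K F L := by
  rw [← PeF_sub_PoF, evF, odF]
  noncomm_ring

theorem evF_add_odF (f : Module.End K (FM K F L)) : evF f + odF f = f := by
  have h : f = (PeF K F L + PoF K F L) * f * (PeF K F L + PoF K F L) := by
    rw [PeF_add_PoF, one_mul, mul_one]
  conv_rhs => rw [h]
  rw [evF, odF]
  noncomm_ring

theorem HasPar.isEvenOp [CharZero K] {f : Module.End K (FM K F L)} (hf : HasPar false f) :
    IsEvenOp K F L f := by
  have h1 := evF_sub_odF f
  have h3 := hf.twP true
  rw [_root_.twP, if_pos rfl, Bool.false_and, sg_false, one_smul] at h3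
  rw [h3] at h1
  nth_rewrite 3 [← evF_add_odF f] at h1
  change odF f = 0
  refine (smul_eq_zero.1 (?_ : (2 : K) • odF f = 0)).resolve_left two_ne_zero
  rw [two_smul]
  have h4 : -odF f = odF f := add_left_cancel ((sub_eq_add_neg _ _).symm.trans h1)
  nth_rewrite 1 [← h4]
  exact neg_add_cancel _

theorem HasPar.isOddOp [CharZero K] {f : Module.End K (FM K F L)} (hf : HasPar true f) :
    IsOddOp K F L f := by
  have h1 := evF_sub_odF f
  have h3 := hf.twP true
  rw [_root_.twP, if_pos rfl, Bool.true_and, sg_true, neg_one_smul] at h3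
  rw [h3] at h1
  nth_rewrite 3 [← evF_add_odF f] at h1
  change evF f = 0
  refine (smul_eq_zero.1 (?_ : (2 : K) • evF f = 0)).resolve_left two_ne_zero
  rw [two_smul]
  rw [neg_add, ← sub_eq_add_neg, sub_left_inj] at h1
  nth_rewrite 1 [h1]
  exact neg_add_cancel _

theorem odCommF_eq (g f : Module.End K (FM K F L)) :
    odCommF g f = g * f - twP true f * g := by
  rw [twP, if_pos rfl, ← evF_sub_odF, odCommF, sub_mul]; abel

theorem odComm_eq_zero (g f : Module.End K (FM K F L)) :
    odComm K F L g f = 0 ↔ g * f = twP true f * g := by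
  rw [← end_sub_eq_zero, ← odCommF_eq]; exact Iff.rfl

theorem isPnHom_of_PHom [CharZero K] {f : Module.End K (FM K F L)} (hf : PHom f) :
    IsPnHom K F L f := by
  refine ⟨fun i j => ?_, fun i j _ => ?_, fun i j _ => ?_⟩
  · rw [opA_eq]
    exact end_sub_eq_zero.2 (hf (Sum.inl i) (Sum.inl j))
  · refine (odComm_eq_zero _ f).2 ?_
    have h := hf (Sum.inl i) (Sum.inr j)
    by_cases hij : i = j
    · subst hij
      rw [← opBF_self, smul_mul_assoc, mul_smul_comm] at h
      exact smul_right_injective _ (two_ne_zero (α := K)) h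
    · rw [opB_eq hij]; exact h
  · refine (odComm_eq_zero _ f).2 ?_
    rw [opC_eq]
    exact hf (Sum.inr i) (Sum.inl j)

theorem PHom_of_isPnHom [CharZero K] {f : Module.End K (FM K F L)} (hf : IsPnHom K F L f) :
    PHom f := by
  obtain ⟨hA, hB, hC⟩ := hf
  have hA' : ∀ i j : Fin L, pX K tz (Sum.inl i) (Sum.inl j) * f
      = f * pX K tz (Sum.inl i) (Sum.inl j) := fun i j => by
    have := hA i j
    rw [opA_eq] at this
    exact end_sub_eq_zero.1 this
  have hn : ∀ r s : Ix L, pX K tz r s * f = twP (xor r.isRight s.isRight) f * pX K tz r s →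
      pX K tz (nIx s) (nIx r) * f
        = twP (xor (nIx s).isRight (nIx r).isRight) f * pX K tz (nIx s) (nIx r) := by
    intro r s h
    have e : xor (nIx s).isRight (nIx r).isRight = xor r.isRight s.isRight := by
      rw [nIx_isRight, nIx_isRight]; cases r.isRight <;> cases s.isRight <;> rfl
    rw [e, pX_nIx, smul_mul_assoc, h, mul_smul_comm]
  have hB' : ∀ i j : Fin L, i ≤ j → pX K tz (Sum.inl i) (Sum.inr j) * f
      = twP true f * pX K tz (Sum.inl i) (Sum.inr j) := fun i j hij => by
    have h := (odComm_eq_zero _ f).1 (hB i j hij)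
    by_cases hij' : i = j
    · subst hij'
      change opBF i i * f = twP true f * opBF i i at h
      rw [← opBF_self, smul_mul_assoc, h, mul_smul_comm]
    · rw [opB_eq hij'] at h; exact h
  have hC' : ∀ i j : Fin L, i < j → pX K tz (Sum.inr i) (Sum.inl j) * f
      = twP true f * pX K tz (Sum.inr i) (Sum.inl j) := fun i j hij => by
    have h := (odComm_eq_zero _ f).1 (hC i j hij)
    rw [opC_eq] at h; exact h
  rintro (i | i) (j | j)
  · exact hA' i j
  · rcases le_total i j with h | h
    · exact hB' i j h
    · exact hn (Sum.inl j) (Sum.inr i) (hB' j i h)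
  · rcases lt_trichotomy i j with h | h | h
    · exact hC' i j h
    · subst h
      have : pX K (F := F) tz (Sum.inr i) (Sum.inl i) = 0 := by
        simp [pX, etaP, nIx]
      rw [this, zero_mul, mul_zero]
    · exact hn (Sum.inr j) (Sum.inl i) (hC' j i h)
  · exact hn (Sum.inl j) (Sum.inl i) (hA' j i)

end Parity

section Psi
variable {K : Type} [Field K] {m n : ℕ}

theorem hasPar_smul_gen {b : Bool} (p : Prop) [Decidable p] (X : p → Module.End K (FM K m n))
    (hX : ∀ h, HasPar b (X h)) (l : Fin m → ℤ) :
    HasPar b ((if h : p then X h else 0) * prS K n l) := by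
  have h1 : HasPar b (if h : p then X h else 0) := by
    split_ifs with h
    · exact hX h
    · exact HasPar.zero b
  simpa using h1.mul (hasPar_prS l)

theorem PHom_gen {b : Bool} (p : Prop) [Decidable p] (X : p → Module.End K (FM K m n))
    (hX : ∀ h, HasPar b (X h))
    (hX' : ∀ h r s, pX K tz r s * X h = sg K (b && xor r.isRight s.isRight) • (X h * pX K tz r s))
    (l : Fin m → ℤ) : PHom ((if h : p then X h else 0) * prS K n l) := by
  split_ifs with h
  · exact PHom.mul_prS (hX h) (hX' h) l
  · exact PHom.mul_prS (HasPar.zero b) (fun r s => by rw [mul_zero, zero_mul, smul_zero]) l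

theorem pX_gU_tz (r s : Ix n) (P Q : Fin m) : pX K tz r s * gU K tz P Q
    = sg K (false && xor r.isRight s.isRight) • (gU K tz P Q * pX K tz r s) := by
  rw [pX_gU]; simp [tz]

theorem pX_om_tz (r s : Ix n) (P Q : Fin m) : pX K tz r s * om K n tz P Q
    = sg K (true && xor r.isRight s.isRight) • (om K n tz P Q * pX K tz r s) := by
  rw [pX_om]; simp [tz]

theorem pX_bg_tz (r s : Ix n) (P Q : Fin m) : pX K tz r s * bg K n P Q
    = sg K (true && xor r.isRight s.isRight) • (bg K n P Q * pX K tz r s) := by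
  rw [pX_bg, Bool.true_and]

theorem PHom_genOp (g : DGen m) : PHom (genOp K n g) := by
  cases g with
  | idem l =>
    refine PHom.of_hasPar (b := false) (hasPar_prS l) fun r s => ?_
    rw [Bool.false_and, sg_false, one_smul]
    exact pX_prS r s l
  | ge i l =>
    exact PHom_gen (b := false) _ _ (fun _ => hasPar_gU _ _) (fun _ r s => pX_gU_tz r s _ _) l
  | gf i l =>
    exact PHom_gen (b := false) _ _ (fun _ => hasPar_gU _ _) (fun _ r s => pX_gU_tz r s _ _) l
  | gb11 l =>
    exact PHom_gen (b := true) _ _ (fun _ => (hasPar_bg _ _).smul _)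
      (fun _ r s => by rw [mul_smul_comm, pX_bg_tz, smul_mul_assoc, smul_comm]) l
  | gb i l =>
    exact PHom_gen (b := true) _ _ (fun _ => hasPar_bg _ _) (fun _ r s => pX_bg_tz r s _ _) l
  | gc i l =>
    exact PHom_gen (b := true) _ _ (fun _ => hasPar_om _ _) (fun _ r s => pX_om_tz r s _ _) l

variable [CharZero K]

variable (K m n) in
/-- The representation of the idempotented enveloping algebra. -/
noncomputable def Psi : Udt K m →ₐ[K] Module.End K (FM K m n) :=
  RingQuot.liftAlgHom K ⟨phiF K m n, fun x y h => phiF_rel x y h⟩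

theorem Psi_mk (x : FreeAlgebra K (DGen m)) : Psi K m n (mkDt K m x) = phiF K m n x :=
  RingQuot.liftAlgHom_mkAlgHom_apply _ _ _ _

theorem Psi_gen (g : DGen m) : Psi K m n (mkDt K m (FreeAlgebra.ι K g)) = genOp K n g := by
  rw [Psi_mk, phiF_ι]

theorem PHom_Psi (g : DGen m) : PHom (Psi K m n (mkDt K m (FreeAlgebra.ι K g))) := by
  rw [Psi_gen]; exact PHom_genOp g

theorem hasPar_Psi {b : Bool} {g : DGen m} (h : HasPar b (genOp K n g)) :
    HasPar b (Psi K m n (mkDt K m (FreeAlgebra.ι K g))) := by rwa [Psi_gen]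

/-- The functor with all its properties, given its fullness. -/
theorem functor_of_full
    (hfull : ∀ (lam mu : Fin m → ℤ) (f : Module.End K (FM K m n)),
      prS K n mu * f = f → f * prS K n lam = f → PHom f →
        ∃ u : Udt K m, prS K n mu * Psi K m n u * prS K n lam = f) :
    ∃ Ψ : Udt K m →ₐ[K] Module.End K (SM K m n),
      (∀ l : Fin m → ℤ, Ψ (mkDt K m (iId K m l)) = projP K m n l) ∧
      (∀ g : DGen m, IsPnHom K m n (Ψ (mkDt K m (FreeAlgebra.ι K g)))) ∧
      (∀ i l, IsEvenOp K m n (Ψ (mkDt K m (FreeAlgebra.ι K (DGen.ge i l))))) ∧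
      (∀ i l, IsEvenOp K m n (Ψ (mkDt K m (FreeAlgebra.ι K (DGen.gf i l))))) ∧
      (∀ l, IsOddOp K m n (Ψ (mkDt K m (FreeAlgebra.ι K (DGen.gb11 l))))) ∧
      (∀ i l, IsOddOp K m n (Ψ (mkDt K m (FreeAlgebra.ι K (DGen.gb i l))))) ∧
      (∀ i l, IsOddOp K m n (Ψ (mkDt K m (FreeAlgebra.ι K (DGen.gc i l))))) ∧
      (∀ a : Fin m → ℕ, ∃ l : Fin m → ℤ, (∀ i, 0 ≤ l i) ∧
        LinearMap.range (Ψ (mkDt K m (iId K m l)))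
          = LinearMap.range (projP K m n fun i => (a i : ℤ))) ∧
      (∀ lam mu : Fin m → ℤ, (∀ i, 0 ≤ lam i) → (∀ i, 0 ≤ mu i) →
        ∀ f : Module.End K (SM K m n),
          projP K m n mu * f = f → f * projP K m n lam = f → IsPnHom K m n f →
          ∃ u : Udt K m,
            Ψ (mkDt K m (iId K m mu) * u * mkDt K m (iId K m lam)) = f) := by
  have hid : ∀ l : Fin m → ℤ, Psi K m n (mkDt K m (iId K m l)) = prS K n l := fun l =>
    Psi_gen (DGen.idem l)
  refine ⟨(Psi K m n : Udt K m →ₐ[K] Module.End K (FM K m n)), fun l => ?_, fun g => ?_,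
    fun i l => ?_, fun i l => ?_, fun l => ?_, fun i l => ?_, fun i l => ?_, fun a => ?_,
    fun lam mu _ _ f h1 h2 hf => ?_⟩
  · exact (hid l).trans (prS_eq_projP l)
  · exact isPnHom_of_PHom (PHom_Psi g)
  · exact HasPar.isEvenOp (hasPar_Psi (hasPar_smul_gen _ _ (fun _ => hasPar_gU _ _) l))
  · exact HasPar.isEvenOp (hasPar_Psi (hasPar_smul_gen _ _ (fun _ => hasPar_gU _ _) l))
  · exact HasPar.isOddOp
      (hasPar_Psi (hasPar_smul_gen _ _ (fun _ => (hasPar_bg _ _).smul _) l))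
  · exact HasPar.isOddOp (hasPar_Psi (hasPar_smul_gen _ _ (fun _ => hasPar_bg _ _) l))
  · exact HasPar.isOddOp (hasPar_Psi (hasPar_smul_gen _ _ (fun _ => hasPar_om _ _) l))
  · exact ⟨fun i => a i, fun i => Int.natCast_nonneg _,
      congrArg LinearMap.range ((hid _).trans (prS_eq_projP _))⟩
  · rw [← prS_eq_projP] at h1 h2
    obtain ⟨u, hu⟩ := hfull lam mu f h1 h2 (PHom_of_isPnHom hf)
    have key : Psi K m n (mkDt K m (iId K m mu) * u * mkDt K m (iId K m lam))
        = prS K n mu * Psi K m n u * prS K n lam := by rw [map_mul, map_mul, hid, hid]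
    exact ⟨u, key.trans hu⟩

end Psi

section Weights
variable {K : Type} [Field K] {F L : ℕ} {G : Type} [AddCommGroup G]

/-- `T` shifts the weight `w` by `v`. -/
def ShW (w : Fin F → Ix L → G) (T : Module.End K (FM K F L)) (v : G) : Prop :=
  ∀ g, T * prW K w g = prW K w (g + v) * T

variable {w : Fin F → Ix L → G}

theorem ShW.mul {T S : Module.End K (FM K F L)} {u v : G} (hT : ShW w T u) (hS : ShW w S v) :
    ShW w (T * S) (u + v) := fun g => by
  rw [mul_assoc, hS g, ← mul_assoc, hT, mul_assoc, add_assoc, add_comm v u]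

theorem ShW.add {T S : Module.End K (FM K F L)} {v : G} (hT : ShW w T v) (hS : ShW w S v) :
    ShW w (T + S) v := fun g => by rw [add_mul, hS g, hT g, mul_add]

theorem ShW.smul {T : Module.End K (FM K F L)} {v : G} (c : K) (hT : ShW w T v) :
    ShW w (c • T) v := fun g => by rw [smul_mul_assoc, hT g, mul_smul_comm]

theorem ShW.sum {ι : Type*} (s : Finset ι) {T : ι → Module.End K (FM K F L)} {v : G}
    (hT : ∀ i ∈ s, ShW w (T i) v) : ShW w (∑ i ∈ s, T i) v := fun g => by
  rw [Finset.sum_mul, Finset.mul_sum]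
  exact Finset.sum_congr rfl fun i hi => hT i hi g

theorem ShW.apply {T : Module.End K (FM K F L)} {v : G} (hT : ShW w T v) (g : G) (x : FM K F L) :
    prW K w g (T x) = T (prW K w (g - v) x) := by
  have := congrArg (fun S => S x) (hT (g - v))
  simp only [Module.End.mul_apply, sub_add_cancel] at this
  exact this.symm

theorem shW_zF (w : Fin F → Ix L → G) (p : Fin F) (r : Ix L) : ShW w (zF (K := K) p r) (w p r) :=
  fun g => zF_prW w g p r

theorem shW_dF (w : Fin F → Ix L → G) (p : Fin F) (r : Ix L) : ShW w (dF (K := K) p r) (-w p r) :=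
  fun g => by rw [← sub_eq_add_neg]; exact dF_prW w g p r

theorem shW_prW {G' : Type} [AddCommGroup G'] (w : Fin F → Ix L → G) (w' : Fin F → Ix L → G')
    (g' : G') : ShW w (prW K w' g') 0 := fun g => by
  unfold prW
  rw [add_zero, dgW_comm]

theorem prW_prW_self (g : G) (x : FM K F L) : prW K w g (prW K w g x) = prW K w g x := by
  rw [← Module.End.mul_apply, prW_mul_self]

theorem prW_prW_ne {g h : G} (hgh : g ≠ h) (x : FM K F L) : prW K w g (prW K w h x) = 0 := by
  rw [← Module.End.mul_apply, prW_mul_of_ne w hgh, LinearMap.zero_apply]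

theorem prW_eq_zero_iff {g : G} {x : FM K F L} :
    prW K w g x = 0 ↔ ∀ b, wtG w b = g → co b x = 0 := by
  classical
  constructor
  · intro h b hb
    have := co_prW (K := K) w g b x
    rw [h, map_zero, if_pos hb] at this
    exact this.symm
  · intro h
    refine FM_ext fun b => ?_
    rw [co_prW, map_zero]
    split_ifs with hb
    · exact h b hb
    · rfl

theorem eq_zero_of_prW (w : Fin F → Ix L → G) {x : FM K F L} (h : ∀ g, prW K w g x = 0) : x = 0 :=
  FM_ext fun b => by rw [map_zero]; exact prW_eq_zero_iff.1 (h (wtG w b)) b rfl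

theorem exists_co_ne {x : FM K F L} (h : x ≠ 0) : ∃ b, co b x ≠ 0 := by
  by_contra! hc
  exact h (FM_ext fun b => by rw [map_zero]; exact hc b)

theorem finite_support (x : FM K F L) : {b | co b x ≠ 0}.Finite := by
  refine (Finset.finite_toSet (Finsupp.support (x : SM K F L))).subset fun b hb => ?_
  exact Finset.mem_coe.2 (Finsupp.mem_support_iff.2 hb)

theorem finite_weights (w : Fin F → Ix L → G) (x : FM K F L) : {g | prW K w g x ≠ 0}.Finite := by
  refine ((finite_support x).image (wtG w)).subset fun g hg => ?_
  by_contra hc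
  refine hg (prW_eq_zero_iff.2 fun b hb => ?_)
  by_contra hb'
  exact hc ⟨b, hb', hb⟩

theorem exists_top (w : Fin F → Ix L → ℤ) {x : FM K F L} (hx : x ≠ 0) :
    ∃ g, prW K w g x ≠ 0 ∧ ∀ g', g < g' → prW K w g' x = 0 := by
  have hne : {g | prW K w g x ≠ 0}.Nonempty := by
    by_contra hc
    exact hx (eq_zero_of_prW w fun g => by
      by_contra h
      exact hc ⟨g, h⟩)
  obtain ⟨g, hg, hmax⟩ := (finite_weights w x).exists_maximal hne
  refine ⟨g, hg, fun g' hg' => ?_⟩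
  by_contra h
  exact absurd (hmax h hg'.le) (not_le.2 hg')

/-- The weights of `x` lie in `A`. -/
def WtIn (w : Fin F → Ix L → G) (A : Set G) (x : FM K F L) : Prop := ∀ g, prW K w g x ≠ 0 → g ∈ A

theorem WtIn.mono {A B : Set G} {x : FM K F L} (hx : WtIn w A x) (h : A ⊆ B) : WtIn w B x :=
  fun g hg => h (hx g hg)

theorem WtIn.shift {A : Set G} {x : FM K F L} {T : Module.End K (FM K F L)} {v : G}
    (hx : WtIn w A x) (hT : ShW w T v) : WtIn w {g | g - v ∈ A} (T x) := fun g h => by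
  refine hx _ fun h0 => h ?_
  rw [hT.apply, h0, map_zero]

theorem WtIn.prW_eq {g : G} {x : FM K F L} (h : WtIn w {g} x) : prW K w g x = x := by
  refine sub_eq_zero.1 (eq_zero_of_prW w fun g' => ?_)
  rw [map_sub]
  by_cases hg : g' = g
  · subst hg; rw [prW_prW_self, sub_self]
  · rw [prW_prW_ne hg, not_not.1 (mt (h g') hg), sub_zero]

theorem wtIn_of_co {A : Set G} {x : FM K F L} (h : ∀ b, co b x ≠ 0 → wtG w b ∈ A) :
    WtIn w A x := fun g hg => by
  by_contra hA
  refine hg (prW_eq_zero_iff.2 fun b hb => ?_)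
  by_contra hb'
  exact hA (hb ▸ h b hb')

theorem WtIn.co {A : Set G} {x : FM K F L} (h : WtIn w A x) {b : MonB F L} (hb : co b x ≠ 0) :
    wtG w b ∈ A := h _ fun h0 => hb (prW_eq_zero_iff.1 h0 b rfl)

theorem wtG_vac (w : Fin F → Ix L → G) :
    wtG w ((fun _ => 0, fun _ => false) : MonB F L) = 0 := by
  unfold wtG
  refine Finset.sum_eq_zero fun p _ => Finset.sum_eq_zero fun r _ => ?_
  rcases r with l | l <;> simp [ex]

theorem wtIn_vF (w : Fin F → Ix L → G) : WtIn w {0} (vF K F L) := by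
  refine wtIn_of_co fun b hb => ?_
  rw [vF_eq, co_bF] at hb
  have : (fun _ => 0, fun _ => false) = b := by
    by_contra h
    exact hb (if_neg h)
  rw [← this]
  exact wtG_vac w

theorem co_zF_dF (p : Fin F) (r : Ix L) (b : MonB F L) (x : FM K F L) :
    co b (zF p r (dF p r x)) = (ex b p r : K) * co b x := by
  have : co b ∘ₗ (zF p r * dF p r : Module.End K (FM K F L)) = (ex b p r : K) • co b := by
    refine FM_hom_ext fun c => ?_
    rw [LinearMap.comp_apply, Module.End.mul_apply, zF_dF_bF, map_smul, LinearMap.smul_apply, co_bF]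
    split_ifs with h
    · rw [h]
    · simp
  exact LinearMap.congr_fun this x

variable [CharZero K]

theorem ex_eq_zero_of_dF {p : Fin F} {r : Ix L} {x : FM K F L} (h : dF p r x = 0) {b : MonB F L}
    (hb : co b x ≠ 0) : ex b p r = 0 := by
  have := co_zF_dF p r b x
  rw [h, map_zero, map_zero] at this
  exact_mod_cast (mul_eq_zero.1 this.symm).resolve_right hb

theorem zF_inl_injective {p : Fin F} {l : Fin L} {x : FM K F L} (h : zF p (Sum.inl l) x = 0) :
    x = 0 := by
  have h1 := congrArg (fun T => T x) (dF_zF (K := K) p p (Sum.inl l : Ix L) (Sum.inl l))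
  simp only [Module.End.mul_apply, h, map_zero, Sum.isRight_inl, Bool.and_self, sg_false, one_smul,
    and_self, if_true, LinearMap.add_apply, Module.End.one_apply] at h1
  refine FM_ext fun b => ?_
  have h2 := congrArg (co b) h1
  rw [map_add, co_zF_dF, map_zero, ← add_one_mul] at h2
  rw [map_zero]
  refine (mul_eq_zero.1 h2.symm).resolve_left ?_
  exact Nat.cast_add_one_ne_zero _

end Weights

section Form
variable {F L : ℕ}

/-- The norm of a monomial. -/
def fac (b : MonB F L) : ℚ := ∏ q, ((b.1 q).factorial : ℚ)

theorem fac_pos (b : MonB F L) : 0 < fac b :=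
  Finset.prod_pos fun _ _ => Nat.cast_pos.2 (Nat.factorial_pos _)

theorem fac_update (f : Fin F × Fin L → ℕ) (ε : Fin F × Fin L → Bool) (q : Fin F × Fin L) :
    fac (Function.update f q (f q + 1), ε) = (f q + 1) * fac (f, ε) := by
  unfold fac
  rw [← Finset.mul_prod_erase _ _ (Finset.mem_univ q),
    ← Finset.mul_prod_erase Finset.univ (fun q => (((f, ε) : MonB F L).1 q).factorial.cast)
      (Finset.mem_univ q), ← mul_assoc]
  congr 1
  · simp [Nat.factorial_succ]
  · refine Finset.prod_congr rfl fun x hx => ?_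
    simp [Function.update_of_ne (Finset.ne_of_mem_erase hx)]

/-- The positive form on the rational Fock space. -/
noncomputable def ip (u : FM ℚ F L) : FM ℚ F L →ₗ[ℚ] ℚ :=
  (Finsupp.linearCombination ℚ fun b => fac b * co b u : (MonB F L →₀ ℚ) →ₗ[ℚ] ℚ)

theorem ip_bF (u : FM ℚ F L) (b : MonB F L) : ip u (bF ℚ b) = fac b * co b u := by
  refine (Finsupp.linearCombination_single ℚ (1:ℚ) b).trans ?_
  rw [one_smul]

theorem ip_bF_bF (b c : MonB F L) : ip (bF ℚ b) (bF ℚ c) = if b = c then fac b else 0 := by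
  rw [ip_bF, co_bF]
  split_ifs with h
  · rw [h, mul_one]
  · rw [mul_zero]

theorem ip_add (u v : FM ℚ F L) : ip (u + v) = ip u + ip v :=
  FM_hom_ext fun b => by
    rw [LinearMap.add_apply, ip_bF, ip_bF, ip_bF, map_add, mul_add]

theorem ip_smul (c : ℚ) (v : FM ℚ F L) : ip (c • v) = c • ip v :=
  FM_hom_ext fun b => by
    rw [LinearMap.smul_apply, ip_bF, ip_bF, map_smul, smul_eq_mul, smul_eq_mul]; ring

variable (F L) in
/-- The positive form as a bilinear map. -/
noncomputable def ipB : FM ℚ F L →ₗ[ℚ] FM ℚ F L →ₗ[ℚ] ℚ where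
  toFun := ip
  map_add' := ip_add
  map_smul' := ip_smul

theorem ip_adjoint {S T : Module.End ℚ (FM ℚ F L)}
    (h : ∀ b c, ip (S (bF ℚ b)) (bF ℚ c) = ip (bF ℚ b) (T (bF ℚ c))) (u v : FM ℚ F L) :
    ip (S u) v = ip u (T v) := by
  have : (ipB F L).comp S = (LinearMap.llcomp ℚ _ _ _ : _ →ₗ[ℚ] _ →ₗ[ℚ] _).flip T ∘ₗ ipB F L :=
    FM_hom_ext fun b => FM_hom_ext fun c => h b c
  exact LinearMap.congr_fun (LinearMap.congr_fun this u) v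

theorem ip_comm (u v : FM ℚ F L) : ip u v = ip v u := by
  have : ipB F L = (ipB F L).flip := FM_hom_ext fun b => FM_hom_ext fun c => by
    change ip (bF ℚ b) (bF ℚ c) = ip (bF ℚ c) (bF ℚ b)
    rw [ip_bF_bF, ip_bF_bF]
    by_cases h : b = c
    · rw [h]
    · rw [if_neg h, if_neg (Ne.symm h)]
  exact LinearMap.congr_fun (LinearMap.congr_fun this u) v

theorem ip_self (u : FM ℚ F L) (hu : u ≠ 0) : 0 < ip u u := by
  have h : ip u u = Finsupp.sum (α := MonB F L) (M := ℚ) u fun b c => c * (fac b * co b u) :=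
    Finsupp.linearCombination_apply ℚ _
  rw [h]
  refine Finset.sum_pos (fun b hb => ?_) (Finsupp.support_nonempty_iff.2 hu)
  have h0 : co b u ≠ 0 := Finsupp.mem_support_iff.1 hb
  have : 0 < co b u * (fac b * co b u) := by
    have := mul_pos (fac_pos b) (mul_self_pos.2 h0)
    linarith
  exact this

theorem ip_zF_bF (p : Fin F) (r : Ix L) (b c : MonB F L) :
    ip (zF p r (bF ℚ b)) (bF ℚ c) = ip (bF ℚ b) (dF p r (bF ℚ c)) := by
  rcases r with r | r
  · have h1 : zF p (Sum.inl r) (bF ℚ b)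
        = bF ℚ (Function.update b.1 (p, r) (b.1 (p, r) + 1), b.2) := zE_bvec p r b
    have h2 : dF p (Sum.inl r) (bF ℚ c)
        = (c.1 (p, r) : ℚ) • bF ℚ (Function.update c.1 (p, r) (c.1 (p, r) - 1), c.2) :=
      dE_bvec p r c
    rw [h1, h2, map_smul, ip_bF_bF, ip_bF_bF, smul_eq_mul, fac_update]
    by_cases h : (Function.update b.1 (p, r) (b.1 (p, r) + 1), b.2) = c
    · subst h
      simp
    · rw [if_neg h]
      by_cases h0 : c.1 (p, r) = 0
      · simp [h0]
      · rw [if_neg, mul_zero]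
        rintro rfl
        refine h ?_
        simp only [Function.update_self, Function.update_idem]
        rw [Nat.sub_add_cancel (Nat.pos_of_ne_zero h0), Function.update_eq_self]
  · have h1 : zF p (Sum.inr r) (bF ℚ b) = if b.2 (p, r) then 0
      else ((-1:ℚ) ^ oddBefore b.2 (p, r)) • bF ℚ (b.1, Function.update b.2 (p, r) true) :=
      zO_bvec p r b
    have h2 : dF p (Sum.inr r) (bF ℚ c) = if c.2 (p, r) then
      ((-1:ℚ) ^ oddBefore c.2 (p, r)) • bF ℚ (c.1, Function.update c.2 (p, r) false) else 0 :=
      dO_bvec p r c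
    rw [h1, h2]
    by_cases hb : b.2 (p, r) = true
    · rw [if_pos hb, ip_comm, map_zero]
      by_cases hc : c.2 (p, r) = true
      · rw [if_pos hc, map_smul, ip_bF_bF, if_neg, smul_zero]
        rintro rfl
        simp at hb
      · rw [if_neg hc, map_zero]
    · rw [if_neg hb, ip_smul, LinearMap.smul_apply, ip_bF_bF]
      rw [Bool.not_eq_true] at hb
      by_cases hc : c.2 (p, r) = true
      · rw [if_pos hc, map_smul, ip_bF_bF]
        by_cases h : (b.1, Function.update b.2 (p, r) true) = c
        · subst h
          have hu : Function.update b.2 (p, r) false = b.2 := by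
            rw [← hb, Function.update_eq_self]
          simp [oddBefore_update_self, hu, fac]
        · rw [if_neg h, if_neg, smul_zero, smul_zero]
          rintro rfl
          refine h ?_
          simp only [Function.update_idem]
          rw [← hc, Function.update_eq_self]
      · rw [if_neg hc, map_zero, if_neg, smul_zero]
        rintro rfl
        simp at hc

theorem ip_zF (p : Fin F) (r : Ix L) (u v : FM ℚ F L) : ip (zF p r u) v = ip u (dF p r v) :=
  ip_adjoint (ip_zF_bF p r) u v

theorem ip_dF (p : Fin F) (r : Ix L) (u v : FM ℚ F L) : ip (dF p r u) v = ip u (zF p r v) := by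
  rw [ip_comm, ← ip_zF, ip_comm]

variable {G : Type} [AddCommGroup G]

theorem ip_sum_left {ι : Type*} (s : Finset ι) (f : ι → FM ℚ F L) (v : FM ℚ F L) :
    ip (∑ i ∈ s, f i) v = ∑ i ∈ s, ip (f i) v := by
  rw [ip_comm, map_sum]
  exact Finset.sum_congr rfl fun i _ => ip_comm _ _

variable (τ : Fin F → Bool)

theorem ip_gU (P Q : Fin F) (u v : FM ℚ F L) : ip (gU ℚ τ P Q u) v = ip u (gU ℚ τ Q P v) := by
  unfold gU
  rw [LinearMap.sum_apply, LinearMap.sum_apply, ip_sum_left, map_sum]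
  refine Finset.sum_congr rfl fun r _ => ?_
  rw [Module.End.mul_apply, Module.End.mul_apply, Zt, Dt, ip_zF, ip_dF]; rfl

theorem ip_gV (r s : Ix L) (u v : FM ℚ F L) : ip (gV ℚ τ r s u) v = ip u (gV ℚ τ s r v) := by
  unfold gV
  rw [LinearMap.sum_apply, LinearMap.sum_apply, ip_sum_left, map_sum]
  refine Finset.sum_congr rfl fun P _ => ?_
  rw [LinearMap.smul_apply, LinearMap.smul_apply, ip_smul, map_smul, LinearMap.smul_apply,
    Module.End.mul_apply, Module.End.mul_apply, Zt, Dt, ip_zF, ip_dF, Bool.xor_comm]; rfl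

/-- Orthogonal projection onto a finite-dimensional subspace. -/
theorem exists_orth (W : Submodule ℚ (FM ℚ F L)) [FiniteDimensional ℚ W] (x : FM ℚ F L) :
    ∃ w ∈ W, ∀ y ∈ W, ip y (x - w) = 0 := by
  let T : W →ₗ[ℚ] Module.Dual ℚ W := ((ipB F L).compr₂ (1 : Module.Dual ℚ ℚ)).compl₁₂ W.subtype
      W.subtype
  have hT : ∀ w y : W, T w y = ip (w : FM ℚ F L) y := fun w y => rfl
  have hinj : Function.Injective T := by
    rw [← LinearMap.ker_eq_bot, LinearMap.ker_eq_bot']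
    intro w hw
    by_contra h
    have := ip_self (w : FM ℚ F L) (fun h0 => h (Subtype.ext h0))
    rw [← hT, hw] at this
    exact lt_irrefl _ this
  have hsurj : Function.Surjective T :=
    (LinearMap.injective_iff_surjective_of_finrank_eq_finrank
      (Subspace.dual_finrank_eq (K := ℚ) (V := W)).symm).1 hinj
  obtain ⟨w, hw⟩ := hsurj ((ip x).comp W.subtype)
  refine ⟨w, w.2, fun y hy => ?_⟩
  have := LinearMap.congr_fun hw ⟨y, hy⟩
  rw [hT] at this
  rw [map_sub, ip_comm y x, ip_comm y w, this, sub_eq_zero]; rfl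

end Form

section Shifts
variable {K : Type} [Field K] {F L : ℕ} {G : Type} [AddCommGroup G] (τ : Fin F → Bool)

theorem shW_Zt (w : Fin F → Ix L → G) (P : Fin F) (r : Ix L) :
    ShW w (Zt K τ P r) (w P (fl τ P r)) := shW_zF w P _

theorem shW_Dt (w : Fin F → Ix L → G) (P : Fin F) (r : Ix L) :
    ShW w (Dt K τ P r) (-w P (fl τ P r)) := shW_dF w P _

theorem shW_ZD {w : Fin F → Ix L → G} {v : G} {P Q : Fin F} {r s : Ix L}
    (h : w P (fl τ P r) = w Q (fl τ Q s) + v) : ShW w (Zt K τ P r * Dt K τ Q s) v := by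
  have := (shW_Zt (K := K) τ w P r).mul (shW_Dt τ w Q s)
  rwa [h, add_neg_cancel_comm] at this

theorem shW_ZZ {w : Fin F → Ix L → G} {v : G} {P Q : Fin F} {r s : Ix L}
    (h : w P (fl τ P r) + w Q (fl τ Q s) = v) : ShW w (Zt K τ P r * Zt K τ Q s) v := by
  have := (shW_Zt (K := K) τ w P r).mul (shW_Zt τ w Q s)
  rwa [h] at this

theorem shW_gU {w : Fin F → Ix L → G} {v : G} {P Q : Fin F}
    (h : ∀ r, w P (fl τ P r) = w Q (fl τ Q r) + v) : ShW w (gU K τ P Q) v :=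
  ShW.sum _ fun r _ => shW_ZD τ (h r)

theorem shW_gV {w : Fin F → Ix L → G} {v : G} {r s : Ix L}
    (h : ∀ P, w P (fl τ P r) = w P (fl τ P s) + v) : ShW w (gV K τ r s) v :=
  ShW.sum _ fun P _ => (shW_ZD τ (h P)).smul _

theorem shW_om {w : Fin F → Ix L → G} {v : G} {P Q : Fin F}
    (h : ∀ r, w P (fl τ P r) + w Q (fl τ Q (nIx r)) = v) : ShW w (om K L τ P Q) v :=
  ShW.sum _ fun r _ => (shW_ZZ τ (h r)).smul _

theorem ShW.prW_comm {w : Fin F → Ix L → G} {T : Module.End K (FM K F L)} (hT : ShW w T 0) (g : G)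
    (x : FM K F L) : prW K w g (T x) = T (prW K w g x) := by
  rw [hT.apply, sub_zero]

/-- The total degree. -/
def wdeg : Fin F → Ix L → ℤ := fun _ _ => 1

/-- The weight recording the slots. -/
def wst : Fin F → Ix L → ℤ := fun P _ => (P.val : ℤ)

theorem wtG_nonneg {w : Fin F → Ix L → ℤ} (hw : ∀ P r, 0 ≤ w P r) (b : MonB F L) :
    0 ≤ wtG w b :=
  Finset.sum_nonneg fun P _ => Finset.sum_nonneg fun r _ => nsmul_nonneg (hw P r) _

theorem ex_le_wtG (w : Fin F → Ix L → ℤ) (hw : ∀ P r, 0 ≤ w P r) (b : MonB F L) (P : Fin F)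
    (r : Ix L) : ex b P r • w P r ≤ wtG w b :=
  (Finset.single_le_sum (f := fun r => ex b P r • w P r)
    (fun s _ => nsmul_nonneg (hw P s) _) (Finset.mem_univ r)).trans
  (Finset.single_le_sum (f := fun P => ∑ r, ex b P r • w P r)
    (fun Q _ => Finset.sum_nonneg fun s _ => nsmul_nonneg (hw Q s) _) (Finset.mem_univ P))

theorem finite_wdeg (d : ℤ) : {b : MonB F L | wtG wdeg b = d}.Finite := by
  refine Set.Finite.of_finite_image (f := fun b => ex b)
    ((Set.finite_Iic (fun (_ : Fin F) (_ : Ix L) => d.toNat)).subset ?_)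
    fun b _ c _ h => ex_injective fun p r => congrFun (congrFun h p) r
  rintro _ ⟨b, hb, rfl⟩ p r
  have := ex_le_wtG wdeg (fun _ _ => zero_le_one) b p r
  rw [show wtG wdeg b = d from hb, wdeg, nsmul_one] at this
  change ex b p r ≤ d.toNat
  omega

theorem finiteDimensional_of_wdeg {d : ℤ} {Y : Submodule K (FM K F L)}
    (h : ∀ x ∈ Y, prW K wdeg d x = x) : FiniteDimensional K Y := by
  let S : Submodule K (FM K F L) := Submodule.span K (bF K '' {b | wtG wdeg b = d})
  have : FiniteDimensional K S := FiniteDimensional.span_of_finite K ((finite_wdeg d).image _)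
  refine Submodule.finiteDimensional_of_le (S₂ := S) fun x hx => ?_
  have hS : S = Finsupp.supported (M := K) (R := K) {b : MonB F L | wtG wdeg b = d} :=
    (Finsupp.supported_eq_span_single K _).symm
  rw [hS]
  refine (Finsupp.mem_supported (M := K) K (α := MonB F L) x).2 fun b hb => ?_
  have hb : co b x ≠ 0 := Finsupp.mem_support_iff.1 hb
  rw [← h x hx, co_prW] at hb
  by_contra hne
  exact hb (if_neg hne)

variable {τ} in
/-- A nonzero subspace stable under the slot operators contains a vector killed by the raising
operators. -/
theorem exists_raised {Z : Submodule K (FM K F L)} (hZ : ∀ P Q, ∀ x ∈ Z, gU K τ P Q x ∈ Z)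
    {x : FM K F L} (hx : x ∈ Z) (hx0 : x ≠ 0) :
    ∃ y ∈ Z, y ≠ 0 ∧ ∀ P Q, P < Q → gU K τ P Q y = 0 := by
  have key : ∀ B : ℕ, ∀ x ∈ Z, x ≠ 0 → WtIn wst (Set.Iio (B : ℤ)) x →
      ∃ y ∈ Z, y ≠ 0 ∧ ∀ P Q, P < Q → gU K τ P Q y = 0 := by
    intro B
    induction B with
    | zero =>
      intro x _ hx0 hw
      obtain ⟨b, hb⟩ := exists_co_ne hx0
      have h1 := hw.co hb
      have h2 := wtG_nonneg (w := wst) (fun P _ => Int.natCast_nonneg _) b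
      rw [Set.mem_Iio] at h1
      push_cast at h1
      omega
    | succ B ih =>
      intro x hx hx0 hw
      by_cases h : ∀ P Q, P < Q → gU K τ P Q x = 0
      · exact ⟨x, hx, hx0, h⟩
      · push Not at h
        obtain ⟨P, Q, hPQ, hne⟩ := h
        refine ih _ (hZ P Q x hx) hne ((hw.shift (v := (P.val : ℤ) - Q.val)
          (shW_gU τ fun r => by simp [wst])).mono fun g hg => ?_)
        simp only [Set.mem_ofPred_eq, Set.mem_Iio] at hg ⊢
        have : P.val < Q.val := hPQ
        push_cast at hg
        omega
  obtain ⟨g, _, hg⟩ := exists_top wst hx0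
  refine key (g.toNat + 1) x hx hx0 fun g' hg' => ?_
  by_contra hc
  refine hg' (hg g' ?_)
  rw [Set.mem_Iio] at hc
  push_cast at hc
  omega

end Shifts

section Reducibility
variable {F L : ℕ} {τ : Fin F → Bool}

theorem exists_raised_notMem {d : ℤ} {Y Y' : Submodule ℚ (FM ℚ F L)} (hle : Y' ≤ Y)
    (hd : ∀ x ∈ Y, prW ℚ wdeg d x = x) (hY : ∀ P Q, ∀ x ∈ Y, gU ℚ τ P Q x ∈ Y)
    (hY' : ∀ P Q, ∀ x ∈ Y', gU ℚ τ P Q x ∈ Y') {x : FM ℚ F L} (hx : x ∈ Y) (hx' : x ∉ Y') :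
    ∃ y ∈ Y, y ∉ Y' ∧ ∀ P Q, P < Q → gU ℚ τ P Q y = 0 := by
  have : FiniteDimensional ℚ Y' := finiteDimensional_of_wdeg fun y hy => hd y (hle hy)
  let Z : Submodule ℚ (FM ℚ F L) :=
    { carrier := {y | y ∈ Y ∧ ∀ w ∈ Y', ip w y = 0}
      zero_mem' := ⟨Y.zero_mem, fun w _ => map_zero _⟩
      add_mem' := fun ha hb => ⟨Y.add_mem ha.1 hb.1, fun w hw => by
        rw [map_add, ha.2 w hw, hb.2 w hw, add_zero]⟩
      smul_mem' := fun c a ha => ⟨Y.smul_mem c ha.1, fun w hw => by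
        rw [map_smul, ha.2 w hw, smul_zero]⟩ }
  have hZ : ∀ P Q, ∀ x ∈ Z, gU ℚ τ P Q x ∈ Z := fun P Q x hx =>
    ⟨hY P Q x hx.1, fun w hw => by rw [← ip_gU]; exact hx.2 _ (hY' _ _ _ hw)⟩
  obtain ⟨w, hw, hort⟩ := exists_orth Y' x
  obtain ⟨y, hy, hy0, hk⟩ := exists_raised hZ (x := x - w)
    ⟨Y.sub_mem hx (hle hw), hort⟩ (fun h => hx' (sub_eq_zero.1 h ▸ hw))
  exact ⟨y, hy.1, fun h => (ip_self y hy0).ne' (hy.2 y h), hk⟩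

end Reducibility

section Pivots
variable {K : Type} [Field K] {F L : ℕ} (τ : Fin F → Bool)

theorem raise_top {ι : Type*} {s : Finset ι} {T : ι → Module.End K (FM K F L)}
    {w : Fin F → Ix L → ℤ}
    {h : FM K F L} {e : ℤ} (h0 : (∑ i ∈ s, T i) h = 0) {i : ι} (hi : i ∈ s) (hTi : ShW w (T i) 1)
    (hT : ∀ j ∈ s, j ≠ i → ShW w (T j) 0) (he : ∀ g, e < g → prW K w g h = 0) :
    T i (prW K w e h) = 0 := by
  have := congrArg (prW K w (e + 1)) h0
  rw [LinearMap.sum_apply, map_sum, map_zero, Finset.sum_eq_single_of_mem i hi, hTi.apply,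
    add_sub_cancel_right] at this
  · exact this
  · intro j hj hji
    rw [(hT j hj hji).prW_comm, he _ (lt_add_one e), map_zero]

/-- The exponent of one even variable. -/
def wcell (P : Fin F) (l : Fin L) : Fin F → Ix L → ℤ := fun Q r => if Q = P ∧ r = Sum.inl l then 1
    else 0

variable {τ}

theorem sg_smul_eq_zero {b : Bool} {x : FM K F L} (h : sg K b • x = 0) : x = 0 := by
  rw [← one_smul K x, ← sg_mul_self (K := K) b, mul_smul, h, smul_zero]

theorem gV_prW_wcell {P : Fin F} {r r' s : Ix L} {l : Fin L} (hl : fl τ P r = Sum.inl l)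
    (hr : r' ≠ r) (hs : s ≠ r) : ShW (wcell P l) (gV K τ r' s) 0 := by
  refine shW_gV τ fun Q => ?_
  by_cases hQ : Q = P
  · subst hQ
    have h1 : fl τ Q r' ≠ Sum.inl l := fun h => hr ((fl_inj τ Q).1 (h.trans hl.symm))
    have h2 : fl τ Q s ≠ Sum.inl l := fun h => hs ((fl_inj τ Q).1 (h.trans hl.symm))
    simp [wcell, h1, h2]
  · simp [wcell, hQ]

theorem gU_prW_wcell {P P' Q : Fin F} {l : Fin L} (hP : P' ≠ P) (hQ : Q ≠ P) :
    ShW (wcell P l) (gU K τ P' Q) 0 :=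
  shW_gU τ fun s => by simp [wcell, hP, hQ]

theorem co_prW_ne {G : Type} [AddCommGroup G] {w : Fin F → Ix L → G} {g : G} {b : MonB F L}
    {x : FM K F L} (h : co b (prW K w g x) ≠ 0) : co b x ≠ 0 := by
  classical
  rw [co_prW] at h
  intro h0
  simp [h0] at h

variable [CharZero K]

theorem Dt_top_of_gV {P : Fin F} {r s : Ix L} {l : Fin L} (hl : fl τ P r = Sum.inl l) (hs : s ≠ r)
    {h : FM K F L} {e : ℤ} (he : ∀ g, e < g → prW K (wcell P l) g h = 0)
    (h0 : gV K τ r s h = 0) : Dt K τ P s (prW K (wcell P l) e h) = 0 := by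
  have hne : fl τ P s ≠ Sum.inl l := fun h => hs ((fl_inj τ P).1 (h.trans hl.symm))
  have h1 := raise_top (w := wcell P l) h0 (Finset.mem_univ P) ((shW_ZD τ ?_).smul _)
    (fun Q _ hQ => (shW_ZD τ ?_).smul _) he
  · have h2 := sg_smul_eq_zero h1
    rw [Module.End.mul_apply, Zt, hl] at h2
    exact zF_inl_injective h2
  · simp [wcell, hl, hne]
  · simp [wcell, hQ]

theorem Dt_top_of_gU {P Q : Fin F} {r : Ix L} {l : Fin L} (hl : fl τ P r = Sum.inl l) (hQ : Q ≠ P)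
    {h : FM K F L} {e : ℤ} (he : ∀ g, e < g → prW K (wcell P l) g h = 0)
    (h0 : gU K τ P Q h = 0) : Dt K τ Q r (prW K (wcell P l) e h) = 0 := by
  have h1 := raise_top (w := wcell P l) h0 (Finset.mem_univ r) (shW_ZD τ ?_)
    (fun s _ hs => shW_ZD τ ?_) he
  · rw [Module.End.mul_apply, Zt, hl] at h1
    exact zF_inl_injective h1
  · simp [wcell, hl, hQ]
  · have hne : fl τ P s ≠ Sum.inl l := fun h => hs ((fl_inj τ P).1 (h.trans hl.symm))
    simp [wcell, hne, hQ]

/-- Successive leading terms with respect to a sequence of even variables. -/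
theorem exists_pivot {m : ℕ} (P : Fin m → Fin F) (r : Fin m → Ix L)
    (hev : ∀ i, pz τ (P i) (r i) = false) (hP : Function.Injective P) (hr : Function.Injective r)
    (S : Fin m → Ix L → Prop) (T : Fin m → Fin F → Prop)
    (hS : ∀ i j s, i ≤ j → S j s → s ≠ r i) (hT : ∀ i j Q, i ≤ j → T j Q → Q ≠ P i)
    {h : FM K F L} (h0 : h ≠ 0) (hV : ∀ i s, S i s → gV K τ (r i) s h = 0)
    (hU : ∀ i Q, T i Q → gU K τ (P i) Q h = 0) :
    ∃ b, co b h ≠ 0 ∧ (∀ i s, S i s → ex b (P i) (fl τ (P i) s) = 0) ∧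
      ∀ i Q, T i Q → ex b Q (fl τ Q (r i)) = 0 := by
  have key : ∀ k : ℕ, k ≤ m → ∃ x : FM K F L, x ≠ 0 ∧ (∀ b, co b x ≠ 0 → co b h ≠ 0) ∧
      (∀ i : Fin m, k ≤ i.val → (∀ s, S i s → gV K τ (r i) s x = 0) ∧
        ∀ Q, T i Q → gU K τ (P i) Q x = 0) ∧
      ∀ i : Fin m, i.val < k → ∀ b, co b x ≠ 0 →
        (∀ s, S i s → ex b (P i) (fl τ (P i) s) = 0) ∧ ∀ Q, T i Q → ex b Q (fl τ Q (r i)) = 0 := by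
    intro k
    induction k with
    | zero =>
      exact fun _ => ⟨h, h0, fun _ => id, fun i _ => ⟨hV i, hU i⟩, fun i hi => absurd hi (by omega)⟩
    | succ k ih =>
      intro hk
      obtain ⟨x, hx0, hsup, hcond, hprop⟩ := ih (by omega)
      let i0 : Fin m := ⟨k, by omega⟩
      obtain ⟨l, hl⟩ : ∃ l, fl τ (P i0) (r i0) = Sum.inl l := by
        have := fl_isRight τ (P i0) (r i0)
        rw [show xor _ _ = _ from hev i0] at this
        cases hc : fl τ (P i0) (r i0) with
        | inl l => exact ⟨l, rfl⟩
        | inr l => rw [hc] at this; cases this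
      obtain ⟨e, hne, he⟩ := exists_top (wcell (P i0) l) hx0
      refine ⟨prW K (wcell (P i0) l) e x, hne, fun b hb => hsup b (co_prW_ne hb),
        fun i hi => ?_, fun i hi b hb => ?_⟩
      · have hlt : i0 < i := hi
        obtain ⟨h1, h2⟩ := hcond i (by omega)
        refine ⟨fun s hs => ?_, fun Q hQ => ?_⟩
        · rw [← (gV_prW_wcell hl (hr.ne hlt.ne') (hS i0 i s hlt.le hs)).prW_comm, h1 s hs, map_zero]
        · rw [← (gU_prW_wcell (hP.ne hlt.ne') (hT i0 i Q hlt.le hQ)).prW_comm, h2 Q hQ, map_zero]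
      · rcases Nat.lt_succ_iff_lt_or_eq.1 hi with hi | hi
        · exact hprop i hi b (co_prW_ne hb)
        · have hi : i = i0 := Fin.ext hi
          rw [hi]
          obtain ⟨h1, h2⟩ := hcond i0 le_rfl
          exact ⟨fun s hs => ex_eq_zero_of_dF
              (Dt_top_of_gV hl (hS i0 i0 s le_rfl hs) he (h1 s hs)) hb,
            fun Q hQ => ex_eq_zero_of_dF (Dt_top_of_gU hl (hT i0 i0 Q le_rfl hQ) he (h2 Q hQ)) hb⟩
  obtain ⟨x, hx0, hsup, -, hprop⟩ := key m le_rfl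
  obtain ⟨b, hb⟩ := exists_co_ne hx0
  exact ⟨b, hsup b hb, fun i => (hprop i i.2 b hb).1, fun i => (hprop i i.2 b hb).2⟩

end Pivots

section Strict
variable {K : Type} [Field K] {F L : ℕ} (τ : Fin F → Bool)

theorem gV_gV (r s t u : Ix L) :
    gV K τ r s * gV K τ t u
      = sg K (xor r.isRight s.isRight && xor t.isRight u.isRight) • (gV K τ t u * gV K τ r s)
        + ((if r = u then -(sg K (xor r.isRight s.isRight && xor t.isRight u.isRight) • gV K τ t s)
            else 0) + if s = t then gV K τ r u else 0) := by
  have h : ∀ P ∈ (Finset.univ : Finset (Fin F)),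
      gV K τ r s * (sg K (τ P && xor t.isRight u.isRight) • (Zt K τ P t * Dt K τ P u))
      = sg K (xor r.isRight s.isRight && xor t.isRight u.isRight) •
          ((sg K (τ P && xor t.isRight u.isRight) • (Zt K τ P t * Dt K τ P u)) * gV K τ r s)
        + ((if r = u then -(sg K (xor r.isRight s.isRight && xor t.isRight u.isRight) •
              (sg K (τ P && xor t.isRight s.isRight) • (Zt K τ P t * Dt K τ P s))) else 0)
          + if s = t then sg K (τ P && xor r.isRight u.isRight) • (Zt K τ P r * Dt K τ P u)
            else 0) := by
    intro P _
    rw [push_smul (sg K (τ P && xor t.isRight u.isRight))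
      (push_mul (gV_Zt τ P r s t) (gV_Dt τ P r s u))]
    congr 1
    · congr 1
      simp only [pz]
      cases τ P <;> cases r.isRight <;> cases s.isRight <;> cases t.isRight <;>
        cases u.isRight <;> simp
    · rw [smul_add]
      congr 1
      · by_cases h : r = u
        · subst h
          simp only [if_true, mul_neg, smul_neg, mul_smul_comm, smul_smul, pz]
          congr 2
          cases τ P <;> cases r.isRight <;> cases s.isRight <;> cases t.isRight <;> simp
        · simp [h]
      · by_cases h : s = t
        · subst h
          simp only [if_true, smul_mul_assoc, smul_smul]
          congr 1
          cases τ P <;> cases r.isRight <;> cases s.isRight <;> cases u.isRight <;> simp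
        · simp [h]
  have e : gV K τ t u
      = ∑ P, sg K (τ P && xor t.isRight u.isRight) • (Zt K τ P t * Dt K τ P u) := rfl
  rw [e, push_sum _ h, Finset.sum_add_distrib]
  congr 1
  congr 1
  · by_cases h : r = u
    · simp only [h, if_true, Finset.sum_neg_distrib, ← Finset.smul_sum]; rfl
    · simp [h]
  · by_cases h : s = t
    · simp only [h, if_true]; rfl
    · simp [h]

/-- The linear order on the indices for which highest weight vectors are taken. -/
def cd : Ix L → ℕ := Sum.elim (fun a => 2 * a.val) (fun a => 2 * a.val + 1)

/-- The position of the pair containing an index. -/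
def pr : Ix L → ℕ := Sum.elim (fun a => a.val) (fun a => a.val)

@[simp] theorem pr_nIx (r : Ix L) : pr (nIx r) = pr r := by cases r <;> rfl

@[simp] theorem pr_fl (P : Fin F) (r : Ix L) : pr (fl τ P r) = pr r := by
  unfold fl; split_ifs <;> simp

/-- The weight recording the positions of the indices. -/
def wth : Fin F → Ix L → ℤ := fun _ r => -(pr r : ℤ)

theorem shW_gV_wth (r s : Ix L) : ShW wth (gV K τ r s) (pr s - pr r) :=
  shW_gV τ fun P => by simp only [wth, pr_fl]; ring

/-- The weight recording the number of occurrences of each index. -/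
def wV : Fin F → Ix L → Ix L → ℤ := fun P r => Pi.single (fl τ P r) 1

@[simp] theorem fl_fl (P : Fin F) (r : Ix L) : fl τ P (fl τ P r) = r := by
  unfold fl; cases τ P <;> simp

theorem shW_gV_wV (r s : Ix L) : ShW (wV τ) (gV K τ r s) (Pi.single r 1 - Pi.single s 1) :=
  shW_gV τ fun P => by simp only [wV, fl_fl, add_sub_cancel]

theorem shW_gU_wV (P Q : Fin F) : ShW (wV τ) (gU K (L := L) τ P Q) 0 :=
  shW_gU τ fun r => by simp only [wV, fl_fl, add_zero]

theorem shW_gU_wth (P Q : Fin F) : ShW wth (gU K (L := L) τ P Q) 0 :=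
  shW_gU τ fun r => by simp only [wth, pr_fl, add_zero]

theorem wtG_wV (b : MonB F L) (r : Ix L) : wtG (wV τ) b r = ∑ P, (ex b P (fl τ P r) : ℤ) := by
  simp only [wtG, Finset.sum_apply, Pi.smul_apply, wV]
  refine Finset.sum_congr rfl fun P _ => ?_
  rw [Finset.sum_eq_single (fl τ P r)]
  · simp
  · intro s _ hs
    rw [Pi.single_eq_of_ne, smul_zero]
    rintro rfl
    simp at hs
  · simp

theorem co_gV_self (r : Ix L) (b : MonB F L) (x : FM K F L) :
    co b (gV K τ r r x) = (wtG (wV τ) b r : K) * co b x := by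
  rw [wtG_wV, gV, LinearMap.sum_apply, map_sum, Int.cast_sum, Finset.sum_mul]
  refine Finset.sum_congr rfl fun P _ => ?_
  rw [Bool.xor_self, Bool.and_false, sg_false, one_smul, Module.End.mul_apply, Zt, Dt, co_zF_dF,
    Int.cast_natCast]

theorem wtG_of_pure {G : Type} [AddCommGroup G] {w : Fin F → Ix L → G} {k : G} {x : FM K F L}
    (hx : prW K w k x = x) {b : MonB F L} (hb : co b x ≠ 0) : wtG w b = k := by
  classical
  rw [← hx, co_prW] at hb
  exact (ite_ne_right_iff.1 hb).1

theorem gV_self_of_pure {k : Ix L → ℤ} {x : FM K F L} (hx : prW K (wV τ) k x = x) (r : Ix L) :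
    gV K τ r r x = (k r : K) • x := by
  refine FM_ext fun b => ?_
  rw [co_gV_self, map_smul, smul_eq_mul]
  by_cases hb : co b x = 0
  · rw [hb, mul_zero, mul_zero]
  · rw [wtG_of_pure hx hb]

variable (L) in
/-- The vectors killed by the upper triangular matrix units and balanced between the two halves. -/
def HwV (τ : Fin F → Bool) (h : FM K F L) : Prop :=
  (∀ r s, cd r < cd s → gV K τ r s h = 0) ∧
    ∀ a : Fin L, gV K τ (Sum.inl a) (Sum.inl a) h = gV K τ (Sum.inr a) (Sum.inr a) h

theorem HwV.prW {h : FM K F L} (hh : HwV L τ h) (k : Ix L → ℤ) : HwV L τ (prW K (wV τ) k h) := by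
  refine ⟨fun r s hrs => ?_, fun a => ?_⟩
  · have := (shW_gV_wV (K := K) τ r s).apply (k + (Pi.single r 1 - Pi.single s 1)) h
    rwa [hh.1 r s hrs, map_zero, add_sub_cancel_right, eq_comm] at this
  · have h1 : ∀ r : Ix L, ShW (wV τ) (gV K τ r r) 0 := fun r => by
      simpa using shW_gV_wV (K := K) τ r r
    rw [← (h1 _).prW_comm, ← (h1 _).prW_comm, hh.2]

theorem hwV_top [CharZero K] {f : FM K F L} (hf : ∀ r s, pX K τ r s f = 0) {t : ℤ}
    (ht : ∀ g, t < g → prW K wth g f = 0) : HwV L τ (prW K wth t f) := by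
  have key : ∀ r s g, gV K τ r s (prW K wth g f)
      + etaP K r s • gV K τ (nIx s) (nIx r) (prW K wth (g + 2 * (pr s - pr r)) f) = 0 := by
    intro r s g
    have := congrArg (prW K wth (g + (pr s - pr r))) (hf r s)
    rw [map_zero, pX, LinearMap.add_apply, map_add, LinearMap.smul_apply, map_smul,
      (shW_gV_wth τ r s).apply, (shW_gV_wth τ _ _).apply, pr_nIx, pr_nIx] at this
    rwa [add_sub_cancel_right, show g + ((pr s : ℤ) - pr r) - (pr r - pr s)
      = g + 2 * (pr s - pr r) by ring] at this
  refine ⟨fun r s hrs => ?_, fun a => ?_⟩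
  · have h1 := key r s t
    by_cases hp : pr r = pr s
    · obtain ⟨a, rfl, rfl⟩ : ∃ a, r = Sum.inl a ∧ s = Sum.inr a := by
        rcases r with a | a <;> rcases s with b | b <;> simp [cd, pr] at hrs hp
        · omega
        · exact ⟨a, rfl, by rw [Fin.ext hp]⟩
        · omega
        · omega
      simp only [pr, Sum.elim_inl, Sum.elim_inr, sub_self, mul_zero, add_zero, nIx, etaP] at h1
      have h2 : (2 : K) • gV K τ (Sum.inl a) (Sum.inr a) (_root_.prW K wth t f) = 0 := by
        rw [two_smul, ← h1]; simp
      exact (smul_eq_zero_iff_right two_ne_zero).1 h2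
    · have hlt : pr r < pr s := by
        rcases r with a | a <;> rcases s with b | b <;> simp [cd, pr] at hrs hp ⊢ <;> omega
      rwa [ht (t + 2 * (pr s - pr r)) (by omega), map_zero, smul_zero, add_zero] at h1
  · have h1 := key (Sum.inl a) (Sum.inl a) t
    simp only [pr, Sum.elim_inl, sub_self, mul_zero, add_zero, nIx, etaP] at h1
    simpa [add_neg_eq_zero] using h1

theorem wtG_wV_nonneg (b : MonB F L) (r : Ix L) : 0 ≤ wtG (wV τ) b r := by
  rw [wtG_wV]; positivity

theorem HwV.balanced [CharZero K] {h : FM K F L} (hh : HwV L τ h) (h0 : h ≠ 0) {k : Ix L → ℤ}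
    (hk : _root_.prW K (wV τ) k h = h) (a : Fin L) : k (Sum.inr a) = k (Sum.inl a) := by
  have := hh.2 a
  rw [gV_self_of_pure τ hk, gV_self_of_pure τ hk] at this
  exact_mod_cast (smul_left_injective K h0 this).symm

theorem HwV.strict {h : FM ℚ F L} (hh : HwV L τ h) (h0 : h ≠ 0) {k : Ix L → ℤ}
    (hk : _root_.prW ℚ (wV τ) k h = h) {a b : Fin L} (hab : a < b) :
    k (Sum.inl b) < k (Sum.inl a) ∨ (k (Sum.inl a) = 0 ∧ k (Sum.inl b) = 0) := by
  obtain ⟨c, hc⟩ := exists_co_ne h0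
  have hnn : ∀ r, 0 ≤ k r := fun r => wtG_of_pure hk hc ▸ wtG_wV_nonneg τ c r
  have hpos := ip_self h h0
  have hab' : a.val < b.val := hab
  have e1 : gV ℚ τ (Sum.inl a) (Sum.inl b) h = 0 := hh.1 _ _ (by simp [cd]; omega)
  have h1 := congrArg (fun T => T h) (gV_gV (K := ℚ) τ (Sum.inl a) (Sum.inl b) (Sum.inl b)
      (Sum.inl a))
  simp only [Module.End.mul_apply, LinearMap.add_apply, e1, map_zero, if_true, Sum.isRight_inl,
    Bool.xor_self, Bool.and_self, sg_false, one_smul, LinearMap.neg_apply, zero_add,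
    gV_self_of_pure τ hk] at h1
  have h2 : ip (gV ℚ τ (Sum.inl b) (Sum.inl a) h) (gV ℚ τ (Sum.inl b) (Sum.inl a) h)
      = (k (Sum.inl a) - k (Sum.inl b)) * ip h h := by
    rw [ip_gV, h1, map_add, map_neg, map_smul, map_smul, smul_eq_mul, smul_eq_mul]; ring
  rcases lt_or_ge (k (Sum.inl b)) (k (Sum.inl a)) with hlt | hge
  · exact Or.inl hlt
  right
  have e2 : gV ℚ τ (Sum.inl b) (Sum.inl a) h = 0 := by
    by_contra hne
    have := ip_self _ hne
    rw [h2] at this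
    have h3 : (0 : ℚ) < k (Sum.inl a) - k (Sum.inl b) := by
      by_contra h4
      nlinarith
    have : (k (Sum.inl b) : ℚ) < k (Sum.inl a) := by linarith
    exact absurd (by exact_mod_cast this) (not_lt.2 hge)
  have e3 : gV ℚ τ (Sum.inl a) (Sum.inr a) h = 0 := hh.1 _ _ (by simp [cd])
  have e4 : gV ℚ τ (Sum.inl b) (Sum.inr a) h = 0 := by
    have h3 := congrArg (fun T => T h) (gV_gV (K := ℚ) τ (Sum.inl b) (Sum.inl a) (Sum.inl a)
        (Sum.inr a))
    simpa [e2, e3] using h3.symm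
  have e5 : gV ℚ τ (Sum.inr a) (Sum.inl b) h = 0 := hh.1 _ _ (by simp [cd]; omega)
  have h4 := congrArg (fun T => T h) (gV_gV (K := ℚ) τ (Sum.inr a) (Sum.inl b) (Sum.inl b)
      (Sum.inr a))
  simp only [Module.End.mul_apply, LinearMap.add_apply, e4, e5, map_zero, if_true, Sum.isRight_inl,
    Sum.isRight_inr, Bool.xor_false, Bool.xor_true, Bool.not_false, Bool.and_self, sg_true,
    LinearMap.neg_apply, gV_self_of_pure τ hk, neg_one_smul, neg_neg, neg_zero, zero_add, ←
        add_smul] at h4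
  have h5 := (smul_eq_zero_iff_left h0).1 h4.symm
  rw [hh.balanced τ h0 hk] at h5
  have h6 : k (Sum.inl b) + k (Sum.inl a) = 0 := by exact_mod_cast h5
  have := hnn (Sum.inl a); have := hnn (Sum.inl b)
  omega

theorem HwV.add_le {h : FM ℚ F L} (hh : HwV L τ h) (h0 : h ≠ 0) {k : Ix L → ℤ}
    (hk : _root_.prW ℚ (wV τ) k h = h) {a b : Fin L} (hab : a < b) (hb : 0 < k (Sum.inl b)) :
    b + k (Sum.inl b) ≤ a + k (Sum.inl a) := by
  have key : ∀ (d : ℕ) (a b : Fin L), b.val = a.val + d → 0 < k (Sum.inl b) →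
      b + k (Sum.inl b) ≤ a + k (Sum.inl a) := by
    intro d
    induction d with
    | zero => intro a b hab _; rw [Fin.ext hab]
    | succ d ih =>
      intro a b hab hb
      have h1 := ih ⟨a + 1, by omega⟩ b (by simp; omega) hb
      have h2 := hh.strict τ h0 hk (a := a) (b := ⟨a + 1, by omega⟩) (Nat.lt_succ_self a.val)
      have h3 : ((⟨a + 1, by omega⟩ : Fin L) : ℕ) = a + 1 := rfl
      rw [h3] at h1
      rcases h2 with h2 | h2
      · push_cast at h1; omega
      · have h4 := hh.strict τ h0 hk (a := a) (b := b) (show a.val < b.val by omega)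
        omega
  exact key (b - a) a b (by have : a.val < b.val := hab; omega) hb

end Strict

section Diagonal
variable {K : Type} [Field K] {N L : ℕ}

/-- The slot parity alternating between even and odd slots. -/
def tm (P : Fin N) : Bool := decide (P.val % 2 = 1)

theorem cd_injective : Function.Injective (cd : Ix L → ℕ) := by
  rintro (a | a) (b | b) h <;> simp only [cd, Sum.elim_inl, Sum.elim_inr] at h
  · rw [Fin.ext (show a.val = b.val by omega)]
  · omega
  · omega
  · rw [Fin.ext (show a.val = b.val by omega)]

theorem cd_lt (r : Ix L) : cd r < 2 * L := by
  rcases r with a | a <;> simp only [cd, Sum.elim_inl, Sum.elim_inr] <;> omega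

theorem exists_cd {i : ℕ} (hi : i < 2 * L) : ∃ r : Ix L, cd r = i := by
  rcases Nat.even_or_odd' i with ⟨a, ha | ha⟩
  · exact ⟨Sum.inl ⟨a, by omega⟩, ha.symm⟩
  · exact ⟨Sum.inr ⟨a, by omega⟩, ha.symm⟩

theorem pz_tm {P : Fin N} {r : Ix L} (h : P.val = cd r) : pz tm P r = false := by
  rcases r with a | a <;> simp only [cd, Sum.elim_inl, Sum.elim_inr] at h <;> simp [pz, tm, h]

/-- Monomials in the diagonal variables. -/
def IsDiag (b : MonB N L) : Prop := ∀ P r, ex b P (fl tm P r) ≠ 0 → P.val = cd r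

/-- Vectors killed by the upper triangular part of the slot algebra. -/
def HwU (τ : Fin N → Bool) (h : FM K N L) : Prop := ∀ P Q, P < Q → gU K τ P Q h = 0

theorem exists_diag [CharZero K] (hN : 2 * L ≤ N) {h : FM K N L} (h0 : h ≠ 0) (hV : HwV L tm h)
    (hU : HwU tm h) : ∃ b, co b h ≠ 0 ∧ IsDiag b := by
  choose r hr using fun i : Fin (2 * L) => exists_cd (L := L) i.2
  obtain ⟨b, hb, h1, h2⟩ := exists_pivot (τ := tm) (fun i : Fin (2 * L) => Fin.castLE hN i) r
    (fun i => pz_tm (hr i).symm) (Fin.castLE_injective hN)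
    (fun i j hij => Fin.ext (by rw [← hr i, ← hr j, hij])) (fun i s => i.val < cd s)
    (fun i Q => i.val < Q.val) (fun i j s hij hs h => by
      have hs : j.val < cd s := hs
      have hij : i.val ≤ j.val := hij
      rw [h, hr] at hs; omega)
    (fun i j Q hij hQ h => by
      have hQ : j.val < Q.val := hQ
      have hij : i.val ≤ j.val := hij
      rw [h, Fin.val_castLE] at hQ; omega) h0
    (fun i s hs => hV.1 _ _ (by rw [hr]; exact hs)) (fun i Q hQ => hU _ _ hQ)
  refine ⟨b, hb, fun P s hne => ?_⟩
  by_contra hPs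
  rcases lt_or_gt_of_ne hPs with hlt | hgt
  · exact hne (h1 ⟨P, hlt.trans (cd_lt s)⟩ s hlt)
  · have := h2 ⟨cd s, cd_lt s⟩ P hgt
    rw [cd_injective (hr ⟨cd s, cd_lt s⟩)] at this
    exact hne this

/-- The weight recording the degrees in the slots. -/
def wU : Fin N → Ix L → Fin N → ℤ := fun P _ => Pi.single P 1

theorem shW_gU_wU (τ : Fin N → Bool) (P Q : Fin N) :
    ShW wU (gU K (L := L) τ P Q) (Pi.single P 1 - Pi.single Q 1) :=
  shW_gU τ fun r => by simp only [wU, add_sub_cancel]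

theorem shW_gV_wU (τ : Fin N → Bool) (r s : Ix L) : ShW wU (gV K τ r s) 0 :=
  shW_gV τ fun r => by simp only [wU, add_zero]

theorem shW_gU_wdeg (τ : Fin N → Bool) (P Q : Fin N) : ShW wdeg (gU K (L := L) τ P Q) 0 :=
  shW_gU τ fun _ => rfl

theorem wtG_wU (b : MonB N L) (P : Fin N) : wtG wU b P = ∑ r, (ex b P r : ℤ) := by
  simp only [wtG, Finset.sum_apply, Pi.smul_apply, wU]
  rw [Finset.sum_eq_single P]
  · simp
  · intro Q _ hQ
    simp [Pi.single_eq_of_ne' hQ]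
  · simp

theorem ex_fl_ext {τ : Fin N → Bool} {b c : MonB N L}
    (h : ∀ P r, ex b P (fl τ P r) = ex c P (fl τ P r)) : b = c :=
  ex_injective fun P r => by simpa using h P (fl τ P r)

theorem IsDiag.wtG_wV {b : MonB N L} (hb : IsDiag b) {P : Fin N} {r : Ix L} (h : P.val = cd r) :
    wtG (wV tm) b r = ex b P (fl tm P r) := by
  rw [_root_.wtG_wV, Finset.sum_eq_single P]
  · intro Q _ hQ
    by_contra hne
    exact hQ (Fin.ext ((hb Q r (by exact_mod_cast hne)).trans h.symm))
  · simp

theorem IsDiag.wtG_wU {b : MonB N L} (hb : IsDiag b) {P : Fin N} {r : Ix L} (h : P.val = cd r) :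
    wtG wU b P = ex b P (fl tm P r) := by
  rw [_root_.wtG_wU, Finset.sum_eq_single (fl tm P r)]
  · intro s _ hs
    by_contra hne
    have := hb P (fl tm P s) (by rw [fl_fl]; exact_mod_cast hne)
    rw [h] at this
    rw [cd_injective this, fl_fl] at hs
    exact hs rfl
  · simp

theorem IsDiag.eq_of_wV {b c : MonB N L} (hb : IsDiag b) (hc : IsDiag c)
    (h : wtG (wV tm) b = wtG (wV tm) c) : b = c := by
  refine ex_fl_ext (τ := tm) fun P r => ?_
  by_cases hP : P.val = cd r
  · have := congrFun h r
    rw [hb.wtG_wV hP, hc.wtG_wV hP] at this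
    exact_mod_cast this
  · rw [not_not.1 (mt (hb P r) hP), not_not.1 (mt (hc P r) hP)]

theorem IsDiag.eq_of_wU {b c : MonB N L} (hb : IsDiag b) (hc : IsDiag c)
    (h : wtG wU b = wtG wU c) : b = c := by
  refine ex_fl_ext (τ := tm) fun P r => ?_
  by_cases hP : P.val = cd r
  · have := congrFun h P
    rw [hb.wtG_wU hP, hc.wtG_wU hP] at this
    exact_mod_cast this
  · rw [not_not.1 (mt (hb P r) hP), not_not.1 (mt (hc P r) hP)]

variable (K L) in
/-- The span of the products of quadratic invariants applied to the vacuum. -/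
inductive OmC (τ : Fin N → Bool) : FM K N L → Prop
  | vac : OmC τ (vF K N L)
  | om (P Q : Fin N) {x : FM K N L} : OmC τ x → OmC τ (om K L τ P Q x)
  | add {x y : FM K N L} : OmC τ x → OmC τ y → OmC τ (x + y)
  | smul (c : K) {x : FM K N L} : OmC τ x → OmC τ (c • x)

variable {τ : Fin N → Bool}

theorem OmC.zero : OmC K L τ 0 := by
  simpa using OmC.vac.smul (0 : K) (τ := τ) (L := L)

variable (K L τ) in
/-- The span of the products of quadratic invariants as a submodule. -/
def omS : Submodule K (FM K N L) where
  carrier := {x | OmC K L τ x}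
  add_mem' := OmC.add
  zero_mem' := OmC.zero
  smul_mem' c _ := OmC.smul c

theorem OmC.sum {ι : Type*} (s : Finset ι) {f : ι → FM K N L} (h : ∀ i ∈ s, OmC K L τ (f i)) :
    OmC K L τ (∑ i ∈ s, f i) := (omS K L τ).sum_mem h

theorem Dt_vF (P : Fin N) (r : Ix L) : Dt K τ P r (vF K N L) = 0 := dF_vF P _

theorem gU_vF (P Q : Fin N) : gU K τ P Q (vF K N L) = 0 := by
  simp [gU, LinearMap.sum_apply, Module.End.mul_apply, Dt_vF]

theorem gV_vF (r s : Ix L) : gV K τ r s (vF K N L) = 0 := by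
  simp [gV, LinearMap.sum_apply, Module.End.mul_apply, Dt_vF]

theorem OmC.pX {x : FM K N L} (hx : OmC K L τ x) (r s : Ix L) : pX K τ r s x = 0 := by
  induction hx with
  | vac => simp [_root_.pX, gV_vF]
  | om P Q _ ih =>
    rw [← Module.End.mul_apply, pX_om, LinearMap.smul_apply, Module.End.mul_apply, ih, map_zero,
      smul_zero]
  | add _ _ h1 h2 => rw [map_add, h1, h2, add_zero]
  | smul c _ ih => rw [map_smul, ih, smul_zero]

theorem OmC.prW {G : Type} [AddCommGroup G] {w : Fin N → Ix L → G} {u : Fin N → Fin N → G}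
    (hw : ∀ P Q r, w P (fl τ P r) + w Q (fl τ Q (nIx r)) = u P Q) {x : FM K N L}
    (hx : OmC K L τ x) (g : G) : OmC K L τ (prW K w g x) := by
  induction hx generalizing g with
  | vac =>
    by_cases hg : g = 0
    · rw [hg, (wtIn_vF w).prW_eq]; exact OmC.vac
    · rw [not_not.1 (mt (wtIn_vF w g) hg)]; exact OmC.zero
  | om P Q _ ih => rw [(shW_om τ (hw P Q)).apply]; exact (ih _).om P Q
  | add _ _ h1 h2 => rw [map_add]; exact (h1 g).add (h2 g)
  | smul c _ ih => rw [map_smul]; exact (ih g).smul c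

theorem OmC.gU {x : FM K N L} (hx : OmC K L τ x) (P Q : Fin N) : OmC K L τ (gU K τ P Q x) := by
  induction hx with
  | vac => rw [gU_vF]; exact OmC.zero
  | om R S hx ih =>
    rw [← Module.End.mul_apply, gU_om, LinearMap.add_apply, LinearMap.smul_apply,
      Module.End.mul_apply, LinearMap.add_apply]
    refine ((ih.om R S).smul _).add (OmC.add ?_ ?_) <;> split_ifs
    · exact hx.om P S
    · exact OmC.zero
    · exact (hx.om R P).smul _
    · exact OmC.zero
  | add _ _ h1 h2 => rw [map_add]; exact h1.add h2
  | smul c _ ih => rw [map_smul]; exact ih.smul c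

end Diagonal

section Words
variable {K : Type} [Field K] {N L : ℕ} (σ : ℕ → Fin N)

variable (K L) in
/-- A product of quadratic invariants. -/
noncomputable def omL (l : List (ℕ × ℕ)) : Module.End K (FM K N L) :=
  (l.map fun q => om K L tz (σ q.1) (σ q.2)).prod

@[simp] theorem omL_nil : omL K L σ [] = 1 := rfl

@[simp] theorem omL_cons (q : ℕ × ℕ) (l : List (ℕ × ℕ)) :
    omL K L σ (q :: l) = om K L tz (σ q.1) (σ q.2) * omL K L σ l := by simp [omL]

theorem omL_append (l l' : List (ℕ × ℕ)) : omL K L σ (l ++ l') = omL K L σ l * omL K L σ l' := by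
  simp [omL]

theorem om_sq [CharZero K] (P Q : Fin N) : om K L tz P Q * om K L tz P Q = 0 := by
  have h := om_om (K := K) (L := L) P Q P Q
  have h2 : (2 : K) • (om K L tz P Q * om K L tz P Q) = 0 := by
    rw [two_smul]; nth_rewrite 1 [h]; abel
  exact (smul_eq_zero.1 h2).resolve_left two_ne_zero

theorem omL_om (l : List (ℕ × ℕ)) (P Q : Fin N) :
    ∃ ε : K, omL K L σ l * om K L tz P Q = ε • (om K L tz P Q * omL K L σ l) := by
  induction l with
  | nil => exact ⟨1, by simp⟩
  | cons q l ih =>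
    obtain ⟨ε, h⟩ := ih
    refine ⟨-ε, ?_⟩
    rw [omL_cons, mul_assoc, h, mul_smul_comm, ← mul_assoc, om_om, neg_mul, smul_neg, neg_smul,
      mul_assoc]

theorem Dt_om (P R S : Fin N) (t : Ix L) :
    Dt K tz P t * om K L tz R S = sg K t.isRight • (om K L tz R S * Dt K tz P t)
      + ((if P = R then sg K t.isRight • Zt K tz S (nIx t) else 0)
        - if P = S then sg K t.isRight • Zt K tz R (nIx t) else 0) := by
  have h : ∀ r ∈ (Finset.univ : Finset (Ix L)),
      Dt K tz P t * (sg K (r.isRight && !(tz S)) • (Zt K tz R r * Zt K tz S (nIx r)))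
      = sg K t.isRight •
          ((sg K (r.isRight && !(tz S)) • (Zt K tz R r * Zt K tz S (nIx r))) * Dt K tz P t)
        + ((if t = r then (if P = R then sg K t.isRight • Zt K tz S (nIx t) else 0) else 0)
          - if nIx t = r then (if P = S then sg K t.isRight • Zt K tz R (nIx t) else 0) else 0) :=
              by
    intro r _
    rw [push_smul _ (push_mul (Dt_Zt tz P R t r) (Dt_Zt tz P S t (nIx r)))]
    have e : (t = nIx r) ↔ nIx t = r := (nIx_eq_iff t r).symm
    congr 1
    · congr 1
      simp only [pz_tz, nIx_isRight]
      cases t.isRight <;> cases r.isRight <;> simp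
    · simp only [e]
      by_cases h1 : t = r
      · subst h1
        have h2 : nIx t ≠ t := by rintro h; cases t <;> simp [nIx] at h
        by_cases h3 : P = R <;> simp [h2, h3, tz]
      · by_cases h2 : nIx t = r
        · subst h2
          by_cases h3 : P = S
          · simp only [h3, pz_tz, nIx_isRight, tz, h1]
            cases t.isRight <;> simp
          · simp [h3, h1]
        · simp [h1, h2]
  rw [om, push_sum _ h]
  congr 1
  rw [Finset.sum_sub_distrib]
  simp

variable [CharZero K]

theorem omL_mul_of_mem {q : ℕ × ℕ} {l : List (ℕ × ℕ)} (h : q ∈ l) :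
    omL K L σ l * om K L tz (σ q.1) (σ q.2) = 0 := by
  induction l with
  | nil => simp at h
  | cons a l ih =>
    rw [omL_cons, mul_assoc]
    rcases List.mem_cons.1 h with rfl | h
    · obtain ⟨ε, h⟩ := omL_om (K := K) (L := L) σ l (σ q.1) (σ q.2)
      rw [h, mul_smul_comm, ← mul_assoc, om_sq, zero_mul, smul_zero]
    · rw [ih h, mul_zero]

theorem om_mul_of_mem {q : ℕ × ℕ} {l : List (ℕ × ℕ)} (h : q ∈ l) :
    om K L tz (σ q.1) (σ q.2) * omL K L σ l = 0 := by
  induction l with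
  | nil => simp at h
  | cons a l ih =>
    rw [omL_cons, ← mul_assoc]
    rcases List.mem_cons.1 h with rfl | h
    · rw [om_sq, zero_mul]
    · rw [om_om, neg_mul, mul_assoc, ih h, mul_zero, neg_zero]

theorem omL_om_omL {p s l : List (ℕ × ℕ)} {A : ℕ × ℕ} (hl : p ++ A :: s = l) {i j : ℕ}
    (h : (i, j) ∈ l ∨ (j, i) ∈ l ∨ i = j) (h1 : A ≠ (i, j)) (h2 : A ≠ (j, i)) :
    omL K L σ p * (om K L tz (σ i) (σ j) * omL K L σ s) = 0 := by
  have key : ∀ q : ℕ × ℕ, q ∈ l → A ≠ q →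
      omL K L σ p * (om K L tz (σ q.1) (σ q.2) * omL K L σ s) = 0 := by
    intro q hq hA
    rw [← hl, List.mem_append, List.mem_cons] at hq
    rcases hq with hq | rfl | hq
    · rw [← mul_assoc, omL_mul_of_mem σ hq, zero_mul]
    · exact absurd rfl hA
    · rw [om_mul_of_mem σ hq, mul_zero]
  rcases h with h | h | rfl
  · exact key (i, j) h h1
  · rw [om_swap (σ j) (σ i), neg_mul, mul_neg, key (j, i) h h2, neg_zero]
  · rw [om_self, zero_mul, mul_zero]

theorem gU_omL_vF {l : List (ℕ × ℕ)} {a b : ℕ} (hab : a ≠ b)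
    (h1 : ∀ i j, (i, j) ∈ l → σ b = σ i → i = b ∧ ((a, j) ∈ l ∨ (j, a) ∈ l ∨ a = j))
    (h2 : ∀ i j, (i, j) ∈ l → σ b = σ j → j = b ∧ ((i, a) ∈ l ∨ (a, i) ∈ l ∨ i = a)) :
    gU K tz (σ a) (σ b) (omL K L σ l (vF K N L)) = 0 := by
  have key : ∀ s p, p ++ s = l →
      omL K L σ p (gU K tz (σ a) (σ b) (omL K L σ s (vF K N L))) = 0 := by
    intro s
    induction s with
    | nil => intro p _; rw [omL_nil, Module.End.one_apply, gU_vF, map_zero]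
    | cons A s ih =>
      intro p hp
      have hA : A ∈ l := by rw [← hp]; simp
      have e1 := ih (p ++ [A]) (by simpa using hp)
      rw [omL_append, omL_cons, omL_nil, mul_one, Module.End.mul_apply] at e1
      rw [omL_cons, Module.End.mul_apply, ← Module.End.mul_apply (gU K tz (σ a) (σ b)), gU_om,
        LinearMap.add_apply, LinearMap.smul_apply, Module.End.mul_apply, map_add, map_smul, e1,
        smul_zero, zero_add, LinearMap.add_apply, map_add]
      have e2 : omL K L σ p ((if σ b = σ A.1 then om K L tz (σ a) (σ A.2) else 0)
          (omL K L σ s (vF K N L))) = 0 := by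
        split_ifs with h
        · obtain ⟨hb, h3⟩ := h1 A.1 A.2 hA h
          have := omL_om_omL (K := K) (L := L) σ hp h3
            (fun h => hab (by rw [← hb, h])) (fun h => hab (by
              have e3 := congrArg Prod.fst h
              have e4 := congrArg Prod.snd h
              simp only at e3 e4
              rw [← e4, ← hb, e3]))
          exact congrArg (fun T => T (vF K N L)) this
        · rw [LinearMap.zero_apply, map_zero]
      have e3 : omL K L σ p ((if σ b = σ A.2 then om K L tz (σ A.1) (σ a) else 0)
          (omL K L σ s (vF K N L))) = 0 := by
        split_ifs with h
        · obtain ⟨hb, h3⟩ := h2 A.1 A.2 hA h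
          have := omL_om_omL (K := K) (L := L) σ hp h3
            (fun h => hab (by rw [← hb, h])) (fun h => hab (by
              have e3 := congrArg Prod.fst h
              have e4 := congrArg Prod.snd h
              simp only at e3 e4
              rw [← e3, ← hb, e4]))
          exact congrArg (fun T => T (vF K N L)) this
        · rw [LinearMap.zero_apply, map_zero]
      simp only [tz, Bool.and_false, Bool.xor_self, sg_false, one_smul] at e2 e3 ⊢
      rw [e2, e3, add_zero]
  exact key l [] rfl

end Words

section Partition

/-- The cells to the right of the diagonal in rows `a, …, a + n - 1`, of lengths `κ`. -/
def pl (κ : ℕ → ℕ) : ℕ → ℕ → List (ℕ × ℕ)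
  | _, 0 => []
  | a, n + 1 => (List.range (κ a)).map (fun j => (a, a + 1 + j)) ++ pl κ (a + 1) n

theorem mem_pl {κ : ℕ → ℕ} {i j n a : ℕ} :
    (i, j) ∈ pl κ a n ↔ (a ≤ i ∧ i < a + n) ∧ i < j ∧ j ≤ i + κ i := by
  induction n generalizing a with
  | zero => simp only [pl, List.not_mem_nil, false_iff]; omega
  | succ n ih =>
    rw [pl, List.mem_append, ih, List.mem_map]
    constructor
    · rintro (⟨t, ht, h⟩ | h)
      · obtain ⟨rfl, rfl⟩ := Prod.mk.inj h
        rw [List.mem_range] at ht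
        omega
      · omega
    · intro h
      rcases eq_or_ne a i with rfl | hai
      · exact Or.inl ⟨j - a - 1, List.mem_range.2 (by omega), by ext <;> simp; omega⟩
      · exact Or.inr (by omega)

theorem sum_pl {A : Type*} [AddCommMonoid A] (κ : ℕ → ℕ) (f : ℕ × ℕ → A) (n a : ℕ) :
    ((pl κ a n).map f).sum
      = ∑ t ∈ Finset.range n, ∑ j ∈ Finset.range (κ (a + t)), f (a + t, a + t + 1 + j) := by
  induction n generalizing a with
  | zero => simp [pl]
  | succ n ih =>
    rw [pl, List.map_append, List.sum_append, ih, Finset.sum_range_succ', add_comm]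
    congr 1
    · refine Finset.sum_congr rfl fun t _ => ?_
      rw [show a + 1 + t = a + (t + 1) by ring]
    · rw [List.map_map, add_zero]
      exact Multiset.sum_coe _

end Partition

section OddWords
variable {K : Type} [Field K] {N L : ℕ}

variable (K) in
/-- A product of odd variables. -/
noncomputable def wW (W : List (Fin N × Fin L)) : Module.End K (FM K N L) :=
  (W.map fun q => zF q.1 (Sum.inr q.2)).prod

theorem wW_cons (q : Fin N × Fin L) (W : List (Fin N × Fin L)) :
    wW K (q :: W) = zF q.1 (Sum.inr q.2) * wW K W := by simp [wW]

theorem dF_wW_comm (P : Fin N) (e : Fin L) (W : List (Fin N × Fin L)) :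
    dF P (Sum.inl e) * wW K W = wW K W * dF P (Sum.inl e) := by
  induction W with
  | nil => simp [wW]
  | cons q W ih =>
    rw [wW_cons, ← mul_assoc, dF_zF]
    simp only [Sum.isRight_inl, Bool.false_and, sg_false, one_smul, reduceCtorEq, and_false,
      if_false, add_zero]
    rw [mul_assoc, ih, mul_assoc]

theorem dF_wW_vF {q : Fin N × Fin L} {W : List (Fin N × Fin L)} (h : q ∉ W) :
    dF q.1 (Sum.inr q.2) (wW K W (vF K N L)) = 0 := by
  induction W with
  | nil => exact dF_vF _ _
  | cons p W ih =>
    rw [List.mem_cons, not_or] at h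
    rw [wW_cons, ← Module.End.mul_apply, ← mul_assoc, dF_zF, if_neg, add_zero, smul_mul_assoc,
      LinearMap.smul_apply, mul_assoc, Module.End.mul_apply, Module.End.mul_apply, ih h.2, map_zero,
      smul_zero]
    rintro ⟨h1, h2⟩
    exact h.1 (Prod.ext h1 (Sum.inr_injective h2))

theorem wW_vF_ne {W : List (Fin N × Fin L)} (hW : W.Nodup) : wW K W (vF K N L) ≠ 0 := by
  induction W with
  | nil =>
    intro h
    have h1 := congrArg (co (K := K) (fun _ => 0, fun _ => false)) h
    rw [map_zero, wW, List.map_nil, List.prod_nil, Module.End.one_apply, vF_eq, co_bF,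
      if_pos rfl] at h1
    exact one_ne_zero h1
  | cons q W ih =>
    intro h
    rw [List.nodup_cons] at hW
    refine ih hW.2 ?_
    have h1 := congrArg (dF (K := K) q.1 (Sum.inr q.2)) h
    rw [map_zero, wW_cons, ← Module.End.mul_apply, ← mul_assoc, dF_zF, if_pos ⟨rfl, rfl⟩, add_mul,
      one_mul, LinearMap.add_apply, smul_mul_assoc, mul_assoc, LinearMap.smul_apply,
      Module.End.mul_apply, Module.End.mul_apply, dF_wW_vF hW.1, map_zero, smul_zero,
      zero_add] at h1
    exact h1

theorem pow_derivation {M : Type*} [AddCommGroup M] [Module K M] {D A Z : Module.End K M}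
    (h : D * A = A * D + Z) (hZ : D * Z = Z * D) (n : ℕ) :
    D ^ (n + 1) * A = A * D ^ (n + 1) + (n + 1) • (Z * D ^ n) := by
  induction n with
  | zero => simpa using h
  | succ n ih =>
    have e : D * (Z * D ^ n) = Z * D ^ (n + 1) := by rw [← mul_assoc, hZ, mul_assoc, ← pow_succ']
    rw [pow_succ' D (n + 1), mul_assoc, ih, mul_add, ← mul_assoc, h, add_mul, mul_smul_comm, e,
      mul_assoc, add_assoc, ← succ_nsmul']

theorem pow_derivation_prod {M ι : Type*} [AddCommGroup M] [Module K M] {D : Module.End K M}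
    {A Z : ι → Module.End K M} (l : List ι) (h : ∀ i ∈ l, D * A i = A i * D + Z i)
    (hZ : ∀ i ∈ l, D * Z i = Z i * D) {x : M} (hx : D x = 0) :
    (D ^ l.length) ((l.map A).prod x) = l.length.factorial • (l.map Z).prod x := by
  have hc : ∀ l' : List ι, (∀ i ∈ l', i ∈ l) → D ((l'.map Z).prod x) = 0 := by
    intro l'
    induction l' with
    | nil => intro _; exact hx
    | cons i l' ih =>
      intro hl
      rw [List.map_cons, List.prod_cons, Module.End.mul_apply, ← Module.End.mul_apply,
        hZ i (hl i List.mem_cons_self), Module.End.mul_apply,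
        ih fun j hj => hl j (List.mem_cons_of_mem _ hj), map_zero]
  induction l with
  | nil => simp
  | cons i l ih =>
    have h1 := ih (fun j hj => h j (List.mem_cons_of_mem _ hj))
      (fun j hj => hZ j (List.mem_cons_of_mem _ hj))
      (fun l' hl => hc l' fun j hj => List.mem_cons_of_mem _ (hl j hj))
    rw [List.map_cons, List.prod_cons, Module.End.mul_apply, List.length_cons,
      ← Module.End.mul_apply, pow_derivation (h i List.mem_cons_self) (hZ i List.mem_cons_self),
      LinearMap.add_apply, Module.End.mul_apply, pow_succ', Module.End.mul_apply, h1, map_nsmul,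
      hc l fun j hj => List.mem_cons_of_mem _ hj, smul_zero, map_zero, zero_add,
      LinearMap.smul_apply, Module.End.mul_apply, h1, map_nsmul, smul_smul, Nat.factorial_succ,
      List.map_cons, List.prod_cons, Module.End.mul_apply]

variable {σ : ℕ → Fin N} {κ : ℕ → ℕ}

theorem dF_omL_vF {P : Fin N} {l : List (ℕ × ℕ)} (e : Fin L)
    (h : ∀ q ∈ l, P ≠ σ q.1 ∧ P ≠ σ q.2) :
    dF P (Sum.inl e) (omL K L σ l (vF K N L)) = 0 := by
  induction l with
  | nil => exact dF_vF _ _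
  | cons q l ih =>
    have h1 := Dt_om (K := K) P (σ q.1) (σ q.2) (Sum.inl e)
    obtain ⟨h2, h3⟩ := h q List.mem_cons_self
    rw [if_neg h2, if_neg h3, sub_zero, add_zero, Sum.isRight_inl, sg_false, one_smul] at h1
    rw [omL_cons, Module.End.mul_apply]
    refine (congrArg (fun T => T (omL K L σ l (vF K N L))) h1).trans ?_
    refine (congrArg (om K L tz (σ q.1) (σ q.2))
      (ih fun p hp => h p (List.mem_cons_of_mem _ hp))).trans (map_zero _)

theorem omL_pl_ne [CharZero K] {M : ℕ} (hσ : ∀ i j, i < M → j < M → σ i = σ j → i = j) (n a : ℕ)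
    (hn : a + n ≤ L) (hM : ∀ i, a ≤ i → i < a + n → i + κ i < M) (W : List (Fin N × Fin L))
    (hW : W.Nodup) (ha : ∀ q ∈ W, q.2.val < a) :
    wW K W (omL K L σ (pl κ a n) (vF K N L)) ≠ 0 := by
  induction n generalizing a W with
  | zero => exact wW_vF_ne hW
  | succ n ih =>
    intro h0
    set e : Fin L := ⟨a, by omega⟩
    set x := omL K L σ (pl κ (a + 1) n) (vF K N L) with hxdef
    set D : Module.End K (FM K N L) := dF (σ a) (Sum.inl e) with hD
    have haM : a < M := by have := hM a le_rfl (by omega); omega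
    have hx : D x = 0 := by
      refine dF_omL_vF e fun q hq => ?_
      obtain ⟨⟨h1, h2⟩, h3, h4⟩ := mem_pl.1 hq
      have h5 := hM q.1 (by omega) (by omega)
      exact ⟨fun h => by have := hσ _ _ haM (by omega) h; omega,
        fun h => by have := hσ _ _ haM (by omega) h; omega⟩
    have hne : ∀ j < κ a, σ a ≠ σ (a + 1 + j) := fun j hj h => by
      have h5 := hM a le_rfl (by omega)
      have := hσ _ _ haM (by omega) h; omega
    have hd := pow_derivation_prod (D := D)
      (A := fun j => om K L tz (σ a) (σ (a + 1 + j)))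
      (Z := fun j => zF (σ (a + 1 + j)) (Sum.inr e)) (List.range (κ a))
      (fun j hj => by
        have h2 := hne j (List.mem_range.1 hj)
        have h3 := Dt_om (K := K) (σ a) (σ a) (σ (a + 1 + j)) (Sum.inl e)
        rw [if_pos rfl, if_neg h2] at h3
        simp only [Sum.isRight_inl, sg_false, one_smul, sub_zero] at h3
        exact h3)
      (fun j hj => by
        rw [hD, dF_zF]; simp) hx
    rw [List.length_range] at hd
    set W' : List (Fin N × Fin L) := (List.range (κ a)).map fun j => (σ (a + 1 + j), e) with hW'
    refine ih (a + 1) (by omega) (fun i h1 h2 => hM i (by omega) (by omega)) (W ++ W') ?_ ?_ ?_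
    · refine List.nodup_append'.2 ⟨hW, List.Nodup.map_on ?_ List.nodup_range, ?_⟩
      · intro i hi j hj hij
        rw [List.mem_range] at hi hj
        have h5 := hM a le_rfl (by omega)
        have := hσ _ _ (by omega) (by omega) (Prod.ext_iff.1 hij).1
        omega
      · intro q hq hq'
        obtain ⟨j, _, rfl⟩ := List.mem_map.1 hq'
        exact lt_irrefl _ (ha _ hq)
    · intro q hq
      rcases List.mem_append.1 hq with hq | hq
      · exact (ha q hq).trans (Nat.lt_succ_self _)
      · obtain ⟨j, _, rfl⟩ := List.mem_map.1 hq
        exact Nat.lt_succ_self _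
    · have hcomm : Commute D (wW K W) := dF_wW_comm _ _ W
      have h1 := congrArg (D ^ κ a) h0
      rw [map_zero, pl, omL_append, Module.End.mul_apply, ← Module.End.mul_apply,
        (hcomm.pow_left _).eq, Module.End.mul_apply] at h1
      have h2 : omL K L σ ((List.range (κ a)).map fun j => (a, a + 1 + j))
          = ((List.range (κ a)).map fun j => om K L tz (σ a) (σ (a + 1 + j))).prod := by
        rw [omL, List.map_map]; rfl
      rw [h2, hd, map_nsmul, ← Nat.cast_smul_eq_nsmul K] at h1
      have h3 := (smul_eq_zero.1 h1).resolve_left (Nat.cast_ne_zero.2 (Nat.factorial_ne_zero _))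
      have h4 : wW K (W ++ W')
          = wW K W * ((List.range (κ a)).map fun j => zF (σ (a + 1 + j)) (Sum.inr e)).prod := by
        rw [wW, List.map_append, List.prod_append, hW', List.map_map]; rfl
      rw [h4]
      exact h3

end OddWords

section Staircase

theorem wtG_wth {F L : ℕ} (τ : Fin F → Bool) (b : MonB F L) :
    wtG wth b = -∑ r, (pr r : ℤ) * wtG (wV τ) b r := by
  have : ∀ P : Fin F, ∑ r : Ix L, (pr r : ℤ) * (ex b P (fl τ P r) : ℤ)
      = ∑ r : Ix L, (pr r : ℤ) * (ex b P r : ℤ) := fun P => by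
    unfold fl
    split_ifs
    · rw [← sum_nIx]; simp
    · rfl
  simp only [wtG_wV, Finset.mul_sum]
  rw [Finset.sum_comm]
  simp only [this, wtG, wth, ← Finset.sum_neg_distrib]
  refine Finset.sum_congr rfl fun P _ => Finset.sum_congr rfl fun r _ => ?_
  simp [mul_comm]

theorem sum_wV {F L : ℕ} (τ : Fin F → Bool) (b : MonB F L) :
    ∑ r, wtG (wV τ) b r = wtG wdeg b := by
  have : ∀ P : Fin F, ∑ r : Ix L, (ex b P (fl τ P r) : ℤ) = ∑ r : Ix L, (ex b P r : ℤ) :=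
    fun P => by
      unfold fl
      split_ifs
      · exact sum_nIx fun r => (ex b P r : ℤ)
      · rfl
  simp only [wtG_wV]
  rw [Finset.sum_comm]
  simp only [this, wtG, wdeg]
  simp

theorem ex_inr_le {F L : ℕ} (b : MonB F L) (P : Fin F) (e : Fin L) : ex b P (Sum.inr e) ≤ 1 := by
  simp only [ex, Sum.elim_inr]
  split_ifs <;> omega

section Words
variable {K : Type} [Field K] {N L : ℕ} {σ : ℕ → Fin N}

theorem wtIn_omL {G : Type} [AddCommGroup G] {w : Fin N → Ix L → G} {u : Fin N → Fin N → G}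
    (hw : ∀ P Q r, w P r + w Q (nIx r) = u P Q) (l : List (ℕ × ℕ)) :
    WtIn w {(l.map fun q => u (σ q.1) (σ q.2)).sum} (omL K L σ l (vF K N L)) := by
  induction l with
  | nil => exact wtIn_vF w
  | cons q l ih =>
    rw [omL_cons, Module.End.mul_apply]
    refine (ih.shift (shW_om tz (v := u (σ q.1) (σ q.2)) fun r => hw _ _ r)).mono fun g hg => ?_
    rw [List.map_cons, List.sum_cons]
    have hg : g - u (σ q.1) (σ q.2) = _ := hg
    exact (sub_eq_iff_eq_add'.1 hg)

theorem om_eq_of_even {τ τ' : Fin N → Bool} {P Q : Fin N} (hP : τ P = τ' P) (hQ : τ Q = τ' Q) :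
    om K L τ P Q = om K L τ' P Q := by
  simp only [om, Zt, fl, hP, hQ]

theorem gU_eq_of_even {τ τ' : Fin N → Bool} {P Q : Fin N} (hP : τ P = τ' P) (hQ : τ Q = τ' Q) :
    gU K (L := L) τ P Q = gU K τ' P Q := by
  simp only [gU, Zt, Dt, fl, hP, hQ]

theorem omC_omL {τ : Fin N → Bool} (hσ : ∀ i, τ (σ i) = false) (l : List (ℕ × ℕ)) :
    OmC K L τ (omL K L σ l (vF K N L)) := by
  induction l with
  | nil => exact OmC.vac
  | cons q l ih =>
    rw [omL_cons, Module.End.mul_apply,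
      om_eq_of_even (τ := tz) (τ' := τ) (hσ q.1).symm (hσ q.2).symm]
    exact ih.om _ _

end Words

variable {N L : ℕ} {κ : ℕ → ℕ}

theorem single_nonneg_int (P Q : Fin N) : (0 : ℤ) ≤ (Pi.single P 1 : Fin N → ℤ) Q := by
  rw [Pi.single_apply]; split_ifs <;> norm_num

theorem sum_row_ge (hs : ∀ a b, a < b → b < L → 0 < κ b → b + κ b ≤ a + κ a) (σ : ℕ → Fin N)
    {a : ℕ} (ha : a < L) (hk : 0 < κ a) :
    ((a + κ a : ℕ) : ℤ) ≤ ((pl κ 0 L).map fun q =>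
      (Pi.single (σ q.1) 1 + Pi.single (σ q.2) 1 : Fin N → ℤ)).sum (σ a) := by
  rw [sum_pl]
  simp only [Finset.sum_apply, Pi.add_apply, zero_add]
  have hnn : ∀ t j : ℕ, (0 : ℤ) ≤ (Pi.single (σ t) 1 : Fin N → ℤ) (σ a)
      + (Pi.single (σ (t + 1 + j)) 1 : Fin N → ℤ) (σ a) := fun t j =>
    add_nonneg (single_nonneg_int _ _) (single_nonneg_int _ _)
  have h1 : ∀ t < a, (1 : ℤ) ≤ ∑ j ∈ Finset.range (κ t), ((Pi.single (σ t) 1 : Fin N → ℤ) (σ a)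
      + (Pi.single (σ (t + 1 + j)) 1 : Fin N → ℤ) (σ a)) := fun t hta => by
    have h2 := hs t a hta ha hk
    refine le_trans ?_ (Finset.single_le_sum (fun j _ => hnn t j)
      (Finset.mem_range.2 (show a - t - 1 < κ t by omega)))
    rw [show t + 1 + (a - t - 1) = a by omega, Pi.single_eq_same]
    exact le_add_of_nonneg_left (single_nonneg_int _ _)
  have h2 : (κ a : ℤ) ≤ ∑ j ∈ Finset.range (κ a), ((Pi.single (σ a) 1 : Fin N → ℤ) (σ a)
      + (Pi.single (σ (a + 1 + j)) 1 : Fin N → ℤ) (σ a)) := by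
    refine le_trans (by simp) (Finset.card_nsmul_le_sum (Finset.range (κ a)) _ (1 : ℤ)
      fun j _ => ?_)
    rw [Pi.single_eq_same]
    exact le_add_of_nonneg_right (single_nonneg_int _ _)
  refine le_trans ?_ (Finset.sum_le_sum_of_subset_of_nonneg
    (Finset.range_subset_range.2 (show a + 1 ≤ L by omega))
    fun t _ _ => Finset.sum_nonneg fun j _ => hnn t j)
  rw [Finset.sum_range_succ]
  have h3 := Finset.card_nsmul_le_sum (Finset.range a) _ (1 : ℤ)
    fun t ht => h1 t (Finset.mem_range.1 ht)
  simp only [Finset.card_range, nsmul_eq_mul, mul_one] at h3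
  push_cast
  linarith

theorem top_of_omL (σ : ℕ → Fin N) (hσ : ∀ i j, 2 * i < N → 2 * j < N → σ i = σ j → i = j)
    (hev : ∀ i, tm (σ i) = false)
    (hs : ∀ a b, a < b → b < L → 0 < κ b → b + κ b ≤ a + κ a)
    (hM : ∀ i, i < L → 2 * (i + κ i) < N) {t : ℤ}
    (ht : ∀ g, t < g → prW ℚ wth g (omL ℚ L σ (pl κ 0 L) (vF ℚ N L)) = 0) :
    WtIn (wV tm) {fun r => (κ (pr r) : ℤ)}
      (prW ℚ wth t (omL ℚ L σ (pl κ 0 L) (vF ℚ N L))) := by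
  set c := omL ℚ L σ (pl κ 0 L) (vF ℚ N L) with hc
  intro l hl
  set h := prW ℚ (wV tm) l (prW ℚ wth t c) with hh
  have hO : OmC ℚ L tm c := omC_omL hev _
  have hV : HwV L tm h := HwV.prW tm (hwV_top tm (fun r s => hO.pX r s) ht) l
  have hU : ∀ a b : ℕ, a < b → 2 * b < N → gU ℚ tm (σ a) (σ b) h = 0 := by
    intro a b hab hb
    rw [hh, ← (shW_gU_wV tm (σ a) (σ b)).prW_comm, ← (shW_gU_wth tm (σ a) (σ b)).prW_comm,
      gU_eq_of_even (τ := tm) (τ' := tz) (hev a) (hev b), hc, gU_omL_vF σ hab.ne, map_zero,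
          map_zero]
    · intro i j hij h
      obtain ⟨⟨h1, h2⟩, h3, h4⟩ := mem_pl.1 hij
      have h5 := hM i (by omega)
      have h6 := hσ _ _ hb (by omega) h
      subst h6
      have h7 := hs a b hab (by omega) (by omega)
      exact ⟨rfl, Or.inl (mem_pl.2 ⟨by omega, by omega, by omega⟩)⟩
    · intro i j hij h
      obtain ⟨⟨h1, h2⟩, h3, h4⟩ := mem_pl.1 hij
      have h5 := hM i (by omega)
      have h6 := hσ _ _ hb (by omega) h
      subst h6
      refine ⟨rfl, ?_⟩
      rcases lt_trichotomy i a with hia | hia | hia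
      · exact Or.inl (mem_pl.2 ⟨by omega, by omega, by omega⟩)
      · exact Or.inr (Or.inr hia)
      · have h7 := hs a i hia (by omega) (by omega)
        exact Or.inr (Or.inl (mem_pl.2 ⟨by omega, by omega, by omega⟩))
  have hpure : prW ℚ (wV tm) l h = h := prW_prW_self _ _
  have hcd : ∀ i : Fin L, cd (Sum.inl i : Ix L) = 2 * i.val := fun _ => rfl
  have hNL : ∀ i : Fin L, 2 * i.val < N := fun i => by have := hM i i.2; omega
  obtain ⟨b, hb, hb1, hb2⟩ := exists_pivot (τ := tm) (fun i : Fin L => σ i)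
    (fun i => Sum.inl i) (fun i => by simp [pz, hev])
    (fun i j hij => Fin.ext (hσ _ _ (hNL i) (hNL j) hij)) Sum.inl_injective
    (fun i s => 2 * i.val < cd s) (fun i Q => ∃ j : ℕ, i.val < j ∧ 2 * j < N ∧ Q = σ j)
    (fun i j s hij hs h => by
      have hs : 2 * j.val < cd s := hs
      have hij : i.val ≤ j.val := hij
      rw [h, hcd] at hs; omega)
    (fun i j Q hij ⟨q, hq1, hq2, hq3⟩ h => by
      have hij : i.val ≤ j.val := hij
      have := hσ _ _ hq2 (hNL i) (hq3.symm.trans h); omega) hl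
    (fun i s hs => hV.1 _ _ hs) (fun i Q ⟨q, hq1, hq2, hq3⟩ => hq3 ▸ hU _ _ hq1 hq2)
  have hbc : co b c ≠ 0 := co_prW_ne (co_prW_ne hb)
  have hl' : wtG (wV tm) b = l := wtG_of_pure hpure hb
  have hdeg : wtG wdeg b = 2 * ∑ i : Fin L, (κ i : ℤ) := by
    have h1 := (wtIn_omL (K := ℚ) (σ := σ) (w := wdeg) (u := fun _ _ => 2)
      (fun _ _ _ => rfl) (pl κ 0 L)).co hbc
    rw [Set.mem_singleton_iff, sum_pl] at h1
    rw [h1, Finset.mul_sum, Fin.sum_univ_eq_sum_range (fun i => 2 * (κ i : ℤ))]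
    simp [mul_comm]
  have hrow : ∀ a : Fin L, (κ a : ℤ) ≤ l (Sum.inl a) := by
    intro a
    rcases Nat.eq_zero_or_pos (κ a) with h0 | h0
    · rw [h0, ← hl']; exact_mod_cast wtG_wV_nonneg tm b _
    have h1 := (wtIn_omL (K := ℚ) (σ := σ) (w := wU)
      (u := fun P Q => Pi.single P 1 + Pi.single Q 1) (fun _ _ _ => rfl) (pl κ 0 L)).co hbc
    have h2 := sum_row_ge hs σ a.2 h0
    rw [← Set.mem_singleton_iff.1 h1, wtG_wU, Fintype.sum_sum_type] at h2
    have hflr : ∀ (i : Fin L) (r : Ix L), fl tm (σ i) r = r := fun i r => by simp [fl, hev]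
    have h3 : ∀ i : Fin L, i ≠ a → ex b (σ a) (Sum.inl i) = 0 := by
      intro i hia
      rcases lt_or_gt_of_ne hia with hlt | hgt
      · have := hb2 i (σ a) ⟨a, hlt, hNL a, rfl⟩
        rwa [hflr] at this
      · have := hb1 a (Sum.inl i) (by rw [hcd]; have : a.val < i.val := hgt; omega)
        rwa [hflr] at this
    have h4 : ∑ i : Fin L, (ex b (σ a) (Sum.inl i) : ℤ) = ex b (σ a) (Sum.inl a) :=
      Finset.sum_eq_single a (fun i _ hi => by rw [h3 i hi]; rfl) (by simp)
    have h5 : ∑ i : Fin L, (ex b (σ a) (Sum.inr i) : ℤ) ≤ a := by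
      have : ∀ i : Fin L, (ex b (σ a) (Sum.inr i) : ℤ) ≤ if i < a then 1 else 0 := by
        intro i
        split_ifs with h
        · exact_mod_cast ex_inr_le b _ i
        · have := hb1 a (Sum.inr i) (by
            have e : cd (Sum.inr i : Ix L) = 2 * i.val + 1 := rfl
            have : a.val ≤ i.val := not_lt.1 h
            omega)
          rw [hflr] at this
          rw [this]; rfl
      refine (Finset.sum_le_sum fun i _ => this i).trans ?_
      rw [Finset.sum_boole, Finset.filter_gt_eq_Iio, Fin.card_Iio]
    have h6 : (ex b (σ a) (Sum.inl a) : ℤ) ≤ l (Sum.inl a) := by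
      rw [← hl', wtG_wV]
      have := Finset.single_le_sum (f := fun P => (ex b P (fl tm P (Sum.inl a)) : ℤ))
        (fun P _ => Int.natCast_nonneg _) (Finset.mem_univ (σ a))
      simpa only [hflr] using this
    push_cast at h2
    linarith
  have hbal := hV.balanced tm hl hpure
  have hsum : ∑ i : Fin L, (κ i : ℤ) = ∑ i : Fin L, l (Sum.inl i) := by
    have h1 := sum_wV tm b
    rw [hl', Fintype.sum_sum_type, hdeg] at h1
    simp only [hbal] at h1
    linarith
  have heq := (Finset.sum_eq_sum_iff_of_le fun i _ => hrow i).1 hsum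
  rw [Set.mem_singleton_iff]
  funext r
  rcases r with a | a
  · exact (heq a (Finset.mem_univ a)).symm
  · exact (hbal a).trans (heq a (Finset.mem_univ a)).symm

end Staircase

section FFT
variable {K : Type} [Field K] {N L : ℕ}

theorem mem_of_prW {G : Type} [AddCommGroup G] (w : Fin N → Ix L → G) {S : Submodule K (FM K N L)}
    {x : FM K N L} (h : ∀ g, prW K w g x ∈ S) : x ∈ S := by
  classical
  have hx : x = ∑ g ∈ (finite_weights w x).toFinset, prW K w g x := by
    refine FM_ext fun b => ?_
    rw [map_sum]
    simp only [co_prW]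
    rw [Finset.sum_ite_eq]
    split_ifs with hb
    · rfl
    · by_contra hne
      refine hb ((Set.Finite.mem_toFinset _).2 fun h0 => hne ?_)
      exact prW_eq_zero_iff.1 h0 b rfl
  rw [hx]
  exact S.sum_mem fun g _ => h g

theorem shW_pX_wU (τ : Fin N → Bool) (r s : Ix L) : ShW wU (pX K τ r s) 0 :=
  (shW_gV_wU τ r s).add ((shW_gV_wU τ _ _).smul _)

theorem prW_comm_prW {G G' : Type} [AddCommGroup G] [AddCommGroup G'] (w : Fin N → Ix L → G)
    (w' : Fin N → Ix L → G') (g : G) (g' : G') (x : FM K N L) :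
    prW K w g (prW K w' g' x) = prW K w' g' (prW K w g x) :=
  (shW_prW w w' g').prW_comm g x

theorem HwU.prW {τ : Fin N → Bool} {x : FM K N L} (hx : HwU τ x) {G : Type} [AddCommGroup G]
    (w : Fin N → Ix L → G) (v : Fin N → Fin N → G)
    (hw : ∀ P Q, ShW w (gU K (L := L) τ P Q) (v P Q)) (g : G) : HwU τ (prW K w g x) := by
  intro P Q hPQ
  have := (hw P Q).apply (g + v P Q) x
  rw [add_sub_cancel_right, hx P Q hPQ, map_zero] at this
  exact this.symm

theorem pX_gU_apply {τ : Fin N → Bool} {x : FM K N L} (hx : ∀ r s, pX K τ r s x = 0) (P Q : Fin N)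
    (r s : Ix L) : pX K τ r s (gU K τ P Q x) = 0 := by
  rw [← Module.End.mul_apply, pX_gU, LinearMap.smul_apply, Module.End.mul_apply, hx, map_zero,
    smul_zero]

theorem exists_diag_of_inv [CharZero K] (hN : 2 * L ≤ N) {x : FM K N L} (h0 : x ≠ 0)
    (hx : ∀ r s, pX K tm r s x = 0) (hU : HwU tm x) :
    ∃ t k b, IsDiag b ∧ HwV L tm (prW K (wV tm) k (prW K wth t x)) ∧
      co b (prW K (wV tm) k (prW K wth t x)) ≠ 0 := by
  obtain ⟨t, ht, htop⟩ := exists_top wth h0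
  obtain ⟨k, hk⟩ : ∃ k, prW K (wV tm) k (prW K wth t x) ≠ 0 := by
    by_contra! h
    exact ht (eq_zero_of_prW _ h)
  have hV := (hwV_top tm hx htop).prW tm k
  obtain ⟨b, hb, hd⟩ := exists_diag hN hk hV
    ((hU.prW wth (fun _ _ => 0) (shW_gU_wth tm) t).prW (wV tm) (fun _ _ => 0) (shW_gU_wV tm) k)
  exact ⟨t, k, b, hd, hV, hb⟩

end FFT

section Rational
variable {N L : ℕ}

variable (N L) in
/-- The invariants of degree `d`. -/
noncomputable def invS (d : ℤ) : Submodule ℚ (FM ℚ N L) where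
  carrier := {x | (∀ r s, pX ℚ tm r s x = 0) ∧ prW ℚ wdeg d x = x}
  add_mem' hx hy := ⟨fun r s => by rw [map_add, hx.1, hy.1, add_zero],
    by rw [map_add, hx.2, hy.2]⟩
  zero_mem' := ⟨fun r s => map_zero _, map_zero _⟩
  smul_mem' c x hx := ⟨fun r s => by rw [map_smul, hx.1, smul_zero], by rw [map_smul, hx.2]⟩

variable (N L) in
/-- The products of quadratic invariants whose top component is pure of weight `k`. -/
noncomputable def topS (d t : ℤ) (k : Ix L → ℤ) : Submodule ℚ (FM ℚ N L) where
  carrier := {x | OmC ℚ L tm x ∧ prW ℚ wdeg d x = x ∧ (∀ g, t < g → prW ℚ wth g x = 0) ∧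
    prW ℚ (wV tm) k (prW ℚ wth t x) = prW ℚ wth t x}
  add_mem' hx hy := ⟨hx.1.add hy.1, by rw [map_add, hx.2.1, hy.2.1],
    fun g hg => by rw [map_add, hx.2.2.1 g hg, hy.2.2.1 g hg, add_zero],
    by rw [map_add, map_add, hx.2.2.2, hy.2.2.2]⟩
  zero_mem' := ⟨OmC.zero, map_zero _, fun _ _ => map_zero _, by simp⟩
  smul_mem' c x hx := ⟨hx.1.smul c, by rw [map_smul, hx.2.1],
    fun g hg => by rw [map_smul, hx.2.2.1 g hg, smul_zero],
    by rw [map_smul, map_smul, hx.2.2.2]⟩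

theorem gU_mem_topS {d t : ℤ} {k : Ix L → ℤ} {x : FM ℚ N L} (hx : x ∈ topS N L d t k)
    (P Q : Fin N) : gU ℚ tm P Q x ∈ topS N L d t k :=
  ⟨hx.1.gU P Q, by rw [(shW_gU_wdeg tm P Q).prW_comm, hx.2.1],
    fun g hg => by rw [(shW_gU_wth tm P Q).prW_comm, hx.2.2.1 g hg, map_zero],
    by rw [(shW_gU_wth tm P Q).prW_comm, (shW_gU_wV tm P Q).prW_comm, hx.2.2.2]⟩

/-- A product of quadratic invariants with prescribed top component. -/
theorem exists_topS {d t : ℤ} {k : Ix L → ℤ} (h0N : 0 < N) (hN : 2 * (L + d) ≤ N)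
    {h : FM ℚ N L} (h0 : h ≠ 0) (hV : HwV L tm h) (hk : prW ℚ (wV tm) k h = h)
    (ht : prW ℚ wth t h = h) (hd : prW ℚ wdeg d h = h) :
    ∃ c ∈ topS N L d t k, prW ℚ wth t c ≠ 0 := by
  obtain ⟨b, hb⟩ := exists_co_ne h0
  have hkb := wtG_of_pure hk hb
  have htb := wtG_of_pure ht hb
  have hdb := wtG_of_pure hd hb
  have hnn : ∀ r, 0 ≤ k r := fun r => hkb ▸ wtG_wV_nonneg tm b r
  have hbal := hV.balanced tm h0 hk
  set κ : ℕ → ℕ := fun i => if hi : i < L then (k (Sum.inl ⟨i, hi⟩)).toNat else 0 with hκ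
  have hκ1 : ∀ i : Fin L, (κ i : ℤ) = k (Sum.inl i) := fun i => by
    simp only [hκ, i.2, dif_pos]
    exact Int.toNat_of_nonneg (hnn _)
  have hκk : (fun r => (κ (pr r) : ℤ)) = k := by
    funext r
    rcases r with a | a
    · exact hκ1 a
    · exact (hκ1 a).trans (hbal a).symm
  have hkd : ∑ r, k r = d := by rw [← hkb, sum_wV, hdb]
  have hs : ∀ a b, a < b → b < L → 0 < κ b → b + κ b ≤ a + κ a := by
    intro a b hab hb hpos
    have h1 := hκ1 ⟨a, hab.trans hb⟩
    have h2 := hκ1 ⟨b, hb⟩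
    have h3 := hV.add_le tm h0 hk (a := ⟨a, hab.trans hb⟩) (b := ⟨b, hb⟩) hab (by
      rw [← h2]; exact_mod_cast hpos)
    rw [← h1, ← h2] at h3
    exact_mod_cast h3
  have hM : ∀ i, i < L → 2 * (i + κ i) < N := by
    intro i hi
    have h1 := hκ1 ⟨i, hi⟩
    have h2 : k (Sum.inl ⟨i, hi⟩) ≤ d :=
      hkd ▸ Finset.single_le_sum (fun r _ => hnn r) (Finset.mem_univ _)
    simp only at h1
    omega
  set σ : ℕ → Fin N := fun i => if hi : 2 * i < N then ⟨2 * i, hi⟩ else ⟨0, h0N⟩ with hσdef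
  have hσ : ∀ i j, 2 * i < N → 2 * j < N → σ i = σ j → i = j := by
    intro i j hi hj hij
    simp only [hσdef, hi, hj, dif_pos] at hij
    have := Fin.mk.inj hij
    omega
  have hev : ∀ i, tm (σ i) = false := by
    intro i
    simp only [hσdef, tm]
    split_ifs <;> simp
  set c := omL ℚ L σ (pl κ 0 L) (vF ℚ N L) with hc
  have hc0 : c ≠ 0 := by
    have := omL_pl_ne (K := ℚ) (L := L) (κ := κ) (σ := σ) (M := (N + 1) / 2)
      (fun i j hi hj => hσ i j (by omega) (by omega)) L 0 (by omega)
      (fun i _ hi => by have := hM i (by omega); omega) [] List.nodup_nil (by simp)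
    simpa [wW] using this
  obtain ⟨t', ht', htop⟩ := exists_top wth hc0
  have hpure := top_of_omL σ hσ hev hs hM htop
  rw [hκk] at hpure
  obtain ⟨b', hb'⟩ := exists_co_ne ht'
  have hkb' : wtG (wV tm) b' = k := hpure.co hb'
  have hteq : t' = t := by
    rw [← htb, wtG_wth tm, hkb, ← hkb', ← wtG_wth tm]
    exact (wtG_of_pure (prW_prW_self _ _) hb').symm
  subst hteq
  have hdc := wtIn_omL (K := ℚ) (σ := σ) (w := wdeg) (u := fun _ _ => 2)
      (fun (_ _ : Fin N) (_ : Ix L) => rfl) (pl κ 0 L)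
  have hdd := Set.mem_singleton_iff.1 (hdc.co (co_prW_ne hb'))
  rw [← sum_wV tm, hkb', hkd] at hdd
  rw [← hdd] at hdc
  exact ⟨c, ⟨omC_omL hev _, hdc.prW_eq, htop, hpure.prW_eq⟩, ht'⟩

theorem omC_of_invariant {d : ℤ} (h0N : 0 < N) (hN : 2 * (L + d) ≤ N) {f : FM ℚ N L}
    (hf : ∀ r s, pX ℚ tm r s f = 0) (hd : prW ℚ wdeg d f = f) : OmC ℚ L tm f := by
  by_contra hO
  have hd0 : 0 ≤ d := by
    obtain ⟨b, hb⟩ := exists_co_ne (x := f) fun h => hO (h ▸ OmC.zero)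
    rw [← wtG_of_pure hd hb]
    exact wtG_nonneg (fun _ _ => zero_le_one) b
  have hNL : 2 * L ≤ N := by omega
  obtain ⟨y, ⟨hy1, hy2⟩, hy3, hy4⟩ := exists_raised_notMem (τ := tm) (d := d)
    (Y := invS N L d) (Y' := invS N L d ⊓ omS ℚ L tm) inf_le_left (fun x hx => hx.2)
    (fun P Q x hx => ⟨pX_gU_apply hx.1 P Q, by rw [(shW_gU_wdeg tm P Q).prW_comm, hx.2]⟩)
    (fun P Q x hx => ⟨⟨pX_gU_apply hx.1.1 P Q, by rw [(shW_gU_wdeg tm P Q).prW_comm, hx.1.2]⟩,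
      OmC.gU hx.2 P Q⟩) (x := f) ⟨hf, hd⟩ (fun h => hO h.2)
  have hyO : y ∉ omS ℚ L tm := fun h => hy3 ⟨⟨hy1, hy2⟩, h⟩
  obtain ⟨u, hu⟩ : ∃ u, prW ℚ wU u y ∉ omS ℚ L tm := by
    by_contra! h
    exact hyO (mem_of_prW wU h)
  set x := prW ℚ wU u y with hxdef
  have hx0 : x ≠ 0 := fun h => hu (h ▸ (omS ℚ L tm).zero_mem)
  have hxI : ∀ r s, pX ℚ tm r s x = 0 := fun r s => by
    rw [hxdef, ← (shW_pX_wU tm r s).prW_comm, hy1, map_zero]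
  have hxU : HwU tm x := HwU.prW (τ := tm) hy4 wU _ (shW_gU_wU tm) u
  have hxd : prW ℚ wdeg d x = x := by rw [hxdef, prW_comm_prW, hy2]
  have hxu : prW ℚ wU u x = x := prW_prW_self _ _
  obtain ⟨t, k, b, hbd, hV, hb⟩ := exists_diag_of_inv hNL hx0 hxI hxU
  have hbx : co b x ≠ 0 := co_prW_ne (co_prW_ne hb)
  have hkb : wtG (wV tm) b = k := wtG_of_pure (prW_prW_self _ _) hb
  obtain ⟨c, hc, hct⟩ := exists_topS (d := d) (t := t) h0N hN
    (fun h => hb (by rw [h, map_zero])) hV (prW_prW_self _ _)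
    (by rw [prW_comm_prW, prW_prW_self])
    (by rw [prW_comm_prW, prW_comm_prW wdeg wth, hxd])
  obtain ⟨z, hz, hz', hzU⟩ := exists_raised_notMem (τ := tm) (d := d)
    (Y := topS N L d t k) (Y' := topS N L d t k ⊓ LinearMap.ker (prW ℚ wth t)) inf_le_left
    (fun x hx => hx.2.1) (fun P Q x hx => gU_mem_topS hx P Q)
    (fun P Q x hx => ⟨gU_mem_topS hx.1 P Q, by
      show prW ℚ wth t (gU ℚ tm P Q x) = 0
      rw [(shW_gU_wth tm P Q).prW_comm, LinearMap.mem_ker.1 hx.2, map_zero]⟩)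
    (x := c) hc (fun h => hct h.2)
  have hzt : prW ℚ wth t z ≠ 0 := fun h => hz' ⟨hz, h⟩
  have hzI : ∀ r s, pX ℚ tm r s z = 0 := fun r s => hz.1.pX r s
  obtain ⟨b', hb', hbd'⟩ := exists_diag hNL hzt (hwV_top tm hzI hz.2.2.1)
    (HwU.prW (τ := tm) hzU wth (fun _ _ => 0) (shW_gU_wth tm) t)
  have hbb : b' = b := hbd'.eq_of_wV hbd ((wtG_of_pure hz.2.2.2 hb').trans hkb.symm)
  rw [hbb] at hb'
  have hub : wtG wU b = u := wtG_of_pure hxu hbx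
  set v := prW ℚ wU u z with hvdef
  have hbv : co b v ≠ 0 := by
    classical
    rw [hvdef, co_prW, if_pos hub]
    exact co_prW_ne hb'
  have hvO : OmC ℚ L tm v := hz.1.prW (w := wU) (u := fun P Q => Pi.single P 1 + Pi.single Q 1)
    (fun _ _ _ => rfl) u
  have hvU : HwU tm v := HwU.prW (τ := tm) hzU wU _ (shW_gU_wU tm) u
  set g := x - (co b x / co b v) • v with hg
  have hg0 : g ≠ 0 := fun h => hu (by
    rw [sub_eq_zero.1 h]
    exact hvO.smul _)
  obtain ⟨t₁, k₁, b₁, hbd₁, -, hb₁⟩ := exists_diag_of_inv hNL hg0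
    (fun r s => by rw [hg, map_sub, map_smul, hxI, hvO.pX, smul_zero, sub_zero])
    (fun P Q hPQ => by rw [hg, map_sub, map_smul, hxU P Q hPQ, hvU P Q hPQ, smul_zero, sub_zero])
  have hbg : co b₁ g ≠ 0 := co_prW_ne (co_prW_ne hb₁)
  have hgu : prW ℚ wU u g = g := by
    rw [hg, map_sub, map_smul, hxu, hvdef, prW_prW_self]
  have : b₁ = b := hbd₁.eq_of_wU hbd ((wtG_of_pure hgu hbg).trans hub.symm)
  refine hbg ?_
  rw [this, hg, map_sub, map_smul, smul_eq_mul, div_mul_cancel₀ _ hbv, sub_self]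

end Rational

section BaseChange

variable {K K' : Type} [Field K] [Field K'] {N L : ℕ}

/-- The map on Fock spaces applying an additive map to all coefficients. -/
noncomputable def mapF (φ : K →+ K') : FM K N L →+ FM K' N L :=
  (Finsupp.mapRange.addMonoidHom φ : (MonB N L →₀ K) →+ (MonB N L →₀ K'))

theorem co_mapF (φ : K →+ K') (b : MonB N L) (x : FM K N L) : co b (mapF φ x) = φ (co b x) :=
  Finsupp.mapRange_apply (hf := map_zero φ) (a := b)

theorem mapF_smul_bF (φ : K →+ K') (c : K) (b : MonB N L) :
    mapF φ (c • bF K b) = φ c • bF K' b :=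
  FM_ext fun d => by
    rw [co_mapF, LinearMap.map_smul, LinearMap.map_smul, co_bF, co_bF]
    split_ifs <;> simp

theorem FM_addHom_ext {A : Type*} [AddCommGroup A] {T T' : FM K N L →+ A}
    (h : ∀ (c : K) b, T (c • bF K b) = T' (c • bF K b)) : T = T' :=
  Finsupp.addHom_ext (α := MonB N L) (M := K) fun b c => by
    have : (Finsupp.single b c : MonB N L →₀ K) = (c • bF K b : FM K N L) :=
      (Finsupp.smul_single_one b c).symm
    exact this ▸ h c b

theorem zF_bF_int (p : Fin N) (r : Ix L) (b : MonB N L) : ∃ (e : ℤ) (b' : MonB N L),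
    ∀ (K : Type) [Field K], zF p r (bF K b) = (e : K) • bF K b' := by
  cases r with
  | inl j => exact ⟨1, _, fun K _ => by rw [Int.cast_one, one_smul]; exact zE_bvec p j b⟩
  | inr j =>
    by_cases h : b.2 (p, j)
    · exact ⟨0, b, fun K _ => by
        rw [Int.cast_zero, zero_smul]
        exact (zO_bvec p j b).trans (if_pos h)⟩
    · exact ⟨(-1) ^ oddBefore b.2 (p, j), _, fun K _ => by
        rw [Int.cast_pow, Int.cast_neg, Int.cast_one]
        exact (zO_bvec p j b).trans (if_neg h)⟩

theorem dF_bF_int (p : Fin N) (r : Ix L) (b : MonB N L) : ∃ (e : ℤ) (b' : MonB N L),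
    ∀ (K : Type) [Field K], dF p r (bF K b) = (e : K) • bF K b' := by
  cases r with
  | inl j => exact ⟨b.1 (p, j), _, fun K _ => by rw [Int.cast_natCast]; exact dE_bvec p j b⟩
  | inr j =>
    by_cases h : b.2 (p, j)
    · exact ⟨(-1) ^ oddBefore b.2 (p, j), _, fun K _ => by
        rw [Int.cast_pow, Int.cast_neg, Int.cast_one]
        exact (dO_bvec p j b).trans (if_pos h)⟩
    · exact ⟨0, b, fun K _ => by
        rw [Int.cast_zero, zero_smul]
        exact (dO_bvec p j b).trans (if_neg h)⟩

/-- An operator with integral coefficients commutes with changes of coefficients. -/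
theorem mapF_comm (φ : K →+ K') {T : Module.End K (FM K N L)} {T' : Module.End K' (FM K' N L)}
    (h : ∀ b, ∃ (e : ℤ) (b' : MonB N L), T (bF K b) = (e : K) • bF K b' ∧
      T' (bF K' b) = (e : K') • bF K' b') (x : FM K N L) : mapF φ (T x) = T' (mapF φ x) := by
  refine DFunLike.congr_fun (f := (mapF φ).comp T.toAddMonoidHom)
    (g := T'.toAddMonoidHom.comp (mapF φ)) (FM_addHom_ext fun c b => ?_) x
  obtain ⟨e, b', h1, h2⟩ := h b
  change mapF φ (T (c • bF K b)) = T' (mapF φ (c • bF K b))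
  rw [map_smul, h1, smul_smul, mapF_smul_bF, mapF_smul_bF, map_smul, h2, smul_smul,
    mul_comm c, ← zsmul_eq_mul, map_zsmul, zsmul_eq_mul, mul_comm]

theorem mapF_zF (φ : K →+ K') (p : Fin N) (r : Ix L) (x : FM K N L) :
    mapF φ (zF p r x) = zF p r (mapF φ x) :=
  mapF_comm φ (fun b => by
    obtain ⟨e, b', h⟩ := zF_bF_int p r b
    exact ⟨e, b', h K, h K'⟩) x

theorem mapF_dF (φ : K →+ K') (p : Fin N) (r : Ix L) (x : FM K N L) :
    mapF φ (dF p r x) = dF p r (mapF φ x) :=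
  mapF_comm φ (fun b => by
    obtain ⟨e, b', h⟩ := dF_bF_int p r b
    exact ⟨e, b', h K, h K'⟩) x

theorem mapF_sg (φ : K →+ K') (b : Bool) (x : FM K N L) :
    mapF φ (sg K b • x) = sg K' b • mapF φ x := by
  cases b <;> simp

theorem mapF_gV (φ : K →+ K') (τ : Fin N → Bool) (r s : Ix L) (x : FM K N L) :
    mapF φ (gV K τ r s x) = gV K' τ r s (mapF φ x) := by
  simp only [gV, LinearMap.sum_apply, map_sum, LinearMap.smul_apply, mapF_sg, Module.End.mul_apply,
    Zt, Dt, mapF_zF, mapF_dF]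

theorem mapF_pX (φ : K →+ K') (τ : Fin N → Bool) (r s : Ix L) (x : FM K N L) :
    mapF φ (pX K τ r s x) = pX K' τ r s (mapF φ x) := by
  simp only [pX, etaP, LinearMap.add_apply, LinearMap.smul_apply, map_add, mapF_sg, mapF_gV]

theorem mapF_om (φ : K →+ K') (τ : Fin N → Bool) (P Q : Fin N) (x : FM K N L) :
    mapF φ (om K L τ P Q x) = om K' L τ P Q (mapF φ x) := by
  simp only [om, LinearMap.sum_apply, map_sum, LinearMap.smul_apply, mapF_sg, Module.End.mul_apply,
    Zt, mapF_zF]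

theorem mapF_prW {G : Type} [AddCommGroup G] (φ : K →+ K') (w : Fin N → Ix L → G) (g : G)
    (x : FM K N L) : mapF φ (prW K w g x) = prW K' w g (mapF φ x) :=
  FM_ext fun b => by
    classical
    rw [co_mapF, co_prW, co_prW, co_mapF]
    split_ifs
    · rfl
    · exact map_zero φ

theorem mapF_vF (φ : K →+ K') : mapF φ (vF K N L) = φ 1 • vF K' N L := by
  rw [vF_eq, vF_eq, ← mapF_smul_bF, one_smul]

variable [CharZero K]

theorem OmC.map_rat {τ : Fin N → Bool} {x : FM ℚ N L} (hx : OmC ℚ L τ x) :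
    OmC K L τ (mapF (Rat.castHom K).toAddMonoidHom x) := by
  induction hx with
  | vac => rw [mapF_vF]; exact OmC.vac.smul _
  | om P Q _ ih => rw [mapF_om]; exact ih.om P Q
  | add _ _ ih ih' => rw [map_add]; exact ih.add ih'
  | @smul c x _ ih =>
    have : mapF (Rat.castHom K).toAddMonoidHom (c • x) =
        (c : K) • mapF (Rat.castHom K).toAddMonoidHom x :=
      FM_ext fun b => by
        rw [co_mapF, LinearMap.map_smul, LinearMap.map_smul, co_mapF, smul_eq_mul, smul_eq_mul]
        exact map_mul (Rat.castHom K) _ _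
    rw [this]
    exact ih.smul _

/-- The first fundamental theorem of invariant theory for `p(L)`. -/
theorem omC_of_inv {d : ℤ} (h0N : 0 < N) (hN : 2 * (L + d) ≤ N) {f : FM K N L}
    (hf : ∀ r s, pX K tm r s f = 0) (hd : prW K wdeg d f = f) : OmC K L tm f := by
  classical
  let B := Module.Free.chooseBasis ℚ K
  let s : Finset (Module.Free.ChooseBasisIndex ℚ K) :=
    (finite_support f).toFinset.biUnion fun b => (B.repr (co b f)).support
  let φ i : K →+ ℚ := (B.coord i).toAddMonoidHom
  have hsum : f = ∑ i ∈ s, B i • mapF (Rat.castHom K).toAddMonoidHom (mapF (φ i) f) := by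
    refine FM_ext fun b => ?_
    rw [map_sum]
    have h1 : ∀ i ∈ s, co b (B i • mapF (Rat.castHom K).toAddMonoidHom (mapF (φ i) f)) =
        B.repr (co b f) i • B i := fun i _ => by
      rw [LinearMap.map_smul, co_mapF, co_mapF, smul_eq_mul, mul_comm, Algebra.smul_def (R := ℚ)]
      rfl
    rw [Finset.sum_congr rfl h1]
    conv_lhs => rw [← B.linearCombination_repr (co b f)]
    refine Finsupp.sum_of_support_subset _ (fun i hi => ?_) _ (fun _ _ => zero_smul _ _)
    refine Finset.mem_biUnion.2 ⟨b, (finite_support f).mem_toFinset.2 fun h => ?_, hi⟩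
    rw [h, map_zero] at hi
    simp at hi
  rw [hsum]
  refine OmC.sum _ fun i _ => (OmC.map_rat ?_).smul _
  refine omC_of_invariant h0N hN (fun r s => ?_) ?_
  · rw [← mapF_pX, hf, map_zero]
  · rw [← mapF_prW, hd]

end BaseChange

section Levels

variable {K : Type} [Field K] {A : Type}
  {M M' : Type} [AddCommGroup M] [Module K M] [AddCommGroup M'] [Module K M']

/-- The vectors obtained from the vacuum by applying `d` creation operators. -/
def lev (Z : A → Module.End K M) (v : M) : ℕ → Submodule K M
  | 0 => Submodule.span K {v}
  | d + 1 => ⨆ a, (lev Z v d).map (Z a)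

variable {p : A → Bool} {Z D : A → Module.End K M} {v : M}

theorem mem_lev_succ {d : ℕ} {x : M} (hx : x ∈ lev Z v d) (a : A) : Z a x ∈ lev Z v (d + 1) :=
  Submodule.mem_iSup_of_mem a (Submodule.mem_map_of_mem hx)

theorem lev_succ_induction {d : ℕ} {C : Submodule K M}
    (h : ∀ a, ∀ x ∈ lev Z v d, Z a x ∈ C) {x : M} (hx : x ∈ lev Z v (d + 1)) : x ∈ C := by
  have : lev Z v (d + 1) ≤ C := iSup_le fun a => by
    rintro _ ⟨y, hy, rfl⟩
    exact h a y hy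
  exact this hx

variable {Z' D' : A → Module.End K M'} {v' : M'}

variable (Z v Z' v') in
/-- The correspondence between two Fock spaces. -/
def relL (d : ℕ) : Submodule K (M × M') := lev (fun a => (Z a).prodMap (Z' a)) (v, v') d

theorem fst_mem_lev {d : ℕ} {x : M × M'} (hx : x ∈ relL Z v Z' v' d) : x.1 ∈ lev Z v d := by
  induction d generalizing x with
  | zero =>
    obtain ⟨c, rfl⟩ := Submodule.mem_span_singleton.1 hx
    exact Submodule.smul_mem _ c (Submodule.mem_span_singleton_self v)
  | succ d ih =>
    exact lev_succ_induction (C := (lev Z v (d + 1)).comap (LinearMap.fst K M M'))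
      (fun a y hy => mem_lev_succ (ih hy) a) hx

theorem snd_mem_lev {d : ℕ} {x : M × M'} (hx : x ∈ relL Z v Z' v' d) : x.2 ∈ lev Z' v' d := by
  induction d generalizing x with
  | zero =>
    obtain ⟨c, rfl⟩ := Submodule.mem_span_singleton.1 hx
    exact Submodule.smul_mem _ c (Submodule.mem_span_singleton_self v')
  | succ d ih =>
    exact lev_succ_induction (C := (lev Z' v' (d + 1)).comap (LinearMap.snd K M M'))
      (fun a y hy => mem_lev_succ (ih hy) a) hx

theorem exists_relL {d : ℕ} {y : M'} (hy : y ∈ lev Z' v' d) : ∃ x, (x, y) ∈ relL Z v Z' v' d := by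
  suffices h : y ∈ (relL Z v Z' v' d).map (LinearMap.snd K M M') by
    obtain ⟨⟨x, y'⟩, h1, h2⟩ := h
    have h2 : y' = y := h2
    exact ⟨x, h2 ▸ h1⟩
  induction d generalizing y with
  | zero =>
    obtain ⟨c, rfl⟩ := Submodule.mem_span_singleton.1 hy
    exact ⟨c • (v, v'), Submodule.smul_mem _ c (Submodule.mem_span_singleton_self _), rfl⟩
  | succ d ih =>
    refine lev_succ_induction (fun a y hy => ?_) hy
    obtain ⟨x, hx, rfl⟩ := ih hy
    exact ⟨_, mem_lev_succ hx a, rfl⟩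

variable [DecidableEq A]

/-- The canonical supercommutation relations together with a vacuum vector. -/
structure IsCCR (p : A → Bool) (Z D : A → Module.End K M) (v : M) : Prop where
  zz : ∀ a b, Z a * Z b = sg K (p a && p b) • (Z b * Z a)
  dd : ∀ a b, D a * D b = sg K (p a && p b) • (D b * D a)
  dz : ∀ a b, D a * Z b = sg K (p a && p b) • (Z b * D a) + if a = b then 1 else 0
  dv : ∀ a, D a v = 0

theorem IsCCR.dz_apply (h : IsCCR p Z D v) (a b : A) (x : M) :
    D a (Z b x) = sg K (p a && p b) • Z b (D a x) + if a = b then x else 0 := by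
  have := LinearMap.congr_fun (h.dz a b) x
  rw [Module.End.mul_apply] at this
  rw [this]
  split_ifs <;> simp

theorem IsCCR.dzero (h : IsCCR p Z D v) (a : A) {x : M} (hx : x ∈ lev Z v 0) : D a x = 0 := by
  obtain ⟨c, rfl⟩ := Submodule.mem_span_singleton.1 hx
  rw [map_smul, h.dv, smul_zero]

theorem IsCCR.dsucc (h : IsCCR p Z D v) (a : A) : ∀ (d : ℕ) {x : M}, x ∈ lev Z v (d + 1) →
    D a x ∈ lev Z v d := by
  intro d
  induction d with
  | zero =>
    intro x hx
    refine lev_succ_induction (C := (lev Z v 0).comap (D a)) (fun b y hy => ?_) hx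
    rw [Submodule.mem_comap, h.dz_apply, h.dzero a hy, map_zero, smul_zero, zero_add]
    split_ifs
    · exact hy
    · exact zero_mem _
  | succ d ih =>
    intro x hx
    refine lev_succ_induction (C := (lev Z v (d + 1)).comap (D a)) (fun b y hy => ?_) hx
    rw [Submodule.mem_comap, h.dz_apply]
    refine add_mem (Submodule.smul_mem _ _ (mem_lev_succ (ih hy) b)) ?_
    split_ifs
    · exact hy
    · exact zero_mem _

theorem IsCCR.prod (h : IsCCR p Z D v) (h' : IsCCR p Z' D' v') :
    IsCCR p (fun a => (Z a).prodMap (Z' a)) (fun a => (D a).prodMap (D' a)) (v, v') where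
  zz a b := by
    rw [LinearMap.prodMap_mul, LinearMap.prodMap_mul, h.zz, h'.zz, LinearMap.prodMap_smul]
  dd a b := by
    rw [LinearMap.prodMap_mul, LinearMap.prodMap_mul, h.dd, h'.dd, LinearMap.prodMap_smul]
  dz a b := by
    rw [LinearMap.prodMap_mul, LinearMap.prodMap_mul, h.dz, h'.dz, LinearMap.prodMap_add,
      LinearMap.prodMap_smul]
    split_ifs
    · rw [LinearMap.prodMap_one]
    · rw [LinearMap.prodMap_zero]
  dv a := by
    rw [LinearMap.prodMap_apply, h.dv, h'.dv]
    rfl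

/-- The correspondence is compatible with the operators `Z a * D b`. -/
theorem relL_zd (h : IsCCR p Z D v) (h' : IsCCR p Z' D' v') {d : ℕ} {x : M} {y : M'}
    (hx : (x, y) ∈ relL Z v Z' v' d) (a b : A) :
    (Z a (D b x), Z' a (D' b y)) ∈ relL Z v Z' v' d := by
  cases d with
  | zero =>
    rw [h.dzero b (fst_mem_lev hx), h'.dzero b (snd_mem_lev hx), map_zero, map_zero]
    exact zero_mem _
  | succ d => exact mem_lev_succ ((h.prod h').dsucc b d hx) a

variable [Fintype A]

/-- The Euler operator acts on level `d` by `d`. -/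
theorem IsCCR.euler (h : IsCCR p Z D v) : ∀ (d : ℕ) {x : M}, x ∈ lev Z v d →
    ∑ a, Z a (D a x) = (d : K) • x := by
  intro d
  induction d with
  | zero =>
    intro x hx
    rw [Nat.cast_zero, zero_smul]
    exact Finset.sum_eq_zero fun a _ => by rw [h.dzero a hx, map_zero]
  | succ d ih =>
    intro x hx
    let C : Submodule K M := LinearMap.ker ((∑ a, Z a * D a) - ((d + 1 : ℕ) : K) • 1)
    have key : ∀ x, x ∈ C ↔ ∑ a, Z a (D a x) = ((d + 1 : ℕ) : K) • x := fun x => by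
      rw [LinearMap.mem_ker, LinearMap.sub_apply, sub_eq_zero, LinearMap.sum_apply]
      rfl
    refine (key x).1 (lev_succ_induction (C := C) (fun b y hy => (key _).2 ?_) hx)
    have hz : ∀ a, Z a (D a (Z b y)) = Z b (Z a (D a y)) + if a = b then Z b y else 0 := fun a => by
      have hzz := LinearMap.congr_fun (h.zz a b) (D a y)
      rw [Module.End.mul_apply, LinearMap.smul_apply, Module.End.mul_apply] at hzz
      rw [h.dz_apply, map_add, map_smul, hzz, smul_smul, sg_mul_self, one_smul]
      split_ifs with hab
      · rw [hab]
      · rw [map_zero]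
    rw [Finset.sum_congr rfl fun a _ => hz a, Finset.sum_add_distrib, ← map_sum, ih hy, map_smul,
      Finset.sum_ite_eq' Finset.univ b, if_pos (Finset.mem_univ _), Nat.cast_succ, add_smul,
      one_smul]

theorem IsCCR.eq_zero [CharZero K] (h : IsCCR p Z D v) {d : ℕ} {x : M} (hx : x ∈ lev Z v (d + 1))
    (h0 : ∀ a, D a x = 0) : x = 0 := by
  have := h.euler (d + 1) hx
  rw [Finset.sum_eq_zero fun a _ => by rw [h0 a, map_zero]] at this
  exact (smul_eq_zero.1 this.symm).resolve_left (Nat.cast_ne_zero.2 (Nat.succ_ne_zero d))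

theorem snd_eq_zero [CharZero K] (h : IsCCR p Z D v) (h' : IsCCR p Z' D' v') (hv : v ≠ 0) {d : ℕ}
    {y : M'} (hy : ((0 : M), y) ∈ relL Z v Z' v' d) : y = 0 := by
  induction d generalizing y with
  | zero =>
    obtain ⟨c, hc⟩ := Submodule.mem_span_singleton.1 hy
    obtain ⟨h1, h2⟩ := Prod.mk.inj hc
    have : c = 0 := (smul_eq_zero.1 h1).resolve_right hv
    rw [← h2, this, zero_smul]
  | succ d ih =>
    refine h'.eq_zero (snd_mem_lev hy) fun a => ih ?_
    have := (h.prod h').dsucc a d hy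
    rwa [LinearMap.prodMap_apply, map_zero] at this

theorem fst_eq_zero [CharZero K] (h : IsCCR p Z D v) (h' : IsCCR p Z' D' v') (hv : v' ≠ 0) {d : ℕ}
    {x : M} (hx : (x, (0 : M')) ∈ relL Z v Z' v' d) : x = 0 := by
  induction d generalizing x with
  | zero =>
    obtain ⟨c, hc⟩ := Submodule.mem_span_singleton.1 hx
    obtain ⟨h1, h2⟩ := Prod.mk.inj hc
    have : c = 0 := (smul_eq_zero.1 h2).resolve_right hv
    rw [← h1, this, zero_smul]
  | succ d ih =>
    refine h.eq_zero (fst_mem_lev hx) fun a => ih ?_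
    have := (h.prod h').dsucc a d hx
    rwa [LinearMap.prodMap_apply, map_zero] at this

end Levels

section Symbol

variable {K : Type} [Field K] {m n : ℕ}

theorem twP_add (b : Bool) (f g : Module.End K (FM K m n)) : twP b (f + g) = twP b f + twP b g := by
  cases b
  · rfl
  · simp only [twP, if_true, mul_add, add_mul]

theorem twP_smul (b : Bool) (c : K) (f : Module.End K (FM K m n)) :
    twP b (c • f) = c • twP b f := by
  cases b
  · rfl
  · simp only [twP, if_true, mul_smul_comm, smul_mul_assoc]

theorem twP_mul (b : Bool) (f g : Module.End K (FM K m n)) : twP b (f * g) = twP b f * twP b g := by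
  cases b
  · rfl
  · simp only [twP, if_true, mul_assoc]
    rw [← mul_assoc (PiO K m n) (PiO K m n), PiO_PiO, one_mul]

theorem twP_twP (b c : Bool) (f : Module.End K (FM K m n)) :
    twP b (twP c f) = twP (xor b c) f := by
  cases b
  · rw [Bool.false_xor]; rfl
  · cases c
    · rfl
    · simp only [twP, if_true, mul_assoc, PiO_PiO, mul_one, Bool.xor_self, Bool.false_eq_true,
        if_false]
      rw [← mul_assoc, PiO_PiO, one_mul]

/-- Left multiplication by an operator. -/
noncomputable def lM (T : Module.End K (FM K m n)) : Module.End K (Module.End K (FM K m n)) :=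
  LinearMap.mulLeft K T

/-- Signed right multiplication by an operator of parity `b`. -/
noncomputable def rM (b : Bool) (T : Module.End K (FM K m n)) :
    Module.End K (Module.End K (FM K m n)) where
  toFun f := twP b f * T
  map_add' f g := by rw [twP_add, add_mul]
  map_smul' c f := by rw [twP_smul, smul_mul_assoc, RingHom.id_apply]

theorem lM_apply (T f : Module.End K (FM K m n)) : lM T f = T * f := rfl

theorem rM_apply (b : Bool) (T f : Module.End K (FM K m n)) : rM b T f = twP b f * T := rfl

theorem lM_mul (S T : Module.End K (FM K m n)) : lM (S * T) = lM S * lM T :=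
  LinearMap.ext fun _ => mul_assoc _ _ _

theorem lM_one : lM (1 : Module.End K (FM K m n)) = 1 := LinearMap.ext fun _ => one_mul _

theorem lM_zero : lM (0 : Module.End K (FM K m n)) = 0 := LinearMap.ext fun _ => zero_mul _

theorem lM_smul (c : K) (T : Module.End K (FM K m n)) : lM (c • T) = c • lM T :=
  LinearMap.ext fun _ => smul_mul_assoc _ _ _

theorem lM_add (S T : Module.End K (FM K m n)) : lM (S + T) = lM S + lM T :=
  LinearMap.ext fun _ => add_mul _ _ _

theorem rM_one : rM false (1 : Module.End K (FM K m n)) = 1 := LinearMap.ext fun _ => mul_one _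

theorem rM_zero (b : Bool) : rM b (0 : Module.End K (FM K m n)) = 0 :=
  LinearMap.ext fun _ => mul_zero _

theorem rM_smul (b : Bool) (c : K) (T : Module.End K (FM K m n)) : rM b (c • T) = c • rM b T :=
  LinearMap.ext fun _ => mul_smul_comm _ _ _

theorem rM_add (b : Bool) (S T : Module.End K (FM K m n)) : rM b (S + T) = rM b S + rM b T :=
  LinearMap.ext fun _ => mul_add _ _ _

theorem rM_mul {b c : Bool} {S T : Module.End K (FM K m n)} (hT : HasPar c T) :
    rM b S * rM c T = sg K (b && c) • rM (xor b c) (T * S) :=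
  LinearMap.ext fun f => by
    change twP b (twP c f * T) * S = sg K (b && c) • (twP (xor b c) f * (T * S))
    rw [twP_mul, twP_twP, hT.twP, mul_smul_comm, smul_mul_assoc, mul_assoc, Bool.and_comm]

theorem rM_lM {b c : Bool} {S T : Module.End K (FM K m n)} (hT : HasPar c T) :
    rM b S * lM T = sg K (b && c) • (lM T * rM b S) :=
  LinearMap.ext fun f => by
    change twP b (T * f) * S = sg K (b && c) • (T * (twP b f * S))
    rw [twP_mul, hT.twP, smul_mul_assoc, smul_mul_assoc, mul_assoc, Bool.and_comm]

theorem lM_rM {b c : Bool} {S T : Module.End K (FM K m n)} (hT : HasPar c T) :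
    lM T * rM b S = sg K (b && c) • (rM b S * lM T) := by
  rw [rM_lM hT, smul_smul, sg_mul_self, one_smul]

/-- The creation operators on the space of operators. -/
noncomputable def Zh (a : (Fin m × Bool) × Ix n) : Module.End K (Module.End K (FM K m n)) :=
  if a.1.2 then rM a.2.isRight (dF a.1.1 a.2) else lM (zF a.1.1 a.2)

/-- The annihilation operators on the space of operators. -/
noncomputable def Dh (a : (Fin m × Bool) × Ix n) : Module.End K (Module.End K (FM K m n)) :=
  if a.1.2 then sg K a.2.isRight • rM a.2.isRight (zF a.1.1 a.2) else lM (dF a.1.1 a.2)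

theorem Zh_false (q : Fin m) (r : Ix n) : Zh (K := K) ((q, false), r) = lM (zF q r) := rfl
theorem Zh_true (q : Fin m) (r : Ix n) :
    Zh (K := K) ((q, true), r) = rM r.isRight (dF q r) := rfl
theorem Dh_false (q : Fin m) (r : Ix n) : Dh (K := K) ((q, false), r) = lM (dF q r) := rfl
theorem Dh_true (q : Fin m) (r : Ix n) :
    Dh (K := K) ((q, true), r) = sg K r.isRight • rM r.isRight (zF q r) := rfl

theorem prS_of_neg {l : Fin m → ℤ} {q : Fin m} (h : l q < 0) : prS K n l = 0 :=
  LinearMap.ext fun x => prW_eq_zero_iff.2 fun b hb => by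
    refine absurd h (not_lt.2 ?_)
    rw [← hb, wtG, Finset.sum_apply]
    refine Finset.sum_nonneg fun p _ => ?_
    rw [Finset.sum_apply]
    refine Finset.sum_nonneg fun r _ => ?_
    rw [Pi.smul_apply, wsl, nsmul_eq_mul]
    refine mul_nonneg (Nat.cast_nonneg _) ?_
    rw [Pi.single_apply]
    split_ifs <;> simp

theorem isCCR_end : IsCCR (fun a : (Fin m × Bool) × Ix n => a.2.isRight) (Zh (K := K)) Dh
    (prS K n 0) where
  zz := by
    rintro ⟨⟨q, _ | _⟩, r⟩ ⟨⟨q', _ | _⟩, s⟩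
    · rw [Zh_false, Zh_false, ← lM_mul, zF_zF, lM_smul, lM_mul]
    · rw [Zh_false, Zh_true, lM_rM (hasPar_zF q r), Bool.and_comm]
    · rw [Zh_false, Zh_true, rM_lM (hasPar_zF q' s)]
    · rw [Zh_true, Zh_true, rM_mul (hasPar_dF q' s), rM_mul (hasPar_dF q r), dF_dF q' q, rM_smul,
        Bool.xor_comm, Bool.and_comm]
  dd := by
    rintro ⟨⟨q, _ | _⟩, r⟩ ⟨⟨q', _ | _⟩, s⟩
    · rw [Dh_false, Dh_false, ← lM_mul, dF_dF, lM_smul, lM_mul]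
    · rw [Dh_false, Dh_true, mul_smul_comm, lM_rM (hasPar_dF q r), Bool.and_comm, smul_mul_assoc,
        smul_comm]
    · rw [Dh_false, Dh_true, mul_smul_comm, smul_mul_assoc, rM_lM (hasPar_dF q' s), smul_comm]
    · rw [Dh_true, Dh_true, smul_mul_assoc, mul_smul_comm, smul_mul_assoc, mul_smul_comm,
        rM_mul (hasPar_zF q' s), rM_mul (hasPar_zF q r), zF_zF q' q, rM_smul, Bool.xor_comm,
        Bool.and_comm s.isRight, smul_comm (sg K r.isRight) (sg K s.isRight),
        smul_comm (sg K r.isRight) (sg K (r.isRight && s.isRight)),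
        smul_comm (sg K s.isRight) (sg K (r.isRight && s.isRight))]
  dz := by
    rintro ⟨⟨q, _ | _⟩, r⟩ ⟨⟨q', _ | _⟩, s⟩
    · rw [Zh_false, Dh_false, ← lM_mul, dF_zF, lM_add, lM_smul, lM_mul]
      congr 1
      simp only [Prod.mk.injEq, and_true]
      split_ifs
      · exact lM_one
      · exact lM_zero
    · rw [Dh_false, Zh_true, lM_rM (hasPar_dF q r), Bool.and_comm, if_neg (by simp), add_zero]
    · rw [Zh_false, Dh_true, mul_smul_comm, smul_mul_assoc, rM_lM (hasPar_zF q' s), smul_comm,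
        if_neg (by simp), add_zero]
    · rw [Dh_true, Zh_true, smul_mul_assoc, mul_smul_comm,
        rM_mul (hasPar_dF q' s), rM_mul (hasPar_zF q r), dF_zF q' q, rM_add, rM_smul, Bool.xor_comm,
        Bool.and_comm s.isRight, smul_add, smul_add,
        smul_comm (sg K r.isRight) (sg K (r.isRight && s.isRight))]
      congr 1
      simp only [Prod.mk.injEq, and_true]
      by_cases h : q = q' ∧ r = s
      · obtain ⟨rfl, rfl⟩ := h
        rw [if_pos ⟨rfl, rfl⟩, if_pos ⟨rfl, rfl⟩, Bool.xor_self, rM_one, Bool.and_self, smul_smul,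
          sg_mul_self, one_smul]
      · rw [if_neg (fun h' => h ⟨h'.1.symm, h'.2.symm⟩), if_neg h, rM_zero, smul_zero, smul_zero]
  dv := by
    rintro ⟨⟨q, _ | _⟩, r⟩
    · rw [Dh_false, lM_apply]
      refine (shifts_dF q r 0).trans ?_
      rw [prS_of_neg (q := q) (by simp), zero_mul]
    · rw [Dh_true, LinearMap.smul_apply, rM_apply, (hasPar_prS _).twP, Bool.false_and, sg_false,
        one_smul]
      have := shifts_zF (K := K) q r (-Pi.single q 1)
      rw [neg_add_cancel] at this
      rw [← this, prS_of_neg (q := q) (by simp), mul_zero, smul_zero]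

variable {N : ℕ}

/-- The slot attached to left or right multiplication by the variables of a slot. -/
def emb (h : 2 * m ≤ N) (q : Fin m × Bool) : Fin N :=
  ⟨2 * q.1 + if q.2 then 1 else 0, by have := q.1.2; split_ifs <;> omega⟩

theorem emb_injective (h : 2 * m ≤ N) : Function.Injective (emb h) := by
  rintro ⟨q, b⟩ ⟨q', b'⟩ heq
  have := Fin.mk.inj heq
  cases b <;> cases b' <;> simp_all [Fin.ext_iff] <;> omega

theorem tm_emb (h : 2 * m ≤ N) (q : Fin m × Bool) : tm (emb h q) = q.2 := by
  obtain ⟨q, b⟩ := q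
  cases b <;> simp [tm, emb]

theorem exists_emb (h : 2 * m ≤ N) {P : Fin N} (hP : P.val < 2 * m) : ∃ q, emb h q = P :=
  ⟨(⟨P / 2, by omega⟩, decide (P.val % 2 = 1)), Fin.ext (by simp [emb]; split_ifs <;> omega)⟩

theorem isCCR_FM (h : 2 * m ≤ N) : IsCCR (fun a : (Fin m × Bool) × Ix n => a.2.isRight)
    (fun a => zF (K := K) (emb h a.1) a.2) (fun a => dF (emb h a.1) a.2) (vF K N n) where
  zz a b := zF_zF _ _ _ _
  dd a b := dF_dF _ _ _ _
  dz a b := by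
    rw [dF_zF]
    simp only [(emb_injective h).eq_iff, Prod.ext_iff (x := a)]
  dv a := dF_vF _ _

theorem vF_ne : vF K N n ≠ 0 := fun h => by
  have := congrArg (co (K := K) (fun _ => 0, fun _ => false)) h
  rw [vF_eq, co_bF, if_pos rfl, map_zero] at this
  exact one_ne_zero this

theorem prS_zero_vF : prS K n 0 (vF K m n) = vF K m n := (wtIn_vF wsl).prW_eq

theorem prS_zero_ne : prS K (F := m) n 0 ≠ 0 := fun h => by
  have := LinearMap.congr_fun h (vF K m n)
  rw [prS_zero_vF] at this
  exact vF_ne this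

end Symbol

section Symbol

variable {K : Type} [Field K] {m n N : ℕ}

theorem twP_prS (b : Bool) (l : Fin m → ℤ) : twP b (prS K n l) = prS K n l := by
  rw [(hasPar_prS l).twP, Bool.false_and, sg_false, one_smul]

theorem euler_prS (l : Fin m → ℤ) :
    ∑ q : Fin m, ∑ r : Ix n, zF q r * (dF q r * prS K n l) = ((∑ q, l q : ℤ) : K) • prS K n l := by
  rw [Int.cast_sum, Finset.sum_smul]
  refine Finset.sum_congr rfl fun q _ => ?_
  rw [← gU_self_prS, gU, Finset.sum_mul]
  exact Finset.sum_congr rfl fun r _ => (mul_assoc _ _ _).symm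

theorem prS_zero_apply (x : FM K m n) : ∃ c : K, prS K n 0 x = c • vF K m n := by
  refine ⟨co (fun _ => 0, fun _ => false) x, FM_ext fun b => ?_⟩
  classical
  rw [prS, co_prW, map_smul, vF_eq, co_bF]
  have key : wtG wsl b = 0 ↔ (fun _ => 0, fun _ => false) = b := by
    refine ⟨fun h => ex_injective fun p r => ?_, fun h => h ▸ wtG_vac _⟩
    have h1 : ∑ s : Ix n, (ex b p s : ℤ) = 0 := by
      have := congrFun h p
      rw [wtG, Finset.sum_apply] at this
      rw [← Pi.zero_apply (M := fun _ : Fin m => ℤ) p, ← this, Finset.sum_eq_single p]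
      · rw [Finset.sum_apply]
        refine Finset.sum_congr rfl fun s _ => ?_
        rw [Pi.smul_apply, wsl, Pi.single_eq_same, nsmul_eq_mul, mul_one]
      · intro q _ hq
        rw [Finset.sum_apply]
        refine Finset.sum_eq_zero fun s _ => ?_
        rw [Pi.smul_apply, wsl, Pi.single_eq_of_ne hq.symm, smul_zero]
      · exact fun h => absurd (Finset.mem_univ _) h
    have h2 := (Finset.sum_eq_zero_iff_of_nonneg fun s _ => Nat.cast_nonneg _).1 h1 r
      (Finset.mem_univ _)
    rw [Nat.cast_eq_zero.1 h2]
    cases r <;> simp [ex]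
  by_cases h : wtG wsl b = 0
  · rw [if_pos h, if_pos (key.1 h), key.1 h, smul_eq_mul, mul_one]
  · rw [if_neg h, if_neg (mt key.2 h), smul_zero]

theorem mem_lev_aux [CharZero K] (d : ℕ) : ∀ (lam mu : Fin m → ℤ) (f : Module.End K (FM K m n)),
    prS K n mu * f = f → f * prS K n lam = f → (∑ q, mu q + ∑ q, lam q = d) →
    f ∈ lev Zh (prS K n 0) d := by
  induction d with
  | zero =>
    intro lam mu f h1 h2 h
    by_cases hl : ∃ q, lam q < 0
    · obtain ⟨q, hq⟩ := hl
      rw [← h2, prS_of_neg hq, mul_zero]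
      exact zero_mem _
    by_cases hm : ∃ q, mu q < 0
    · obtain ⟨q, hq⟩ := hm
      rw [← h1, prS_of_neg hq, zero_mul]
      exact zero_mem _
    push Not at hl hm
    have s1 := Finset.sum_nonneg fun q (_ : q ∈ Finset.univ) => hl q
    have s2 := Finset.sum_nonneg fun q (_ : q ∈ Finset.univ) => hm q
    rw [Nat.cast_zero] at h
    have hl0 : lam = 0 := funext fun q => (Finset.sum_eq_zero_iff_of_nonneg fun q _ => hl q).1
      (by linarith) q (Finset.mem_univ q)
    have hm0 : mu = 0 := funext fun q => (Finset.sum_eq_zero_iff_of_nonneg fun q _ => hm q).1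
      (by linarith) q (Finset.mem_univ q)
    subst hl0 hm0
    obtain ⟨c, hc⟩ := prS_zero_apply (f (vF K m n))
    refine Submodule.mem_span_singleton.2 ⟨c, LinearMap.ext fun x => ?_⟩
    obtain ⟨e, he⟩ := prS_zero_apply x
    rw [← h2, ← h1, LinearMap.smul_apply, Module.End.mul_apply, he, map_smul, Module.End.mul_apply,
      hc, smul_comm]
  | succ d ih =>
    intro lam mu f h1 h2 h
    by_cases hl : ∑ q, lam q = 0
    · have hmu : ((∑ q, mu q : ℤ) : K) ≠ 0 := by
        rw [hl, add_zero] at h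
        rw [h]
        exact_mod_cast Nat.succ_ne_zero d
      have key : ((∑ q, mu q : ℤ) : K) • f =
          ∑ q : Fin m, ∑ r : Ix n, Zh ((q, false), r) (dF q r * f) := by
        conv_lhs => rw [← h1, ← smul_mul_assoc, ← euler_prS, Finset.sum_mul]
        refine Finset.sum_congr rfl fun q _ => ?_
        rw [Finset.sum_mul]
        refine Finset.sum_congr rfl fun r _ => ?_
        rw [mul_assoc, mul_assoc, h1]
        rfl
      refine (Submodule.smul_mem_iff _ hmu).1 (key ▸ Submodule.sum_mem _ fun q _ =>
        Submodule.sum_mem _ fun r _ => mem_lev_succ (ih lam (mu + -Pi.single q 1) _ ?_ ?_ ?_) _)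
      · rw [← mul_assoc, ← shifts_dF q r mu, mul_assoc, h1]
      · rw [mul_assoc, h2]
      · push_cast at h
        simp only [Pi.add_apply, Pi.neg_apply, Finset.sum_add_distrib, Finset.sum_neg_distrib,
          Finset.sum_pi_single', Finset.mem_univ, if_true]
        linarith
    · have key : ((∑ q, lam q : ℤ) : K) • f = ∑ q : Fin m, ∑ r : Ix n, Zh ((q, true), r)
          (twP r.isRight (f * zF q r * prS K n (lam + -Pi.single q 1))) := by
        conv_lhs => rw [← h2, ← mul_smul_comm, ← euler_prS, Finset.mul_sum]
        refine Finset.sum_congr rfl fun q _ => ?_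
        rw [Finset.mul_sum]
        refine Finset.sum_congr rfl fun r _ => ?_
        rw [Zh_true, rM_apply, twP_twP, Bool.xor_self, shifts_dF q r lam, ← mul_assoc, ← mul_assoc]
        rfl
      refine (Submodule.smul_mem_iff _ (Int.cast_ne_zero.2 hl)).1 (key ▸ Submodule.sum_mem _
        fun q _ => Submodule.sum_mem _ fun r _ => mem_lev_succ
          (ih (lam + -Pi.single q 1) mu _ ?_ ?_ ?_) _)
      · rw [twP_mul, twP_mul, ← mul_assoc, ← mul_assoc]
        congr 2
        rw [← twP_prS (n := n) r.isRight mu, ← twP_mul, h1]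
      · rw [twP_mul, twP_prS, mul_assoc, prS_prS]
      · push_cast at h
        simp only [Pi.add_apply, Pi.neg_apply, Finset.sum_add_distrib, Finset.sum_neg_distrib,
          Finset.sum_pi_single', Finset.mem_univ, if_true]
        linarith

/-- Operators between weight spaces are obtained from the vacuum projection. -/
theorem exists_mem_lev [CharZero K] {lam mu : Fin m → ℤ} {f : Module.End K (FM K m n)}
    (h1 : prS K n mu * f = f) (h2 : f * prS K n lam = f) : ∃ d, f ∈ lev Zh (prS K n 0) d := by
  by_cases hl : ∃ q, lam q < 0
  · obtain ⟨q, hq⟩ := hl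
    rw [← h2, prS_of_neg hq, mul_zero]
    exact ⟨0, zero_mem _⟩
  by_cases hm : ∃ q, mu q < 0
  · obtain ⟨q, hq⟩ := hm
    rw [← h1, prS_of_neg hq, zero_mul]
    exact ⟨0, zero_mem _⟩
  push Not at hl hm
  refine ⟨(∑ q, mu q + ∑ q, lam q).toNat, mem_lev_aux _ lam mu f h1 h2 ?_⟩
  rw [Int.toNat_of_nonneg]
  exact add_nonneg (Finset.sum_nonneg fun q _ => hm q) (Finset.sum_nonneg fun q _ => hl q)

theorem dF_unused {h : 2 * m ≤ N} {d : ℕ} {x : FM K N n}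
    (hx : x ∈ lev (fun a : (Fin m × Bool) × Ix n => zF (emb h a.1) a.2) (vF K N n) d)
    {P : Fin N} (hP : P ∉ Set.range (emb h)) (r : Ix n) : dF P r x = 0 := by
  induction d generalizing x with
  | zero =>
    obtain ⟨c, rfl⟩ := Submodule.mem_span_singleton.1 hx
    rw [map_smul, dF_vF, smul_zero]
  | succ d ih =>
    refine lev_succ_induction (C := LinearMap.ker (dF P r)) (fun a y hy => ?_) hx
    have := LinearMap.congr_fun (dF_zF P (emb h a.1) r a.2) y
    rw [if_neg fun h' => hP ⟨_, h'.1.symm⟩, add_zero, LinearMap.smul_apply, Module.End.mul_apply,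
      Module.End.mul_apply, ih hy, map_zero, smul_zero] at this
    exact this

/-- The index flip of an odd slot. -/
def flb (b : Bool) (r : Ix n) : Ix n := if b then nIx r else r

theorem fl_emb (h : 2 * m ≤ N) (q : Fin m × Bool) (r : Ix n) : fl tm (emb h q) r = flb q.2 r := by
  rw [fl, tm_emb, flb]

variable (K) in
/-- The action of a matrix unit on operators. -/
noncomputable def gVh (r s : Ix n) (f : Module.End K (FM K m n)) : Module.End K (FM K m n) :=
  ∑ q : Fin m × Bool, sg K (q.2 && xor r.isRight s.isRight) •
    Zh (q, flb q.2 r) (Dh (q, flb q.2 s) f)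

theorem gVh_eq (r s : Ix n) (f : Module.End K (FM K m n)) : gVh K r s f = gV K tz r s * f -
    etaP K r s • (twP (xor r.isRight s.isRight) f * gV K tz (nIx s) (nIx r)) := by
  have key : ∀ q : Fin m, sg K (xor r.isRight s.isRight) •
      Zh ((q, true), nIx r) (Dh ((q, true), nIx s) f) =
      -(etaP K r s • (twP (xor r.isRight s.isRight) f * (zF q (nIx s) * dF q (nIx r)))) := by
    intro q
    rw [Dh_true, LinearMap.smul_apply, map_smul, Zh_true, ← Module.End.mul_apply,
      rM_mul (hasPar_zF q _), LinearMap.smul_apply, rM_apply, smul_smul, smul_smul, ← neg_smul]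
    simp only [nIx_isRight, etaP]
    cases r.isRight <;> cases s.isRight <;> simp
  rw [gVh, Fintype.sum_prod_type]
  simp only [Fintype.sum_bool, Bool.true_and, Bool.false_and, sg_false, one_smul]
  rw [Finset.sum_add_distrib, add_comm, sub_eq_add_neg]
  congr 1
  · rw [gV, Finset.sum_mul]
    refine Finset.sum_congr rfl fun q _ => ?_
    simp only [tz, Bool.false_and, sg_false, one_smul]
    exact (mul_assoc _ _ _).symm
  · simp only [flb, if_true]
    rw [Finset.sum_congr rfl fun q _ => key q, Finset.sum_neg_distrib, ← Finset.smul_sum,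
      ← Finset.mul_sum, gV]
    simp only [tz, Bool.false_and, sg_false, one_smul]
    rfl

theorem gV_unused (h : 2 * m ≤ N) {x : FM K N n}
    (hx : ∀ P, P ∉ Set.range (emb h) → ∀ r, dF P r x = 0) (r s : Ix n) : gV K tm r s x =
    ∑ q : Fin m × Bool, sg K (q.2 && xor r.isRight s.isRight) •
      zF (emb h q) (flb q.2 r) (dF (emb h q) (flb q.2 s) x) := by
  rw [gV, LinearMap.sum_apply]
  refine (Fintype.sum_of_injective (emb h) (emb_injective h) _ _ (fun P hP => ?_) fun q => ?_).symm
  · rw [LinearMap.smul_apply, Module.End.mul_apply, Dt, hx P hP, map_zero, smul_zero]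
  · rw [tm_emb, LinearMap.smul_apply, Module.End.mul_apply, Zt, Dt, fl_emb, fl_emb]

/-- The correspondence between symbols and operators. -/
noncomputable abbrev relS (K : Type) [Field K] (n : ℕ) {m N : ℕ} (h : 2 * m ≤ N) (d : ℕ) :
    Submodule K (FM K N n × Module.End K (FM K m n)) :=
  relL (fun a : (Fin m × Bool) × Ix n => zF (emb h a.1) a.2) (vF K N n) Zh (prS K n 0) d

theorem relS_gV {h : 2 * m ≤ N} {d : ℕ} {x : FM K N n} {f : Module.End K (FM K m n)}
    (hx : (x, f) ∈ relS K n h d) (r s : Ix n) : (gV K tm r s x, gVh K r s f) ∈ relS K n h d := by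
  rw [gV_unused h fun P hP r => dF_unused (fst_mem_lev hx) hP r, gVh]
  have := Submodule.sum_mem (relS K n h d) fun (q : Fin m × Bool) (_ : q ∈ Finset.univ) =>
    Submodule.smul_mem _ (sg K (q.2 && xor r.isRight s.isRight))
      (relL_zd (isCCR_FM h) isCCR_end hx (q, flb q.2 r) (q, flb q.2 s))
  convert this using 1
  exact Prod.ext (by rw [Prod.fst_sum]; rfl) (by rw [Prod.snd_sum]; rfl)

/-- The symbol of a homomorphism is invariant. -/
theorem relS_pX [CharZero K] {h : 2 * m ≤ N} {d : ℕ} {x : FM K N n} {f : Module.End K (FM K m n)}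
    (hx : (x, f) ∈ relS K n h d) (hf : PHom f) (r s : Ix n) : pX K tm r s x = 0 := by
  have h1 := Submodule.add_mem _ (relS_gV hx r s)
    (Submodule.smul_mem _ (etaP K r s) (relS_gV hx (nIx s) (nIx r)))
  have h2 : gVh K r s f + etaP K r s • gVh K (nIx s) (nIx r) f = 0 := by
    have := hf r s
    have he : etaP K (nIx s) (nIx r) = etaP K r s := by
      simp only [etaP, nIx_isRight]
      cases r.isRight <;> cases s.isRight <;> rfl
    have hb : xor (nIx s).isRight (nIx r).isRight = xor r.isRight s.isRight := by
      simp only [nIx_isRight]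
      cases r.isRight <;> cases s.isRight <;> rfl
    rw [gVh_eq, gVh_eq, he, hb, nIx_nIx, nIx_nIx, smul_sub, smul_smul,
      show etaP K r s * etaP K r s = 1 from sg_mul_self _, one_smul]
    rw [pX, add_mul, mul_add, smul_mul_assoc, mul_smul_comm] at this
    rw [sub_add_sub_comm, this, add_comm, sub_eq_zero, add_comm]
  refine fst_eq_zero (isCCR_FM h) isCCR_end prS_zero_ne (d := d) (h2 ▸ ?_)
  exact h1

end Symbol

section Contraction

variable {K : Type} [Field K] {m n N : ℕ}

/-- The algebra generated by the quadratic operators and the slot projections. -/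
inductive OpA : Module.End K (FM K m n) → Prop
  | one : OpA 1
  | gU (P Q : Fin m) {f} : OpA f → OpA (gU K tz P Q * f)
  | om (P Q : Fin m) {f} : OpA f → OpA (om K n tz P Q * f)
  | bg (P Q : Fin m) {f} : OpA f → OpA (bg K n P Q * f)
  | prS (l : Fin m → ℤ) {f} : OpA f → OpA (prS K n l * f)
  | add {f g} : OpA f → OpA g → OpA (f + g)
  | smul (c : K) {f} : OpA f → OpA (c • f)

theorem OpA.zero : OpA (0 : Module.End K (FM K m n)) := by
  have := (OpA.one (K := K) (m := m) (n := n)).smul 0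
  rwa [zero_smul] at this

theorem OpA.neg {f : Module.End K (FM K m n)} (hf : OpA f) : OpA (-f) := by
  have := hf.smul (-1)
  rwa [neg_one_smul] at this

theorem OpA.sub {f g : Module.End K (FM K m n)} (hf : OpA f) (hg : OpA g) : OpA (f - g) :=
  sub_eq_add_neg f g ▸ hf.add hg.neg

theorem OpA.ite {c : Prop} [Decidable c] {f : Module.End K (FM K m n)} (hf : OpA f) :
    OpA (if c then f else 0) := by
  split_ifs
  · exact hf
  · exact OpA.zero

theorem OpA.mul {f g : Module.End K (FM K m n)} (hf : OpA f) (hg : OpA g) : OpA (f * g) := by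
  induction hf with
  | one => rwa [one_mul]
  | gU P Q _ ih => rw [mul_assoc]; exact ih.gU P Q
  | om P Q _ ih => rw [mul_assoc]; exact ih.om P Q
  | bg P Q _ ih => rw [mul_assoc]; exact ih.bg P Q
  | prS l _ ih => rw [mul_assoc]; exact ih.prS l
  | add _ _ ih ih' => rw [add_mul]; exact ih.add ih'
  | smul c _ ih => rw [smul_mul_assoc]; exact ih.smul c

theorem OpA.twP (b : Bool) {f : Module.End K (FM K m n)} (hf : OpA f) : OpA (twP b f) := by
  induction hf with
  | one =>
    have : _root_.twP b (1 : Module.End K (FM K m n)) = 1 := by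
      cases b
      · rfl
      · simp only [_root_.twP, if_true, mul_one, PiO_PiO]
    rw [this]
    exact OpA.one
  | gU P Q _ ih =>
    rw [twP_mul, (hasPar_gU P Q).twP, smul_mul_assoc]
    exact (ih.gU P Q).smul _
  | om P Q _ ih =>
    rw [twP_mul, (hasPar_om P Q).twP, smul_mul_assoc]
    exact (ih.om P Q).smul _
  | bg P Q _ ih =>
    rw [twP_mul, (hasPar_bg P Q).twP, smul_mul_assoc]
    exact (ih.bg P Q).smul _
  | prS l _ ih => rw [twP_mul, twP_prS]; exact ih.prS l
  | add _ _ ih ih' => rw [twP_add]; exact ih.add ih'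
  | smul c _ ih => rw [twP_smul]; exact ih.smul c

/-- The contraction of an operator between two families of operators. -/
noncomputable def con (q : Fin m) (W : Ix n → Module.End K (FM K m n))
    (f : Module.End K (FM K m n)) : Module.End K (FM K m n) :=
  ∑ r : Ix n, W r * (twP r.isRight f * dF q r)

theorem con_add (q : Fin m) (U V : Ix n → Module.End K (FM K m n)) (f : Module.End K (FM K m n)) :
    con q (fun r => U r + V r) f = con q U f + con q V f := by
  simp only [con, add_mul, Finset.sum_add_distrib]

theorem con_neg (q : Fin m) (U : Ix n → Module.End K (FM K m n)) (f : Module.End K (FM K m n)) :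
    con q (fun r => -U r) f = -con q U f := by
  simp only [con, neg_mul, Finset.sum_neg_distrib]

theorem con_ite (q : Fin m) (c : Prop) [Decidable c] (U : Ix n → Module.End K (FM K m n))
    (f : Module.End K (FM K m n)) :
    con q (fun r => if c then U r else 0) f = if c then con q U f else 0 := by
  split_ifs
  · rfl
  · simp only [con, zero_mul, Finset.sum_const_zero]

theorem con_op_add (q : Fin m) (W : Ix n → Module.End K (FM K m n))
    (f g : Module.End K (FM K m n)) : con q W (f + g) = con q W f + con q W g := by
  simp only [con, twP_add, add_mul, mul_add, Finset.sum_add_distrib]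

theorem con_op_smul (q : Fin m) (W : Ix n → Module.End K (FM K m n)) (c : K)
    (f : Module.End K (FM K m n)) : con q W (c • f) = c • con q W f := by
  simp only [con, twP_smul, smul_mul_assoc, mul_smul_comm, Finset.smul_sum]

theorem con_mul (q : Fin m) {W U : Ix n → Module.End K (FM K m n)} {T : Module.End K (FM K m n)}
    {b c : Bool} (hT : HasPar b T)
    (h : ∀ r, T * W r = (sg K c * sg K (b && r.isRight)) • (W r * T) + U r)
    (f : Module.End K (FM K m n)) :
    con q W (T * f) = sg K c • (T * con q W f - con q U f) := by
  rw [con, con, con, Finset.mul_sum, ← Finset.sum_sub_distrib, Finset.smul_sum]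
  refine Finset.sum_congr rfl fun r _ => ?_
  rw [← mul_assoc T, h, add_mul, add_sub_cancel_right, smul_mul_assoc, smul_smul,
    ← mul_assoc (sg K c), sg_mul_self, one_mul, twP_mul, hT.twP]
  simp only [smul_mul_assoc, mul_smul_comm, mul_assoc]

theorem con_prS (q : Fin m) {W : Ix n → Module.End K (FM K m n)} {w : Fin m → ℤ}
    (h : ∀ r, Shifts (W r) w) (l : Fin m → ℤ) (f : Module.End K (FM K m n)) :
    con q W (prS K n l * f) = prS K n (l + w) * con q W f := by
  rw [con, con, Finset.mul_sum]
  refine Finset.sum_congr rfl fun r _ => ?_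
  rw [twP_mul, twP_prS, mul_assoc, ← mul_assoc, h r l, mul_assoc]

theorem con_one_zF (q q' : Fin m) : con q' (fun r => zF (K := K) q r) 1 = gU K (L := n) tz q q' :=
    by
  rw [con, gU]
  refine Finset.sum_congr rfl fun r _ => ?_
  have : twP r.isRight (1 : Module.End K (FM K m n)) = 1 := by
    cases r.isRight
    · rfl
    · simp only [twP, if_true, mul_one, PiO_PiO]
  rw [this, one_mul]
  rfl

theorem con_one_dF (q q' : Fin m) :
    con q' (fun r => dF (K := K) q (nIx r)) 1 = bg K n q q' := by
  rw [con, bg, ← sum_nIx]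
  refine Finset.sum_congr rfl fun r _ => ?_
  have : twP (nIx r).isRight (1 : Module.End K (FM K m n)) = 1 := by
    cases (nIx r).isRight
    · rfl
    · simp only [twP, if_true, mul_one, PiO_PiO]
  rw [this, one_mul, nIx_nIx]
  rfl

theorem gU_zF (P Q q : Fin m) (r : Ix n) : gU K tz P Q * zF q r =
    (sg K false * sg K (false && r.isRight)) • (zF q r * gU K tz P Q) +
      if Q = q then zF P r else 0 := by
  rw [Bool.false_and, sg_false, mul_one]
  exact gU_Zt tz P Q q r

theorem gU_dF (P Q q : Fin m) (r : Ix n) : gU K tz P Q * dF q (nIx r) =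
    (sg K false * sg K (false && r.isRight)) • (dF q (nIx r) * gU K tz P Q) +
      if P = q then -dF Q (nIx r) else 0 := by
  rw [Bool.false_and, sg_false, mul_one]
  have := gU_Dt (K := K) tz P Q q (nIx r)
  simp only [tz, Bool.xor_self, Bool.false_and, sg_false, one_smul] at this ⊢
  exact this

theorem om_zF (P Q q : Fin m) (r : Ix n) : om K n tz P Q * zF q r =
    (sg K false * sg K (true && r.isRight)) • (zF q r * om K n tz P Q) + 0 := by
  rw [Bool.true_and, sg_false, one_mul, add_zero]
  exact om_Zt P Q q r

theorem om_dF (P Q q : Fin m) (r : Ix n) : om K n tz P Q * dF q (nIx r) =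
    (sg K true * sg K (true && r.isRight)) • (dF q (nIx r) * om K n tz P Q) +
      ((if q = P then -zF Q r else 0) + if q = Q then zF P r else 0) := by
  have h : dF q (nIx r) * om K n tz P Q = _ := Dt_om (K := K) q P Q (nIx r)
  have hs : sg K true * sg K (true && r.isRight) = sg K (nIx r).isRight := by
    rw [nIx_isRight]
    cases r.isRight <;> simp
  have e1 : ∀ P : Fin m, Zt K tz P (nIx (nIx r)) = zF P r := fun P => by rw [nIx_nIx]; rfl
  have e2 : Dt K tz q (nIx r) = dF q (nIx r) := rfl
  rw [hs, h, smul_add, smul_smul, sg_mul_self, one_smul, e1, e1, e2, add_assoc]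
  refine (add_eq_left.2 ?_).symm
  split_ifs <;> simp [smul_sub, smul_smul, sg_mul_self]

theorem bg_zF (P Q q : Fin m) (r : Ix n) : bg K n P Q * zF q r =
    (sg K false * sg K (true && r.isRight)) • (zF q r * bg K n P Q) +
      ((if P = q then dF Q (nIx r) else 0) + if Q = q then dF P (nIx r) else 0) := by
  rw [Bool.true_and, sg_false, one_mul]
  exact bg_Zt P Q q r

theorem bg_dF (P Q q : Fin m) (r : Ix n) : bg K n P Q * dF q (nIx r) =
    (sg K true * sg K (true && r.isRight)) • (dF q (nIx r) * bg K n P Q) + 0 := by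
  have hs : sg K true * sg K (true && r.isRight) = sg K (nIx r).isRight := by
    rw [nIx_isRight]
    cases r.isRight <;> simp
  rw [hs, add_zero]
  exact bg_Dt P Q q (nIx r)

/-- Contractions preserve the algebra of quadratic operators. -/
theorem OpA.con {f : Module.End K (FM K m n)} (hf : OpA f) (q' : Fin m) :
    ∀ q, OpA (con q' (fun r => zF q r) f) ∧ OpA (con q' (fun r => dF q (nIx r)) f) := by
  induction hf with
  | one =>
    intro q
    rw [con_one_zF, con_one_dF, ← mul_one (_root_.gU K tz q q'), ← mul_one (_root_.bg K n q q')]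
    exact ⟨OpA.one.gU q q', OpA.one.bg q q'⟩
  | gU P Q _ ih =>
    intro q
    rw [con_mul q' (hasPar_gU P Q) (gU_zF P Q q), con_mul q' (hasPar_gU P Q) (gU_dF P Q q),
      con_ite, con_ite, con_neg]
    exact ⟨(((ih q).1.gU P Q).sub (ih P).1.ite).smul _,
      (((ih q).2.gU P Q).sub (ih Q).2.neg.ite).smul _⟩
  | om P Q _ ih =>
    intro q
    rw [con_mul q' (hasPar_om P Q) (om_zF P Q q), con_mul q' (hasPar_om P Q) (om_dF P Q q),
      con_add, con_ite, con_ite, con_neg]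
    refine ⟨(((ih q).1.om P Q).sub ?_).smul _,
      (((ih q).2.om P Q).sub ((ih Q).1.neg.ite.add (ih P).1.ite)).smul _⟩
    simp only [_root_.con, zero_mul, Finset.sum_const_zero]
    exact OpA.zero
  | bg P Q _ ih =>
    intro q
    rw [con_mul q' (hasPar_bg P Q) (bg_zF P Q q), con_mul q' (hasPar_bg P Q) (bg_dF P Q q),
      con_add, con_ite, con_ite]
    refine ⟨(((ih q).1.bg P Q).sub ((ih Q).2.ite.add (ih P).2.ite)).smul _,
      (((ih q).2.bg P Q).sub ?_).smul _⟩
    simp only [_root_.con, zero_mul, Finset.sum_const_zero]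
    exact OpA.zero
  | prS l _ ih =>
    intro q
    rw [con_prS q' (fun r => shifts_zF q r), con_prS q' (fun r => shifts_dF q (nIx r))]
    exact ⟨(ih q).1.prS _, (ih q).2.prS _⟩
  | add _ _ ih ih' =>
    intro q
    rw [con_op_add, con_op_add]
    exact ⟨(ih q).1.add (ih' q).1, (ih q).2.add (ih' q).2⟩
  | smul c _ ih =>
    intro q
    rw [con_op_smul, con_op_smul]
    exact ⟨(ih q).1.smul c, (ih q).2.smul c⟩

variable (K) in
/-- The quadratic operators on the space of operators. -/
noncomputable def omh (a b : Fin m × Bool) (f : Module.End K (FM K m n)) :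
    Module.End K (FM K m n) :=
  ∑ r : Ix n, sg K (r.isRight && !b.2) • Zh (a, flb a.2 r) (Zh (b, flb b.2 (nIx r)) f)

theorem omh_false_false (q q' : Fin m) (f : Module.End K (FM K m n)) :
    omh K (q, false) (q', false) f = om K n tz q q' * f := by
  rw [omh, om, Finset.sum_mul]
  refine Finset.sum_congr rfl fun r _ => ?_
  rw [smul_mul_assoc, mul_assoc]
  rfl

theorem omh_true_true (q q' : Fin m) (f : Module.End K (FM K m n)) :
    omh K (q, true) (q', true) f = twP true f * bg K n q' q := by
  rw [omh, bg, Finset.mul_sum]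
  refine Finset.sum_congr rfl fun r _ => ?_
  simp only [flb, if_true, nIx_nIx, Bool.not_true, Bool.and_false, sg_false, one_smul]
  rw [Zh_true, Zh_true, ← Module.End.mul_apply, rM_mul (hasPar_dF _ _), LinearMap.smul_apply,
    rM_apply, nIx_isRight, Bool.not_and_self, sg_false, one_smul, Bool.not_xor_self]
  rfl

theorem omh_false_true (q q' : Fin m) (f : Module.End K (FM K m n)) :
    omh K (q, false) (q', true) f = con q' (fun r => zF q r) f := by
  rw [omh, con]
  refine Finset.sum_congr rfl fun r _ => ?_
  simp only [flb, if_true, nIx_nIx, Bool.not_true, Bool.and_false, sg_false, one_smul]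
  rfl

theorem relS_omh {h : 2 * m ≤ N} {d : ℕ} {x : FM K N n} {f : Module.End K (FM K m n)}
    (hx : (x, f) ∈ relS K n h d) (a b : Fin m × Bool) :
    (om K n tm (emb h a) (emb h b) x, omh K a b f) ∈ relS K n h (d + 2) := by
  have := Submodule.sum_mem (relS K n h (d + 2)) fun (r : Ix n) (_ : r ∈ Finset.univ) =>
    (relS K n h (d + 2)).smul_mem (sg K (r.isRight && !b.2))
      (mem_lev_succ (mem_lev_succ hx (b, flb b.2 (nIx r))) (a, flb a.2 r))
  convert this using 1
  refine Prod.ext ?_ (by rw [Prod.snd_sum]; rfl)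
  rw [Prod.fst_sum, om]
  dsimp only
  rw [LinearMap.sum_apply]
  refine Finset.sum_congr rfl fun r _ => ?_
  rw [LinearMap.smul_apply, Module.End.mul_apply, Zt, Zt, fl_emb, fl_emb, tm_emb]
  rfl

theorem exists_relS_om {h : 2 * m ≤ N} {d : ℕ} {x : FM K N n} {f : Module.End K (FM K m n)}
    (hf : OpA f) (hx : (x, f) ∈ relS K n h d) (a b : Fin m × Bool) :
    ∃ f', OpA f' ∧ (om K n tm (emb h a) (emb h b) x, f') ∈ relS K n h (d + 2) := by
  obtain ⟨q, _ | _⟩ := a <;> obtain ⟨q', _ | _⟩ := b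
  · exact ⟨_, omh_false_false q q' f ▸ hf.om q q', relS_omh hx _ _⟩
  · exact ⟨_, omh_false_true q q' f ▸ (hf.con q' q).1, relS_omh hx _ _⟩
  · refine ⟨_, (omh_false_true q' q f ▸ (hf.con q q').1).neg, ?_⟩
    have := Submodule.neg_mem _ (relS_omh hx (q', false) (q, true))
    rw [om_symm, tm_emb, tm_emb]
    simpa using this
  · refine ⟨_, omh_true_true q q' f ▸ (hf.twP true).mul ?_, relS_omh hx _ _⟩
    rw [← mul_one (bg K n q' q)]
    exact OpA.one.bg q' q

end Contraction

section Operators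

variable {K : Type} [Field K] {m n N : ℕ}

/-- The weight counting the variables in the slots that do not encode operators. -/
def wun (m : ℕ) : Fin N → Ix n → ℤ := fun P _ => if P.val < 2 * m then 0 else 1

theorem wun_nonneg (P : Fin N) (r : Ix n) : 0 ≤ wun m P r := by
  unfold wun
  split_ifs <;> decide

theorem prW_of_neg {w : Fin N → Ix n → ℤ} (hw : ∀ P r, 0 ≤ w P r) {d : ℤ} (hd : d < 0)
    (x : FM K N n) : prW K w d x = 0 :=
  prW_eq_zero_iff.2 fun b hb => absurd (hb ▸ wtG_nonneg hw b) (not_le.2 hd)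

theorem lev_wt {h : 2 * m ≤ N} {d : ℕ} {x : FM K N n}
    (hx : x ∈ lev (fun a : (Fin m × Bool) × Ix n => zF (emb h a.1) a.2) (vF K N n) d) :
    prW K wdeg (d : ℤ) x = x ∧ prW K (wun m) 0 x = x := by
  induction d generalizing x with
  | zero =>
    obtain ⟨c, rfl⟩ := Submodule.mem_span_singleton.1 hx
    rw [map_smul, map_smul, Nat.cast_zero, (wtIn_vF wdeg).prW_eq, (wtIn_vF (wun m)).prW_eq]
    exact ⟨rfl, rfl⟩
  | succ d ih =>
    refine lev_succ_induction (C := LinearMap.eqLocus (prW K wdeg ((d + 1 : ℕ) : ℤ)) LinearMap.id ⊓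
      LinearMap.eqLocus (prW K (wun m) 0) LinearMap.id) (fun a y hy => ?_) hx
    obtain ⟨h1, h2⟩ := ih hy
    have hu : wun m (emb h a.1) a.2 = 0 := by
      have := a.1.1.2
      refine if_pos ?_
      simp only [emb]
      split_ifs <;> omega
    constructor
    · change prW K wdeg ((d + 1 : ℕ) : ℤ) (zF (emb h a.1) a.2 y) = zF (emb h a.1) a.2 y
      rw [(shW_zF wdeg (emb h a.1) a.2).apply,
        show ((d + 1 : ℕ) : ℤ) - wdeg (emb h a.1) a.2 = d by simp [wdeg], h1]
    · change prW K (wun m) 0 (zF (emb h a.1) a.2 y) = zF (emb h a.1) a.2 y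
      rw [(shW_zF (wun m) (emb h a.1) a.2).apply, hu, sub_zero, h2]

theorem exists_relS_of_omC {h : 2 * m ≤ N} {x : FM K N n} (hx : OmC K n tm x) (d : ℕ) :
    ∃ f, OpA f ∧ (prW K (wun m) 0 (prW K wdeg (d : ℤ) x), f) ∈ relS K n h d := by
  induction hx generalizing d with
  | vac =>
    obtain _ | d := d
    · refine ⟨prS K n 0 * 1, OpA.one.prS 0, ?_⟩
      rw [Nat.cast_zero, (wtIn_vF wdeg).prW_eq, (wtIn_vF (wun m)).prW_eq, mul_one]
      exact Submodule.mem_span_singleton_self _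
    · refine ⟨0, OpA.zero, ?_⟩
      have : prW K wdeg ((d + 1 : ℕ) : ℤ) (vF K N n) = 0 := by
        by_contra h0
        have := wtIn_vF wdeg _ h0
        simp only [Set.mem_singleton_iff] at this
        omega
      rw [this, map_zero]
      exact Submodule.zero_mem _
  | @om P Q x _ ih =>
    have hs : ShW wdeg (om K n tm P Q) 2 := shW_om tm fun r => rfl
    have hu : ShW (wun m) (om K n tm P Q)
        ((if P.val < 2 * m then 0 else 1) + if Q.val < 2 * m then 0 else 1) := shW_om tm fun r =>
            rfl
    rw [hs.apply, hu.apply]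
    have zero_case : ∀ y : FM K N n, y = 0 →
        ∃ f, OpA f ∧ (om K n tm P Q y, f) ∈ relS K n h d := fun y hy =>
      ⟨0, OpA.zero, by rw [hy, map_zero]; exact Submodule.zero_mem _⟩
    by_cases hd : d < 2
    · refine zero_case _ ?_
      rw [prW_of_neg (w := wdeg) (fun _ _ => zero_le_one) (by omega), map_zero]
    by_cases hP : P.val < 2 * m
    · by_cases hQ : Q.val < 2 * m
      · obtain ⟨d, rfl⟩ := Nat.exists_eq_add_of_le' (not_lt.1 hd)
        obtain ⟨f, hf, hxf⟩ := ih d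
        obtain ⟨a, rfl⟩ := exists_emb h hP
        obtain ⟨b, rfl⟩ := exists_emb h hQ
        rw [if_pos hP, if_pos hQ, add_zero, sub_zero, Nat.cast_add, Nat.cast_ofNat,
          add_sub_cancel_right]
        exact exists_relS_om hf hxf a b
      · exact zero_case _ (prW_of_neg wun_nonneg (by rw [if_pos hP, if_neg hQ]; decide) _)
    · exact zero_case _ (prW_of_neg wun_nonneg (by rw [if_neg hP]; split_ifs <;> decide) _)
  | add _ _ ih ih' =>
    obtain ⟨f, hf, hxf⟩ := ih d
    obtain ⟨g, hg, hyg⟩ := ih' d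
    refine ⟨f + g, hf.add hg, ?_⟩
    rw [map_add, map_add, ← Prod.mk_add_mk]
    exact Submodule.add_mem _ hxf hyg
  | smul c _ ih =>
    obtain ⟨f, hf, hxf⟩ := ih d
    refine ⟨c • f, hf.smul c, ?_⟩
    rw [map_smul, map_smul, ← Prod.smul_mk]
    exact Submodule.smul_mem _ c hxf

/-- The first fundamental theorem: homomorphisms between weight spaces are generated by the
quadratic operators. -/
theorem opA_of_pHom [CharZero K] {lam mu : Fin m → ℤ} {f : Module.End K (FM K m n)}
    (h1 : prS K n mu * f = f) (h2 : f * prS K n lam = f) (hf : PHom f) : OpA f := by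
  obtain ⟨d, hd⟩ := exists_mem_lev h1 h2
  obtain ⟨N, h, hN, h0⟩ : ∃ N, 2 * m ≤ N ∧ 2 * (n + d) ≤ N ∧ 0 < N :=
    ⟨2 * m + 2 * (n + d) + 1, by omega, by omega, by omega⟩
  obtain ⟨x, hx⟩ := exists_relL (Z := fun a : (Fin m × Bool) × Ix n => zF (emb h a.1) a.2)
    (v := vF K N n) hd
  obtain ⟨hx1, hx2⟩ := lev_wt (fst_mem_lev hx)
  have hO : OmC K n tm x :=
    omC_of_inv (d := d) h0 (by omega) (fun r s => relS_pX hx hf r s) hx1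
  obtain ⟨g, hg, hxg⟩ := exists_relS_of_omC hO d
  have hx1 : prW K wdeg (d : ℤ) x = x := hx1
  have hx2 : prW K (wun m) 0 x = x := hx2
  rw [hx1, hx2] at hxg
  have hs := Submodule.sub_mem _ hx hxg
  rw [Prod.mk_sub_mk, sub_self] at hs
  rw [sub_eq_zero.1 (snd_eq_zero (isCCR_FM h) isCCR_end vF_ne hs)]
  exact hg

end Operators

section Fullness

variable {K : Type} [Field K] [CharZero K] {m n : ℕ}

/-- The restrictions of `T` to the weight spaces come from the enveloping algebra. -/
def Adm (T : Module.End K (FM K m n)) : Prop := ∀ l, T * prS K n l ∈ (Psi K m n).range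

theorem Adm.mul {S T : Module.End K (FM K m n)} {w : Fin m → ℤ} (hS : Adm S) (hT : Adm T)
    (hw : Shifts T w) : Adm (S * T) := fun l => by
  have := mul_mem (hS (l + w)) (hT l)
  rwa [mul_assoc, ← mul_assoc (prS K n (l + w)), ← hw, mul_assoc, prS_prS, ← mul_assoc] at this

theorem Adm.sub {S T : Module.End K (FM K m n)} (hS : Adm S) (hT : Adm T) : Adm (S - T) :=
  fun l => by rw [sub_mul]; exact sub_mem (hS l) (hT l)

theorem Adm.smul {T : Module.End K (FM K m n)} (c : K) (hT : Adm T) : Adm (c • T) :=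
  fun l => by rw [smul_mul_assoc]; exact Subalgebra.smul_mem _ (hT l) c

theorem Adm.zero : Adm (0 : Module.End K (FM K m n)) :=
  fun l => by rw [zero_mul]; exact zero_mem _

theorem Adm.neg {T : Module.End K (FM K m n)} (hT : Adm T) : Adm (-T) := by
  rw [← zero_sub]
  exact Adm.zero.sub hT

theorem Adm.cmm {S T : Module.End K (FM K m n)} {v w : Fin m → ℤ} (hS : Adm S) (hT : Adm T)
    (hv : Shifts S v) (hw : Shifts T w) : Adm (S * T - T * S) :=
  (hS.mul hT hw).sub (hT.mul hS hv)

theorem prS_mem_range (l : Fin m → ℤ) : prS K n l ∈ (Psi K m n).range :=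
  ⟨_, Psi_gen (.idem l)⟩

theorem ActsBy.adm {x : WOp K m} {X : Module.End K (FM K m n)} (hx : ActsBy x X) : Adm X :=
  fun l => ⟨mkDt K m (x.op l), (Psi_mk _).trans (hx.1 l)⟩

theorem adm_gU_self (P : Fin m) : Adm (gU K (L := n) tz P P) := fun l => by
  rw [gU_self_prS]
  exact Subalgebra.smul_mem _ (prS_mem_range l) _

theorem adm_gU_up (d : ℕ) : ∀ P Q : Fin m, P.val + d + 1 = Q.val → Adm (gU K (L := n) tz P Q) := by
  induction d with
  | zero =>
    intro P Q h
    have := (rep_E (K := K) (n := n) (i := Q.val) ⟨by omega, Q.2⟩).adm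
    rwa [show (⟨Q.val - 1, by omega⟩ : Fin m) = P from Fin.ext (by simp only; omega)] at this
  | succ d ih =>
    intro P Q h
    have hR : P.val + 1 < m := by omega
    have h1 := rep_E (K := K) (n := n) (i := P.val + 1) ⟨by omega, hR⟩
    have := h1.adm.cmm (ih ⟨P.val + 1, hR⟩ Q (by simp only; omega)) (shifts_gU _ _) (shifts_gU _ _)
    rw [gU_cmm, if_pos rfl, if_neg (fun h0 => by
      have := congrArg Fin.val h0
      simp only at this
      omega), sub_zero] at this
    exact this

theorem adm_gU_down (d : ℕ) :
    ∀ P Q : Fin m, Q.val + d + 1 = P.val → Adm (gU K (L := n) tz P Q) := by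
  induction d with
  | zero =>
    intro P Q h
    have := (rep_F (K := K) (n := n) (i := P.val) ⟨by omega, P.2⟩).adm
    rwa [show (⟨P.val - 1, by omega⟩ : Fin m) = Q from Fin.ext (by simp only; omega)] at this
  | succ d ih =>
    intro P Q h
    have hR : Q.val + 1 < m := by omega
    have h1 := rep_F (K := K) (n := n) (i := Q.val + 1) ⟨by omega, hR⟩
    have := (ih P ⟨Q.val + 1, hR⟩ (by simp only; omega)).cmm h1.adm (shifts_gU _ _) (shifts_gU _ _)
    rw [gU_cmm, if_pos rfl, if_neg (fun h0 => by
      have := congrArg Fin.val h0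
      simp only at this
      omega), sub_zero] at this
    exact this

theorem adm_gU (P Q : Fin m) : Adm (gU K (L := n) tz P Q) := by
  rcases lt_trichotomy P.val Q.val with h | h | h
  · exact adm_gU_up (Q.val - P.val - 1) P Q (by omega)
  · rw [Fin.ext h]
    exact adm_gU_self Q
  · exact adm_gU_down (P.val - Q.val - 1) P Q (by omega)

theorem adm_bg_zero (hm : 0 < m) (Q : Fin m) : Adm (bg K n Q ⟨0, hm⟩) := by
  have h0 : Adm (bg K n (⟨0, hm⟩ : Fin m) ⟨0, hm⟩) := by
    have := (rep_B11 (K := K) (m := m) (n := n)).adm.smul 2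
    rwa [dif_pos hm, smul_smul, mul_inv_cancel₀ two_ne_zero, one_smul] at this
  have := (h0.cmm (adm_gU ⟨0, hm⟩ Q) (shifts_bg _ _) (shifts_gU _ _)).smul (2⁻¹ : K)
  rwa [bg_gU_cmm, if_pos rfl, if_pos rfl, bg_symm _ Q, ← two_smul K, smul_smul,
    inv_mul_cancel₀ two_ne_zero, one_smul] at this

theorem adm_bg (P Q : Fin m) : Adm (bg K n P Q) := by
  have hm : 0 < m := P.pos
  by_cases hP : P = ⟨0, hm⟩
  · rw [hP, bg_symm]
    exact adm_bg_zero hm Q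
  · have := (adm_bg_zero (K := K) (n := n) hm P).cmm (adm_gU ⟨0, hm⟩ Q) (shifts_bg _ _)
      (shifts_gU _ _)
    rwa [bg_gU_cmm, if_neg (Ne.symm hP), if_pos rfl, zero_add] at this

theorem adm_om_zero (hm : 0 < m) (Q : Fin m) : Adm (om K n tz ⟨0, hm⟩ Q) := by
  by_cases hQ : Q = ⟨0, hm⟩
  · rw [hQ, om_self]
    exact Adm.zero
  · have h1 : 1 < m := by
      by_contra h
      exact hQ (Fin.ext (by simp only; omega))
    have h2 := (rep_C (K := K) (n := n) (i := 1) ⟨le_rfl, h1⟩).adm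
    have := (adm_gU Q ⟨1, h1⟩).cmm h2 (shifts_gU _ _) (shifts_om _ _)
    rw [gU_om_cmm, if_neg (fun h0 => by
      have := congrArg Fin.val h0
      simp only at this
      omega), if_pos rfl, zero_add] at this
    exact this

theorem adm_om (P Q : Fin m) : Adm (om K n tz P Q) := by
  have hm : 0 < m := P.pos
  by_cases hQ : Q = ⟨0, hm⟩
  · rw [hQ, om_swap]
    exact (adm_om_zero hm P).neg
  · have := (adm_gU P ⟨0, hm⟩).cmm (adm_om_zero (K := K) (n := n) hm Q) (shifts_gU _ _)
      (shifts_om _ _)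
    rwa [gU_om_cmm, if_pos rfl, if_neg (Ne.symm hQ), add_zero] at this

variable (K m n) in
/-- The span of the operators with values in a single weight space in the image of the enveloping
algebra. -/
noncomputable def imS : Submodule K (Module.End K (FM K m n)) :=
  Submodule.span K {x | x ∈ (Psi K m n).range ∧ ∃ l, prS K n l * x = x}

theorem imS_le : imS K m n ≤ Subalgebra.toSubmodule (Psi K m n).range :=
  Submodule.span_le.2 fun _ hx => hx.1

theorem Adm.mul_mem {T x : Module.End K (FM K m n)} {w : Fin m → ℤ} (hT : Adm T) (hw : Shifts T w)
    (hx : x ∈ imS K m n) : T * x ∈ imS K m n := by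
  induction hx using Submodule.span_induction with
  | mem x hx =>
    obtain ⟨h, l, hl⟩ := hx
    refine Submodule.subset_span ⟨?_, l + w, ?_⟩
    · rw [← hl, ← mul_assoc]
      exact MulMemClass.mul_mem (hT l) h
    · rw [← mul_assoc, ← hw, mul_assoc, hl]
  | zero => rw [mul_zero]; exact Submodule.zero_mem _
  | add x y _ _ hx hy => rw [mul_add]; exact Submodule.add_mem _ hx hy
  | smul c x _ hx => rw [mul_smul_comm]; exact Submodule.smul_mem _ c hx

theorem prS_mul_mem_imS (l : Fin m → ℤ) {x : Module.End K (FM K m n)} (hx : x ∈ imS K m n) :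
    prS K n l * x ∈ imS K m n := by
  induction hx using Submodule.span_induction with
  | mem x hx =>
    refine Submodule.subset_span ⟨MulMemClass.mul_mem (prS_mem_range l) hx.1, l, ?_⟩
    rw [← mul_assoc, prS_prS]
  | zero => rw [mul_zero]; exact Submodule.zero_mem _
  | add x y _ _ hx hy => rw [mul_add]; exact Submodule.add_mem _ hx hy
  | smul c x _ hx => rw [mul_smul_comm]; exact Submodule.smul_mem _ c hx

theorem OpA.mul_prS_mem {f : Module.End K (FM K m n)} (hf : OpA f) (l : Fin m → ℤ) :
    f * _root_.prS K n l ∈ imS K m n := by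
  induction hf with
  | one =>
    rw [one_mul]
    exact Submodule.subset_span ⟨prS_mem_range l, l, prS_prS l⟩
  | gU P Q _ ih => rw [mul_assoc]; exact (adm_gU P Q).mul_mem (shifts_gU P Q) ih
  | om P Q _ ih => rw [mul_assoc]; exact (adm_om P Q).mul_mem (shifts_om P Q) ih
  | bg P Q _ ih => rw [mul_assoc]; exact (adm_bg P Q).mul_mem (shifts_bg P Q) ih
  | prS κ _ ih => rw [mul_assoc]; exact prS_mul_mem_imS κ ih
  | add _ _ ih ih' => rw [add_mul]; exact Submodule.add_mem _ ih ih'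
  | smul c _ ih => rw [smul_mul_assoc]; exact Submodule.smul_mem _ c ih

/-- Every homomorphism between weight spaces comes from the enveloping algebra. -/
theorem exists_of_pHom (lam mu : Fin m → ℤ) (f : Module.End K (FM K m n))
    (h1 : prS K n mu * f = f) (h2 : f * prS K n lam = f) (hf : PHom f) :
    ∃ u : Udt K m, prS K n mu * Psi K m n u * prS K n lam = f := by
  obtain ⟨u, hu⟩ := imS_le ((opA_of_pHom h1 h2 hf).mul_prS_mem lam)
  have hu : Psi K m n u = f * prS K n lam := hu
  exact ⟨u, by rw [hu, h2, h1, h2]⟩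

end Fullness

/-- for every `m, n ≥ 1` there is an essentially surjective,
full `k`-linear superfunctor `Udot(p̃(m)) → p(n)-mod_{S,m}` sending an object
`λ = Σ λ_i ε_i ∈ X(T_m)_{≥0}` to `S^{λ_1}(V_n) ⊗ ⋯ ⊗ S^{λ_m}(V_n)` and every
`λ ∉ X(T_m)_{≥0}` to the zero module.

Formally: there is an algebra homomorphism `Ψ` from the (unital hull of the)
locally unital algebra `U̇(p̃(m))` to `End_k(A)`, `A = S(V_n)^{⊗m}`, such that
`Ψ(1_λ)` is the projection onto the summand `S^λ(V_n)` (which is zero when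
`λ ∉ X(T_m)_{≥0}`); each generating morphism acts by a `p(n)`-module
homomorphism of the correct parity (so `Ψ` defines a superfunctor to
`p(n)-mod_{S,m}`); every object of `p(n)-mod_{S,m}` is (equal to, hence
isomorphic to) the image of an object (essential surjectivity); and every
`p(n)`-module homomorphism `S^λ(V_n) → S^μ(V_n)` is the image of a morphism
`λ → μ` (fullness). -/
theorem statement11 (k : Type) [Field k] [CharZero k] [IsAlgClosed k]
    (m n : ℕ) (hm : 1 ≤ m) (hn : 1 ≤ n) :
    ∃ Ψ : Udt k m →ₐ[k] Module.End k (SM k m n),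
      -- objects: weight idempotents act as the projections onto the S^λ(V_n)
      (∀ l : Fin m → ℤ, Ψ (mkDt k m (iId k m l)) = projP k m n l) ∧
      -- morphisms act by p(n)-module homomorphisms …
      (∀ g : DGen m, IsPnHom k m n (Ψ (mkDt k m (FreeAlgebra.ι k g)))) ∧
      -- … of the correct parity (Ψ is a superfunctor)
      (∀ i l, IsEvenOp k m n (Ψ (mkDt k m (FreeAlgebra.ι k (DGen.ge i l))))) ∧
      (∀ i l, IsEvenOp k m n (Ψ (mkDt k m (FreeAlgebra.ι k (DGen.gf i l))))) ∧
      (∀ l, IsOddOp k m n (Ψ (mkDt k m (FreeAlgebra.ι k (DGen.gb11 l))))) ∧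
      (∀ i l, IsOddOp k m n (Ψ (mkDt k m (FreeAlgebra.ι k (DGen.gb i l))))) ∧
      (∀ i l, IsOddOp k m n (Ψ (mkDt k m (FreeAlgebra.ι k (DGen.gc i l))))) ∧
      -- essential surjectivity
      (∀ a : Fin m → ℕ, ∃ l : Fin m → ℤ, (∀ i, 0 ≤ l i) ∧
        LinearMap.range (Ψ (mkDt k m (iId k m l)))
          = LinearMap.range (projP k m n fun i => (a i : ℤ))) ∧
      -- fullness
      (∀ lam mu : Fin m → ℤ, (∀ i, 0 ≤ lam i) → (∀ i, 0 ≤ mu i) →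
        ∀ f : Module.End k (SM k m n),
          projP k m n mu * f = f → f * projP k m n lam = f → IsPnHom k m n f →
          ∃ u : Udt k m,
            Ψ (mkDt k m (iId k m mu) * u * mkDt k m (iId k m lam)) = f) := by
  exact functor_of_full exists_of_pHom
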